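/- arXiv:2301.08701 — 2 statements merged into one kernel-verified Lean document; each statement's English description precedes it below -/
import Mathlib

section
/- Let n = p₁^{r₁} p₂^{r₂} ⋯ p_k^{r_k} where the p_i are distinct primes and r_i ≥ 1 for every i. Then every finite poset P whose automorphism group is cyclic of order n has at least (Σ_{i=1}^k b(p_i^{r_i})·p_i^{r_i}) − 1 points if 3 ∥ n and 4 ∥ n, and at least Σ_{i=1}^k b(p_i^{r_i})·p_i^{r_i} points otherwise. -/
/-- `b` on prime powers: `b 1 = 0`, `b 2 = 1`, `b 3 = b 4 = b 5 = b 7 = 3`,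
and `b (p^r) = 2` for every other prime power. -/
def b (q : ℕ) : ℕ :=
  if q = 1 then 0
  else if q = 2 then 1
  else if q = 3 ∨ q = 4 ∨ q = 5 ∨ q = 7 then 3
  else 2

/-- A prime power `q = p^r` exactly divides `n` if `q ∣ n` and `p^(r+1) = q * p ∤ n`. -/
def ExactDvd (q n : ℕ) : Prop := q ∣ n ∧ ¬ (q * q.minFac ∣ n)

instance (q n : ℕ) : Decidable (ExactDvd q n) :=
  inferInstanceAs (Decidable (q ∣ n ∧ ¬ (q * q.minFac ∣ n)))

/-- The automorphism `g` of `P` satisfies `g ^ n = 1` and generates the automorphism group. -/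
structure GeneratesAut {P : Type} [PartialOrder P] (g : P ≃o P) (n : ℕ) : Prop where
  pos : 0 < n
  pow_eq_one : g ^ n = 1
  exists_pow : ∀ φ : P ≃o P, ∃ k : ℕ, φ = g ^ k

/-- `y` lies in the forward orbit of `x` under `g`. -/
def InOrbit {P : Type} [PartialOrder P] (g : P ≃o P) (x y : P) : Prop :=
  ∃ k : ℕ, g ^ k • x = y

section Poset

open MulAction

variable {P : Type} [PartialOrder P] {g : P ≃o P} {n : ℕ}

theorem smul_le_smul_iff_orderIso (φ : P ≃o P) (x y : P) : φ • x ≤ φ • y ↔ x ≤ y :=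
  φ.le_iff_le

theorem InOrbit.refl (x : P) : InOrbit g x x := ⟨0, by simp⟩

theorem InOrbit.pow (x : P) (k : ℕ) : InOrbit g x (g ^ k • x) := ⟨k, rfl⟩

theorem InOrbit.trans {x y z : P} (h : InOrbit g x y) (h' : InOrbit g y z) : InOrbit g x z := by
  obtain ⟨k, rfl⟩ := h
  obtain ⟨j, rfl⟩ := h'
  exact ⟨j + k, by rw [pow_add, mul_smul]⟩

theorem GeneratesAut.period_dvd (hg : GeneratesAut g n) (z : P) : period g z ∣ n := by
  rw [← pow_smul_eq_iff_period_dvd, hg.pow_eq_one, one_smul]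

theorem InOrbit.symm (hg : GeneratesAut g n) {x y : P} (h : InOrbit g x y) : InOrbit g y x := by
  obtain ⟨k, rfl⟩ := h
  refine ⟨n * k - k, ?_⟩
  have : k ≤ n * k := Nat.le_mul_of_pos_left k hg.pos
  rw [← mul_smul, ← pow_add, Nat.sub_add_cancel this, pow_mul, hg.pow_eq_one, one_pow, one_smul]

theorem InOrbit.period_eq {x y : P} (h : InOrbit g x y) : period g y = period g x := by
  obtain ⟨k, rfl⟩ := h
  have key (m : ℕ) : g ^ m • g ^ k • x = g ^ k • x ↔ g ^ m • x = x := by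
    rw [← mul_smul, ← pow_add, add_comm, pow_add, mul_smul, smul_left_cancel_iff]
  apply Nat.dvd_antisymm
  · rw [← pow_smul_eq_iff_period_dvd, key, pow_smul_eq_iff_period_dvd]
  · rw [← pow_smul_eq_iff_period_dvd, ← key, pow_smul_eq_iff_period_dvd]

theorem InOrbit.eq_of_le (hg : GeneratesAut g n) {x y : P} (h : InOrbit g x y) (hle : x ≤ y) :
    x = y := by
  obtain ⟨k, rfl⟩ := h
  have hmono (j : ℕ) : g ^ k • x ≤ (g ^ k) ^ (j + 1) • x := by
    induction j with
    | zero => simp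
    | succ j ih =>
      rw [pow_succ', mul_smul]
      exact (smul_le_smul_iff_orderIso _ _ _).2 (hle.trans ih)
  apply le_antisymm hle
  have := hmono (n - 1)
  rwa [Nat.sub_add_cancel hg.pos, ← pow_mul, mul_comm, pow_mul, hg.pow_eq_one, one_pow,
    one_smul] at this

theorem modEq_period_of_pow_smul_eq {x : P} {j k : ℕ}
    (h : g ^ j • x = g ^ k • x) : j ≡ k [MOD period g x] := by
  wlog hjk : j ≤ k generalizing j k
  · exact (this h.symm (le_of_not_ge hjk)).symm
  obtain ⟨d, rfl⟩ := Nat.exists_eq_add_of_le hjk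
  rw [pow_add, mul_smul, smul_left_cancel_iff, eq_comm, pow_smul_eq_iff_period_dvd] at h
  exact (Nat.modEq_iff_dvd' hjk).2 (by simpa using h)

/-- A coordinate modulo `q` on the points of period divisible by `q`. -/
theorem GeneratesAut.exists_coordinate (hg : GeneratesAut g n) (q : ℕ) :
    ∃ κ : P → ZMod q, ∀ z, q ∣ period g z → ∀ k : ℕ, κ (g ^ k • z) = κ z + k := by
  let s : Setoid P := ⟨InOrbit g, InOrbit.refl, InOrbit.symm hg, InOrbit.trans⟩
  have hrep (z : P) : InOrbit g (Quotient.mk s z).out z := Quotient.mk_out (s := s) z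
  choose c hc using hrep
  refine ⟨fun z ↦ c z, fun z hz k ↦ ?_⟩
  have hq : Quotient.mk s (g ^ k • z) = Quotient.mk s z :=
    Quotient.sound (s := s) (InOrbit.symm hg (InOrbit.pow z k))
  have h1 := hc (g ^ k • z)
  rw [hq] at h1
  have h2 : g ^ (k + c z) • (Quotient.mk s z).out = g ^ k • z := by
    rw [pow_add, mul_smul, hc]
  have h3 := modEq_period_of_pow_smul_eq (h1.trans h2.symm)
  rw [← InOrbit.period_eq ⟨_, hc z⟩] at h3
  have h4 := (ZMod.natCast_eq_natCast_iff _ _ _).2 (h3.of_dvd hz)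
  simp only [h4]
  push_cast
  ring

/-- Comparability of two orbits whose periods have greatest common divisor `q` only depends on the
difference of the coordinates modulo `q`. -/
theorem le_iff_le_of_gcd {q : ℕ} {κ : P → ZMod q}
    (hκ : ∀ z, q ∣ period g z → ∀ k : ℕ, κ (g ^ k • z) = κ z + k) {z z' t t' : P}
    (hgcd : Nat.gcd (period g z) (period g z') = q) (ht : InOrbit g z t) (ht' : InOrbit g z' t')
    (h : κ t' - κ t = κ z' - κ z) : t ≤ t' ↔ z ≤ z' := by
  obtain ⟨i, rfl⟩ := ht
  obtain ⟨j, rfl⟩ := ht'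
  have hz : q ∣ period g z := by
    rw [← hgcd]
    exact Nat.gcd_dvd_left _ _
  have hz' : q ∣ period g z' := by
    rw [← hgcd]
    exact Nat.gcd_dvd_right _ _
  rw [hκ _ hz, hκ _ hz'] at h
  have hij : i ≡ j [MOD Nat.gcd (period g z) (period g z')] := by
    rw [hgcd, ← ZMod.natCast_eq_natCast_iff]
    linear_combination -h
  obtain ⟨k, hk, hk'⟩ := Nat.chineseRemainder' hij
  have aux {u : P} {a b : ℕ} (hab : a ≡ b [MOD period g u]) : g ^ a • u = g ^ b • u := by
    rw [← pow_mod_period_smul, hab, pow_mod_period_smul]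
  rw [← aux hk, ← aux hk', smul_le_smul_iff_orderIso]

/-- An order automorphism which multiplies coordinates by `l`, up to translations on each orbit,
can only exist for `l = 1`. -/
theorem GeneratesAut.eq_one_of_twist [Finite P] (hg : GeneratesAut g n) {q : ℕ} [NeZero q]
    {κ : P → ZMod q} (hκ : ∀ z, q ∣ period g z → ∀ k : ℕ, κ (g ^ k • z) = κ z + k)
    {m : ℕ} (hm : (m : ZMod q) = 1) {l : ZMod q} (hl : IsUnit l) {a : P → ZMod q}
    (ha : ∀ z z', InOrbit g z z' → a z' = a z) {x : P} (hx : q ∣ period g x)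
    (hout : ∀ z z', q ∣ period g z → ¬ q ∣ period g z' →
      (z ≤ z' ↔ (g ^ m) ^ ((l - 1) * κ z + a z).val • z ≤ z') ∧
      (z' ≤ z ↔ z' ≤ (g ^ m) ^ ((l - 1) * κ z + a z).val • z))
    (hin : ∀ z z', q ∣ period g z → q ∣ period g z' → ¬ InOrbit g z z' →
      (z ≤ z' ↔ (g ^ m) ^ ((l - 1) * κ z + a z).val • z ≤
        (g ^ m) ^ ((l - 1) * κ z' + a z').val • z')) : l = 1 := by
  classical
  have hκw (z : P) (hz : q ∣ period g z) (e : ZMod q) :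
      κ ((g ^ m) ^ e.val • z) = κ z + e := by
    rw [← pow_mul, hκ z hz, Nat.cast_mul, hm, ZMod.natCast_zmod_val, one_mul]
  have horb (z : P) (e : ℕ) : InOrbit g z ((g ^ m) ^ e • z) := by
    rw [← pow_mul]
    exact InOrbit.pow _ _
  set e : P → ZMod q := fun z ↦ (l - 1) * κ z + a z with he
  let f : P → P := fun z ↦ if q ∣ period g z then (g ^ m) ^ (e z).val • z else z
  have hf1 (z : P) (hz : q ∣ period g z) : f z = (g ^ m) ^ (e z).val • z := if_pos hz
  have hf2 (z : P) (hz : ¬ q ∣ period g z) : f z = z := if_neg hz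
  have hle (z z' : P) : f z ≤ f z' ↔ z ≤ z' := by
    by_cases hz : q ∣ period g z <;> by_cases hz' : q ∣ period g z'
    · by_cases hzz : InOrbit g z z'
      · have hzf : InOrbit g (f z) (f z') := by
          rw [hf1 z hz, hf1 z' hz']
          exact ((horb z _).symm hg).trans (hzz.trans (horb z' _))
        constructor
        · intro h
          have h2 := hzf.eq_of_le hg h
          have h3 := congrArg κ h2
          rw [hf1 z hz, hf1 z' hz', hκw z hz, hκw z' hz'] at h3
          simp only [he, ha z z' hzz] at h3
          have h4 : l * κ z = l * κ z' := by linear_combination h3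
          have h5 := hl.mul_left_cancel h4
          rw [hf1 z hz, hf1 z' hz'] at h2
          simp only [he, ha z z' hzz, h5, smul_left_cancel_iff] at h2
          exact h2.le
        · intro h
          rw [hzz.eq_of_le hg h]
      · rw [hf1 z hz, hf1 z' hz']
        exact (hin z z' hz hz' hzz).symm
    · rw [hf1 z hz, hf2 z' hz']
      exact (hout z z' hz hz').1.symm
    · rw [hf2 z hz, hf1 z' hz']
      exact (hout z' z hz' hz).2.symm
    · rw [hf2 z hz, hf2 z' hz']
  have hinj : Function.Injective f := fun z z' h ↦
    le_antisymm ((hle z z').1 h.le) ((hle z' z).1 h.ge)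
  let φ : P ≃o P := ⟨Equiv.ofBijective f (Finite.injective_iff_bijective.1 hinj), hle _ _⟩
  obtain ⟨k, hk⟩ := hg.exists_pow φ
  have hφ (z : P) : f z = g ^ k • z := by
    rw [← hk]
    rfl
  have hconst (z : P) (hz : q ∣ period g z) : e z = k := by
    have := congrArg κ (hφ z)
    rw [hf1 z hz, hκw z hz, hκ z hz] at this
    simpa using this
  have h0 := hconst x hx
  have h1 := hconst (g ^ 1 • x) (by rwa [(InOrbit.pow x 1).period_eq])
  simp only [he] at h0 h1
  rw [hκ x hx, ha x _ (InOrbit.pow x 1)] at h1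
  push_cast at h1
  linear_combination h1 - h0

end Poset

section Orbits

open MulAction

variable {P : Type} [PartialOrder P] {g : P ≃o P} {n : ℕ}

theorem exists_multiplier {p r n : ℕ} (hp : p.Prime) (hr : 1 ≤ r) (hq : p ^ r ∣ n)
    (hq' : ¬ p ^ (r + 1) ∣ n) :
    ∃ m : ℕ, m ≡ 1 [MOD p ^ r] ∧
      ∀ d, d ∣ n → ¬ p ^ r ∣ d → d ∣ m * p ^ (r - 1) := by
  obtain ⟨s, rfl⟩ := hq
  have hps : p.Coprime s := by
    rw [hp.coprime_iff_not_dvd]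
    rintro ⟨t, rfl⟩
    exact hq' ⟨t, by ring⟩
  obtain ⟨m, hm, hm'⟩ := Nat.chineseRemainder (hps.pow_left r) 1 0
  refine ⟨m, hm, fun d hd hqd ↦ ?_⟩
  obtain ⟨d₁, d₂, h₁, h₂, rfl⟩ := Nat.dvd_mul.1 hd
  obtain ⟨j, hj, rfl⟩ := (Nat.dvd_prime_pow hp).1 h₁
  have hjr : j ≤ r - 1 := by
    by_contra hlt
    obtain rfl : j = r := by omega
    exact hqd (dvd_mul_right _ _)
  rw [mul_comm]
  exact mul_dvd_mul (h₂.trans ((Nat.modEq_zero_iff_dvd).1 hm')) (pow_dvd_pow p hjr)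

theorem le_iff_smul_le_of_fixed {φ : P ≃o P} {z' : P} (h : φ • z' = z') (z : P) :
    (z ≤ z' ↔ φ • z ≤ z') ∧ (z' ≤ z ↔ z' ≤ φ • z) := by
  have h1 := smul_le_smul_iff_orderIso φ z z'
  have h2 := smul_le_smul_iff_orderIso φ z' z
  rw [h] at h1 h2
  exact ⟨h1.symm, h2.symm⟩

theorem pow_pow_smul_eq {m e k : ℕ} {z : P} (h : period g z ∣ m * k) (he : k ∣ e) :
    (g ^ m) ^ e • z = z := by
  rw [← pow_mul, pow_smul_eq_iff_period_dvd]
  exact h.trans (mul_dvd_mul_left m he)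

theorem exists_dvd_period (hord : orderOf g = n) {p r : ℕ} (hp : p.Prime)
    (hr : 1 ≤ r) (hq : p ^ r ∣ n) (hq' : ¬ p ^ (r + 1) ∣ n) : ∃ z : P, p ^ r ∣ period g z := by
  by_contra! hcon
  obtain ⟨m, hm, hmd⟩ := exists_multiplier hp hr hq hq'
  have h1 : g ^ (m * p ^ (r - 1)) = 1 := by
    ext z
    exact pow_smul_eq_iff_period_dvd.2
      (hmd _ ((period_dvd_orderOf g z).trans (by rw [hord])) (hcon z))
  have h2 := orderOf_dvd_of_pow_eq_one h1
  rw [hord] at h2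
  have h3 := hq.trans h2
  have hmp : (p ^ r).Coprime m := by
    rw [Nat.coprime_comm, Nat.Coprime, hm.gcd_eq, Nat.gcd_one_left]
  have h4 := hmp.dvd_of_dvd_mul_left h3
  have h5 := (Nat.pow_dvd_pow_iff_le_right hp.one_lt).1 h4
  omega

/-- A prime power other than `2` exactly dividing `n` divides the lengths of two distinct orbits. -/
theorem GeneratesAut.exists_not_inOrbit [Finite P] (hg : GeneratesAut g n) {p r : ℕ}
    (hp : p.Prime) (hr : 1 ≤ r) (hq : p ^ r ∣ n) (hq' : ¬ p ^ (r + 1) ∣ n) (h2 : p ^ r ≠ 2)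
    {x : P} (hx : p ^ r ∣ period g x) : ∃ y, p ^ r ∣ period g y ∧ ¬ InOrbit g x y := by
  by_contra! hcon
  obtain ⟨m, hm, hmd⟩ := exists_multiplier hp hr hq hq'
  replace hm : (m : ZMod (p ^ r)) = 1 := by
    simpa using (ZMod.natCast_eq_natCast_iff _ _ _).2 hm
  obtain ⟨κ, hκ⟩ := hg.exists_coordinate (p ^ r)
  have : NeZero (p ^ r) := ⟨(pow_pos hp.pos r).ne'⟩
  have hunit : IsUnit (1 + ((p ^ (r - 1) : ℕ) : ZMod (p ^ r))) := by
    have : (1 + ((p ^ (r - 1) : ℕ) : ZMod (p ^ r))) = ((1 + p ^ (r - 1) : ℕ) : ZMod (p ^ r)) := by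
      push_cast
      rfl
    rw [this, ZMod.isUnit_iff_coprime]
    apply Nat.Coprime.pow_right
    rw [Nat.coprime_comm, hp.coprime_iff_not_dvd]
    intro hdvd
    rcases Nat.eq_or_lt_of_le hr with h | h
    · subst h
      simp only [Nat.sub_self, pow_zero] at hdvd
      have := (Nat.prime_dvd_prime_iff_eq hp Nat.prime_two).1 hdvd
      simp [this] at h2
    · have h3 : p ∣ p ^ (r - 1) := dvd_pow_self p (by omega)
      exact hp.one_lt.ne' (Nat.dvd_one.1 ((Nat.dvd_add_left h3).1 hdvd))
  have hl := hg.eq_one_of_twist hκ hm hunit (a := fun _ ↦ 0) (fun _ _ _ ↦ rfl) hx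
    (fun z z' hz hz' ↦ ?_) (fun z z' hz hz' hzz ↦ ?_)
  · have h3 : ((p ^ (r - 1) : ℕ) : ZMod (p ^ r)) = 0 := by linear_combination hl
    rw [ZMod.natCast_eq_zero_iff, Nat.pow_dvd_pow_iff_le_right hp.one_lt] at h3
    omega
  · refine le_iff_smul_le_of_fixed (pow_pow_smul_eq (hmd _ (hg.period_dvd _) hz') ?_) z
    rw [← ZMod.natCast_eq_zero_iff, ZMod.natCast_val]
    have hd : p ^ (r - 1) ∣ p ^ r := pow_dvd_pow p (Nat.sub_le _ _)
    rw [ZMod.cast_add hd, ZMod.cast_mul hd, ZMod.cast_sub hd, ZMod.cast_add hd,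
      ZMod.cast_natCast hd]
    simp
  · exact absurd (((hcon z hz).symm hg).trans (hcon z' hz')) hzz

theorem GeneratesAut.not_le_or_not_le (hg : GeneratesAut g n) {x y : P} (hxy : ¬ InOrbit g x y) :
    (∀ z z', InOrbit g x z → InOrbit g y z' → ¬ z' ≤ z) ∨
      (∀ z z', InOrbit g y z → InOrbit g x z' → ¬ z' ≤ z) := by
  by_contra! hcon
  obtain ⟨⟨z, z', hz, hz', h⟩, ⟨t, t', ht, ht', h'⟩⟩ := hcon
  obtain ⟨k, rfl⟩ := (hz.symm hg).trans ht'
  have h1 : g ^ k • z' ≤ t := ((smul_le_smul_iff_orderIso _ _ _).2 h).trans h'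
  have h2 := (((InOrbit.pow z' k).symm hg).trans ((hz'.symm hg).trans ht)).eq_of_le hg h1
  have h3 : g ^ k • z = t := le_antisymm h' (h2 ▸ (smul_le_smul_iff_orderIso (g ^ k) z' z).2 h)
  exact hxy (ht'.trans ((h3 ▸ ht).symm hg))

theorem GeneratesAut.exists_difference_set (hg : GeneratesAut g n) {q : ℕ} {κ : P → ZMod q}
    (hκ : ∀ z, q ∣ period g z → ∀ k : ℕ, κ (g ^ k • z) = κ z + k) {x y : P}
    (hgcd : Nat.gcd (period g x) (period g y) = q) :
    ∃ S : ZMod q → Bool, ∀ z z', InOrbit g x z → InOrbit g y z' →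
      (z ≤ z' ↔ S (κ z' - κ z) = true) := by
  classical
  refine ⟨fun d ↦ decide (∃ z z', InOrbit g x z ∧ InOrbit g y z' ∧ κ z' - κ z = d ∧ z ≤ z'),
    fun z z' hz hz' ↦ ?_⟩
  rw [decide_eq_true_eq]
  refine ⟨fun h ↦ ⟨z, z', hz, hz', rfl, h⟩, ?_⟩
  rintro ⟨t, t', ht, ht', h, hle⟩
  refine (le_iff_le_of_gcd hκ ?_ ((ht.symm hg).trans hz) ((ht'.symm hg).trans hz') h.symm).2 hle
  rw [ht.period_eq, ht'.period_eq, hgcd]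

theorem GeneratesAut.eq_one_of_two_orbits [Finite P] (hg : GeneratesAut g n) {q : ℕ} [NeZero q]
    {κ : P → ZMod q} (hκ : ∀ z, q ∣ period g z → ∀ k : ℕ, κ (g ^ k • z) = κ z + k)
    {m : ℕ} (hm : (m : ZMod q) = 1) {l : ZMod q} (hl : IsUnit l) {x y : P}
    (hx : q ∣ period g x) (hxy : ¬ InOrbit g x y)
    (hU : ∀ z, q ∣ period g z → InOrbit g x z ∨ InOrbit g y z)
    (hno : ∀ z z', InOrbit g x z → InOrbit g y z' → ¬ z' ≤ z)
    {S : ZMod q → Bool} (hS : ∀ z z', InOrbit g x z → InOrbit g y z' →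
      (z ≤ z' ↔ S (κ z' - κ z) = true)) {a b : ZMod q} (hSl : ∀ d, S (l * d + (b - a)) = S d)
    (hX : ∀ z z', InOrbit g x z → ¬ q ∣ period g z' →
      (z ≤ z' ↔ (g ^ m) ^ ((l - 1) * κ z + a).val • z ≤ z') ∧
      (z' ≤ z ↔ z' ≤ (g ^ m) ^ ((l - 1) * κ z + a).val • z))
    (hY : ∀ z z', InOrbit g y z → ¬ q ∣ period g z' →
      (z ≤ z' ↔ (g ^ m) ^ ((l - 1) * κ z + b).val • z ≤ z') ∧
      (z' ≤ z ↔ z' ≤ (g ^ m) ^ ((l - 1) * κ z + b).val • z)) : l = 1 := by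
  classical
  have hxyz {z : P} (h : InOrbit g y z) : ¬ InOrbit g x z := fun h' ↦ hxy (h'.trans (h.symm hg))
  have hκw (z : P) (hz : q ∣ period g z) (e : ZMod q) :
      κ ((g ^ m) ^ e.val • z) = κ z + e := by
    rw [← pow_mul, hκ z hz, Nat.cast_mul, hm, ZMod.natCast_zmod_val, one_mul]
  have horb (z : P) (e : ℕ) : InOrbit g z ((g ^ m) ^ e • z) := by
    rw [← pow_mul]
    exact InOrbit.pow _ _
  refine hg.eq_one_of_twist hκ hm hl (a := fun z ↦ if InOrbit g x z then a else b)
    (fun z z' h ↦ ?_) hx (fun z z' hz hz' ↦ ?_) (fun z z' hz hz' hzz ↦ ?_)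
  · have : InOrbit g x z' ↔ InOrbit g x z := ⟨fun h' ↦ h'.trans (h.symm hg), fun h' ↦ h'.trans h⟩
    simp only [this]
  · rcases hU z hz with h | h
    · simp only [if_pos h]
      exact hX z z' h hz'
    · simp only [if_neg (hxyz h)]
      exact hY z z' h hz'
  · rcases hU z hz with h | h <;> rcases hU z' hz' with h' | h'
    · exact absurd ((h.symm hg).trans h') hzz
    · simp only [if_pos h, if_neg (hxyz h')]
      rw [hS z z' h h', hS _ _ (h.trans (horb _ _)) (h'.trans (horb _ _)), hκw z hz, hκw z' hz',
        ← hSl (κ z' - κ z)]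
      ring_nf
    · simp only [if_pos h', if_neg (hxyz h)]
      exact iff_of_false (hno z' z h' h) (hno _ _ (h'.trans (horb _ _)) (h.trans (horb _ _)))
    · exact absurd ((h.symm hg).trans h') hzz

/-- If a prime `q` is such that every subset of `ZMod q` has a nontrivial affine symmetry, and only
two orbits have length divisible by `q`, then their lengths share more than the factor `q`. -/
theorem GeneratesAut.gcd_period_ne [Finite P] (hg : GeneratesAut g n) {q : ℕ} (hp : q.Prime)
    (hq : q ∣ n) (hq' : ¬ q ^ 2 ∣ n)
    (hsym : ∀ S : ZMod q → Bool, ∃ l c : ZMod q, IsUnit l ∧ l ≠ 1 ∧ ∀ a, S (l * a + c) = S a)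
    {x y : P} (hx : q ∣ period g x) (hxy : ¬ InOrbit g x y)
    (hU : ∀ z, q ∣ period g z → InOrbit g x z ∨ InOrbit g y z) :
    Nat.gcd (period g x) (period g y) ≠ q := by
  intro hgcd
  wlog hno : ∀ z z', InOrbit g x z → InOrbit g y z' → ¬ z' ≤ z generalizing x y
  · refine this (x := y) (y := x) ?_ (fun h ↦ hxy (h.symm hg)) (fun z hz ↦ (hU z hz).symm)
      (by rwa [Nat.gcd_comm]) ((hg.not_le_or_not_le hxy).resolve_left hno)
    rw [← hgcd]
    exact Nat.gcd_dvd_right _ _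
  obtain ⟨m, hm, hmd⟩ := exists_multiplier (r := 1) hp le_rfl (by simpa using hq)
    (by simpa using hq')
  simp only [pow_one] at hm hmd
  replace hm : (m : ZMod q) = 1 := by
    simpa using (ZMod.natCast_eq_natCast_iff _ _ _).2 hm
  have : NeZero q := ⟨hp.pos.ne'⟩
  obtain ⟨κ, hκ⟩ := hg.exists_coordinate q
  obtain ⟨S, hS⟩ := hg.exists_difference_set hκ hgcd
  obtain ⟨l, c, hl, hl1, hlc⟩ := hsym S
  have hfix (e : ℕ) (z z' : P) (hz' : ¬ q ∣ period g z') :=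
    le_iff_smul_le_of_fixed (pow_pow_smul_eq (e := e) (hmd _ (hg.period_dvd _) hz') (by simp)) z
  exact hl1 (hg.eq_one_of_two_orbits hκ hm hl hx hxy hU hno hS (a := 0) (b := c)
    (by simpa using hlc) (fun z z' _ hz' ↦ hfix _ z z' hz') (fun z z' _ hz' ↦ hfix _ z z' hz'))

theorem ZMod.exists_affine_symmetry_three : ∀ S : ZMod 3 → Bool, ∃ l c : ZMod 3,
    IsUnit l ∧ l ≠ 1 ∧ ∀ a, S (l * a + c) = S a := by
  decide +kernel

theorem ZMod.exists_affine_symmetry_five : ∀ S : ZMod 5 → Bool, ∃ l c : ZMod 5,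
    IsUnit l ∧ l ≠ 1 ∧ ∀ a, S (l * a + c) = S a := by
  decide +kernel

theorem ZMod.exists_affine_symmetry_seven : ∀ S : ZMod 7 → Bool, ∃ l c : ZMod 7,
    IsUnit l ∧ l ≠ 1 ∧ ∀ a, S (l * a + c) = S a := by
  decide +kernel

/-- Every subset of `ZMod 4` has a reflection symmetry; if it has none preserving parity, it
consists of two consecutive elements. -/
theorem ZMod.exists_reflection_four : ∀ S : ZMod 4 → Bool,
    (∃ c : ZMod 4, 2 * c = 0 ∧ ∀ a, S (-1 * a + c) = S a) ∨
      ∃ c : ZMod 4, 2 * (c + 1) = 0 ∧ ∀ a, S (-1 * a + c) = S a ∧ S (a + 2) = !S a := by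
  decide +kernel

theorem two_dvd_val_four : ∀ k a : ZMod 4, 2 * a = 0 → 2 ∣ ((-1 - 1) * k + a).val := by
  decide

/-- If only two orbits have length divisible by `4`, where `4` exactly divides `n`, and their
lengths only share the factor `4`, then there are two distinct orbits of length `2` modulo `4`. -/
theorem GeneratesAut.exists_two_orbits_of_gcd_eq_four [Finite P] (hg : GeneratesAut g n)
    (hq : 4 ∣ n) (hq' : ¬ 8 ∣ n) {x y : P} (hxy : ¬ InOrbit g x y)
    (hU : ∀ z, 4 ∣ period g z → InOrbit g x z ∨ InOrbit g y z)
    (hgcd : Nat.gcd (period g x) (period g y) = 4) :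
    ∃ c d, ¬ InOrbit g c d ∧ (2 ∣ period g c ∧ ¬ 4 ∣ period g c) ∧
      (2 ∣ period g d ∧ ¬ 4 ∣ period g d) := by
  wlog hno : ∀ z z', InOrbit g x z → InOrbit g y z' → ¬ z' ≤ z generalizing x y
  · exact this (x := y) (y := x) (fun h ↦ hxy (h.symm hg)) (fun z hz ↦ (hU z hz).symm)
      (by rwa [Nat.gcd_comm]) ((hg.not_le_or_not_le hxy).resolve_left hno)
  have hx : 4 ∣ period g x := by
    rw [← hgcd]
    exact Nat.gcd_dvd_left _ _
  have hy : 4 ∣ period g y := by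
    rw [← hgcd]
    exact Nat.gcd_dvd_right _ _
  obtain ⟨m, hm, hmd⟩ := exists_multiplier (p := 2) (r := 2) Nat.prime_two (by norm_num) hq hq'
  norm_num at hm hmd
  replace hm : (m : ZMod 4) = 1 := by
    simpa using (ZMod.natCast_eq_natCast_iff _ _ _).2 hm
  obtain ⟨κ, hκ⟩ := hg.exists_coordinate 4
  obtain ⟨S, hS⟩ := hg.exists_difference_set hκ hgcd
  have hfix (z c : P) (hc : ¬ 4 ∣ period g c) (k a : ZMod 4) (ha : 2 * a = 0) :=
    le_iff_smul_le_of_fixed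
      (pow_pow_smul_eq (hmd _ (hg.period_dvd _) hc) (two_dvd_val_four k a ha)) z
  have hunit : IsUnit (-1 : ZMod 4) := isUnit_one.neg
  have hne : (-1 : ZMod 4) ≠ 1 := by decide
  obtain ⟨c, hc, hSc⟩ | ⟨c, hc, hSc⟩ := ZMod.exists_reflection_four S
  · refine absurd (hg.eq_one_of_two_orbits hκ hm hunit hx hxy hU hno hS (a := 0) (b := c)
      (by simpa using hSc) (fun z z' _ hz' ↦ hfix _ _ hz' _ _ (by simp))
      (fun z z' _ hz' ↦ hfix _ _ hz' _ _ hc)) hne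
  have hpow {v : P} (h : ∀ z c, InOrbit g v z → ¬ 4 ∣ period g c →
      (z ≤ c ↔ g ^ m • z ≤ c) ∧ (c ≤ z ↔ c ≤ g ^ m • z)) (e : ℕ) (z c : P) (hz : InOrbit g v z)
      (hc : ¬ 4 ∣ period g c) :
      (z ≤ c ↔ (g ^ m) ^ e • z ≤ c) ∧ (c ≤ z ↔ c ≤ (g ^ m) ^ e • z) := by
    induction e with
    | zero => simp
    | succ e ih =>
      have h1 : InOrbit g z ((g ^ m) ^ e • z) := by
        rw [← pow_mul]
        exact InOrbit.pow _ _
      have h2 := h _ c (hz.trans h1) hc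
      rw [pow_succ', mul_smul]
      exact ⟨ih.1.trans h2.1, ih.2.trans h2.2⟩
  have hX : ∃ z c, InOrbit g x z ∧ ¬ 4 ∣ period g c ∧
      ¬ ((z ≤ c ↔ g ^ m • z ≤ c) ∧ (c ≤ z ↔ c ≤ g ^ m • z)) := by
    by_contra hcon
    replace hcon : ∀ z c, InOrbit g x z → ¬ 4 ∣ period g c →
      (z ≤ c ↔ g ^ m • z ≤ c) ∧ (c ≤ z ↔ c ≤ g ^ m • z) := by
      intro z c hz hc
      by_contra h
      exact hcon ⟨z, c, hz, hc, h⟩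
    exact hne (hg.eq_one_of_two_orbits hκ hm hunit hx hxy hU hno hS (a := 1) (b := c + 1)
      (by simpa using fun d ↦ (hSc d).1) (fun z z' hz hz' ↦ hpow hcon _ z z' hz hz')
      (fun z z' _ hz' ↦ hfix _ _ hz' _ _ hc))
  have hY : ∃ z c, InOrbit g y z ∧ ¬ 4 ∣ period g c ∧
      ¬ ((z ≤ c ↔ g ^ m • z ≤ c) ∧ (c ≤ z ↔ c ≤ g ^ m • z)) := by
    by_contra hcon
    replace hcon : ∀ z c, InOrbit g y z → ¬ 4 ∣ period g c →
      (z ≤ c ↔ g ^ m • z ≤ c) ∧ (c ≤ z ↔ c ≤ g ^ m • z) := by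
      intro z c hz hc
      by_contra h
      exact hcon ⟨z, c, hz, hc, h⟩
    exact hne (hg.eq_one_of_two_orbits hκ hm hunit hx hxy hU hno hS (a := 0) (b := c)
      (by simpa using fun d ↦ (hSc d).1) (fun z z' _ hz' ↦ hfix _ _ hz' _ _ (by simp))
      (fun z z' hz hz' ↦ hpow hcon _ z z' hz hz'))
  have heven {z c : P} (hc : ¬ 4 ∣ period g c)
      (h : ¬ ((z ≤ c ↔ g ^ m • z ≤ c) ∧ (c ≤ z ↔ c ≤ g ^ m • z))) : 2 ∣ period g c := by
    by_contra h2
    refine h (le_iff_smul_le_of_fixed ?_ z)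
    rw [pow_smul_eq_iff_period_dvd]
    exact ((Nat.prime_two.coprime_iff_not_dvd.2 h2).symm.dvd_of_dvd_mul_right
      (hmd _ (hg.period_dvd c) hc))
  obtain ⟨z, c, hz, hc4, hzc⟩ := hX
  obtain ⟨z', c', hz', hc4', hzc'⟩ := hY
  refine ⟨c, c', fun hcc ↦ ?_, ⟨heven hc4 hzc, hc4⟩, ⟨heven hc4' hzc', hc4'⟩⟩
  have hcomp {v z c : P} (hz : InOrbit g v z)
      (h : ¬ ((z ≤ c ↔ g ^ m • z ≤ c) ∧ (c ≤ z ↔ c ≤ g ^ m • z))) :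
      ∃ t, InOrbit g v t ∧ (t ≤ c ∨ c ≤ t) := by
    by_contra! hcon
    have h1 := hcon z hz
    have h2 := hcon _ (hz.trans (InOrbit.pow z m))
    exact h ⟨iff_of_false h1.1 h2.1, iff_of_false h1.2 h2.2⟩
  have hw (c : P) (hc : ¬ 4 ∣ period g c) : g ^ (m * 2) • c = c :=
    pow_smul_eq_iff_period_dvd.2 (hmd _ (hg.period_dvd c) hc)
  have hκ2 (z : P) (hz : 4 ∣ period g z) : κ (g ^ (m * 2) • z) = κ z + 2 := by
    rw [hκ z hz]
    push_cast
    rw [hm, one_mul]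
  have hdx {z : P} (hz : InOrbit g x z) : 4 ∣ period g z := by rwa [hz.period_eq]
  have hdy {z : P} (hz : InOrbit g y z) : 4 ∣ period g z := by rwa [hz.period_eq]
  have key1 (t c : P) (ht : InOrbit g x t) (hc : ¬ 4 ∣ period g c) (h : c ≤ t) (t' : P)
      (ht' : InOrbit g y t') : c ≤ t' := by
    have h2 : c ≤ g ^ (m * 2) • t := by
      have := (smul_le_smul_iff_orderIso (g ^ (m * 2)) _ _).2 h
      rwa [hw c hc] at this
    cases hb : S (κ t' - κ t)
    · refine h2.trans ((hS _ _ (ht.trans (InOrbit.pow _ _)) ht').2 ?_)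
      rw [hκ2 t (hdx ht)]
      have := (hSc (κ t' - (κ t + 2))).2
      rw [show κ t' - (κ t + 2) + 2 = κ t' - κ t by ring, hb] at this
      simpa using this.symm
    · exact h.trans ((hS _ _ ht ht').2 hb)
  have key3 (t' c : P) (ht' : InOrbit g y t') (hc : ¬ 4 ∣ period g c) (h : t' ≤ c) (t : P)
      (ht : InOrbit g x t) : t ≤ c := by
    have h2 : g ^ (m * 2) • t' ≤ c := by
      have := (smul_le_smul_iff_orderIso (g ^ (m * 2)) _ _).2 h
      rwa [hw c hc] at this
    cases hb : S (κ t' - κ t)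
    · refine ((hS _ _ ht (ht'.trans (InOrbit.pow _ _))).2 ?_).trans h2
      rw [hκ2 t' (hdy ht'), show κ t' + 2 - κ t = κ t' - κ t + 2 by ring, (hSc _).2, hb]
      rfl
    · exact ((hS _ _ ht ht').2 hb).trans h
  have key2 (t c t' : P) (ht : InOrbit g x t) (hc : ¬ 4 ∣ period g c) (ht' : InOrbit g y t')
      (h : t ≤ c) (h' : c ≤ t') : False := by
    have h2 : c ≤ g ^ (m * 2) • t' := by
      have := (smul_le_smul_iff_orderIso (g ^ (m * 2)) _ _).2 h'
      rwa [hw c hc] at this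
    have h3 := (hS _ _ ht ht').1 (h.trans h')
    have h4 := (hS _ _ ht (ht'.trans (InOrbit.pow _ _))).1 (h.trans h2)
    rw [hκ2 t' (hdy ht'), show κ t' + 2 - κ t = κ t' - κ t + 2 by ring, (hSc _).2, h3] at h4
    simp at h4
  obtain ⟨t, ht, h | h⟩ := hcomp hz hzc
  · obtain ⟨t', ht', h' | h'⟩ := hcomp hz' hzc'
    · obtain ⟨k, rfl⟩ := hcc.symm hg
      have hall := key3 (g ^ k • t') _ (ht'.trans (InOrbit.pow _ _)) hc4
        ((smul_le_smul_iff_orderIso _ _ _).2 h')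
      have hnone (s : P) (hs : InOrbit g x s) : ¬ g ^ k • c' ≤ s := fun hle ↦
        hc4 (le_antisymm hle (hall s hs) ▸ hdx hs)
      have hz2 := hz.trans (InOrbit.pow z m)
      exact hzc ⟨iff_of_true (hall _ hz) (hall _ hz2), iff_of_false (hnone _ hz) (hnone _ hz2)⟩
    · obtain ⟨k, rfl⟩ := hcc.symm hg
      exact key2 t _ (g ^ k • t') ht hc4 (ht'.trans (InOrbit.pow _ _)) h
        ((smul_le_smul_iff_orderIso _ _ _).2 h')
  · obtain ⟨k, rfl⟩ := hcc
    have hall := key1 (g ^ k • t) _ (ht.trans (InOrbit.pow _ _)) hc4'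
      ((smul_le_smul_iff_orderIso _ _ _).2 h)
    have hnone (s : P) (hs : InOrbit g y s) : ¬ s ≤ g ^ k • c := fun hle ↦
      hc4' (le_antisymm (hall s hs) hle ▸ hdy hs)
    have hz2 := hz'.trans (InOrbit.pow z' m)
    exact hzc' ⟨iff_of_false (hnone _ hz') (hnone _ hz2), iff_of_true (hall _ hz') (hall _ hz2)⟩

end Orbits

section Weights

open Finset

theorem add_le_two_mul_mul {x y w w' : ℕ} (hx : 2 ≤ x) (hxy : x < y) (hw : w ≤ 3 * x)
    (hw' : w' ≤ 3 * y) (hx2 : x = 2 → w ≤ 4) :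
    6 ≤ x * y ∧ (w + w' ≤ 2 * (x * y) ∨
      (x = 2 ∧ y = 3 ∧ w = 4 ∧ 6 < w' ∧ w + w' ≤ 2 * (x * y) + 1)) := by
  rcases Nat.eq_or_lt_of_le hx with rfl | hx
  · specialize hx2 rfl
    omega
  · exact ⟨by nlinarith, Or.inl (by nlinarith)⟩

theorem sum_le_two_mul_prod {ι : Type*} [DecidableEq ι] (T : Finset ι) (v W : ι → ℕ)
    (hcop : ∀ i ∈ T, ∀ j ∈ T, i ≠ j → v i ≠ v j) (h2 : ∀ i ∈ T, 2 ≤ v i)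
    (hW : ∀ i ∈ T, W i ≤ 3 * v i) (hW2 : ∀ i ∈ T, v i = 2 → W i ≤ 4) (hT : 2 ≤ #T) :
    6 ≤ ∏ i ∈ T, v i ∧ (∑ i ∈ T, W i ≤ 2 * ∏ i ∈ T, v i ∨
      ((∃ i ∈ T, ∃ j ∈ T, v i = 2 ∧ v j = 3 ∧ W i = 4 ∧ 6 < W j) ∧ ∏ i ∈ T, v i = 6 ∧
        ∑ i ∈ T, W i ≤ 2 * ∏ i ∈ T, v i + 1)) := by
  induction T using Finset.induction_on with
  | empty => simp at hT
  | insert a s ha ih =>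
    rw [prod_insert ha, sum_insert ha]
    rw [card_insert_of_notMem ha] at hT
    rcases Nat.eq_or_lt_of_le (show 1 ≤ #s by omega) with hs | hs
    · obtain ⟨c, rfl⟩ := card_eq_one.1 hs.symm
      rw [notMem_singleton] at ha
      clear ih
      have hmem : c ∈ insert a ({c} : Finset ι) := mem_insert_of_mem (mem_singleton_self c)
      have hmem' := mem_insert_self a ({c} : Finset ι)
      have hne := hcop a hmem' c hmem ha
      have h2 := And.intro (h2 a hmem') (h2 c hmem)
      have hW := And.intro (hW a hmem') (hW c hmem)
      have hW2 := And.intro (hW2 a hmem') (hW2 c hmem)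
      rw [prod_singleton, sum_singleton]
      rcases lt_or_gt_of_ne hne with h | h
      · obtain ⟨h6, h1 | h1⟩ := add_le_two_mul_mul h2.1 h hW.1 hW.2 hW2.1
        · exact ⟨h6, Or.inl h1⟩
        · exact ⟨h6, Or.inr ⟨⟨a, hmem', c, hmem, h1.1, h1.2.1, h1.2.2.1, h1.2.2.2.1⟩,
            by simp [h1.1, h1.2.1], h1.2.2.2.2⟩⟩
      · obtain ⟨h6, h1 | h1⟩ := add_le_two_mul_mul h2.2 h hW.2 hW.1 hW2.2
        · rw [mul_comm, add_comm]
          exact ⟨h6, Or.inl h1⟩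
        · refine ⟨by rwa [mul_comm], Or.inr ⟨⟨c, hmem, a, hmem', h1.1, h1.2.1, h1.2.2.1,
            h1.2.2.2.1⟩, by simp [h1.1, h1.2.1], ?_⟩⟩
          rw [mul_comm (v a), add_comm]
          exact h1.2.2.2.2
    · obtain ⟨h6, hsum⟩ := ih
        (fun i hi j hj ↦ hcop i (mem_insert_of_mem hi) j (mem_insert_of_mem hj))
        (fun i hi ↦ h2 i (mem_insert_of_mem hi)) (fun i hi ↦ hW i (mem_insert_of_mem hi))
        (fun i hi ↦ hW2 i (mem_insert_of_mem hi)) hs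
      have h1 : ∑ i ∈ s, W i ≤ 2 * ∏ i ∈ s, v i + 1 := by
        rcases hsum with h | h
        · omega
        · exact h.2.2
      have h3 := h2 a (mem_insert_self a s)
      have h4 := hW a (mem_insert_self a s)
      exact ⟨by nlinarith, Or.inl (by nlinarith)⟩

variable {Ω : Type*} [Fintype Ω]

/-- A distribution of the amount `2 * (b q * q)` among orbits of lengths `ℓ`. -/
structure IsWeight (ℓ : Ω → ℕ) (q : ℕ) (W : Ω → ℕ) : Prop where
  sum_ge : 2 * (b q * q) ≤ ∑ o, W o
  le_three : ∀ o, W o ≤ 3 * (ℓ o).gcd q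
  eq_zero : ∀ o, (ℓ o).gcd q = 1 → W o = 0
  le_four : ∀ o, (ℓ o).gcd q = 2 → W o ≤ 4
  le_two : ∀ o, (ℓ o).gcd q = ℓ o → W o ≤ 2 * ℓ o
  of_three : ∀ o, (ℓ o).gcd q = 3 → 6 < W o → q = 3 ∧ ∃ o', o' ≠ o ∧ 3 ∣ ℓ o' ∧
    (∀ o'', 3 ∣ ℓ o'' → o'' = o ∨ o'' = o') ∧ (ℓ o).gcd (ℓ o') ≠ 3
  of_two : ∀ o, (ℓ o).gcd q = 2 → W o = 4 → q = 4 ∨ (q = 2 ∧ ∀ o', 2 ∣ ℓ o' → o' = o)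

theorem exists_isWeight_two {ℓ : Ω → ℕ} (h : ∃ o, 2 ∣ ℓ o) : ∃ W, IsWeight ℓ 2 W := by
  classical
  have hgcd (o : Ω) : (ℓ o).gcd 2 = if 2 ∣ ℓ o then 2 else 1 := by
    split_ifs with h
    · exact Nat.gcd_eq_right h
    · exact ((Nat.prime_two.coprime_iff_not_dvd).2 h).symm
  refine ⟨fun o ↦ if 2 ∣ ℓ o then (if ∀ o', 2 ∣ ℓ o' → o' = o then 4 else 2) else 0,
    ?_, ?_, ?_, ?_, ?_, ?_, ?_⟩
  · obtain ⟨o, ho⟩ := h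
    by_cases hall : ∀ o', 2 ∣ ℓ o' → o' = o
    · refine le_trans ?_ (single_le_sum_of_canonicallyOrdered (mem_univ o))
      rw [if_pos ho, if_pos hall]
      decide
    · have hall' := hall
      push Not at hall'
      obtain ⟨o', ho', hne⟩ := hall'
      refine le_trans ?_ (sum_le_sum_of_subset (subset_univ {o, o'}))
      rw [sum_pair hne.symm, if_pos ho, if_pos ho', if_neg hall,
        if_neg (fun h ↦ hne (h o ho).symm)]
      decide
  all_goals intro o
  all_goals rw [hgcd]
  · split_ifs <;> simp
  · split_ifs <;> simp
  · split_ifs <;> simp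
  · split_ifs <;> omega
  · split_ifs <;> simp
  · split_ifs with h1 h2
    · exact fun _ _ ↦ Or.inr ⟨rfl, h2⟩
    · simp
    · simp

theorem exists_isWeight_of_card {ℓ : Ω → ℕ} {q : ℕ} (h1 : q ≠ 1) (h2 : q ≠ 2)
    (h : b q ≤ #{o | q ∣ ℓ o}) : ∃ W, IsWeight ℓ q W := by
  have hgcd {o : Ω} (ho : q ∣ ℓ o) : (ℓ o).gcd q = q := Nat.gcd_eq_right ho
  refine ⟨fun o ↦ if q ∣ ℓ o then 2 * q else 0, ?_, ?_, ?_, ?_, ?_, ?_, ?_⟩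
  · rw [← sum_filter, sum_const, smul_eq_mul]
    calc 2 * (b q * q) = b q * (2 * q) := by ring
      _ ≤ _ := Nat.mul_le_mul_right _ h
  all_goals
    intro o
    by_cases ho : q ∣ ℓ o
    · rw [if_pos ho, hgcd ho]
      omega
    · rw [if_neg ho]
      omega

theorem exists_isWeight_of_gcd_ne {ℓ : Ω → ℕ} {q : ℕ} (hq : q = 3 ∨ q = 4 ∨ q = 5 ∨ q = 7)
    {o o' : Ω} (hne : o ≠ o') (ho : q ∣ ℓ o) (ho' : q ∣ ℓ o')
    (hall : ∀ o'', q ∣ ℓ o'' → o'' = o ∨ o'' = o') (hgcd : (ℓ o).gcd (ℓ o') ≠ q) :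
    ∃ W, IsWeight ℓ q W := by
  classical
  have hg {o : Ω} (ho : q ∣ ℓ o) : (ℓ o).gcd q = q := Nat.gcd_eq_right ho
  have hb : b q = 3 := by
    rcases hq with rfl | rfl | rfl | rfl <;> decide
  refine ⟨fun o ↦ if q ∣ ℓ o then 3 * q else 0, ?_, ?_, ?_, ?_, ?_, ?_, ?_⟩
  · refine le_trans ?_ (sum_le_sum_of_subset (subset_univ {o, o'}))
    rw [sum_pair hne, if_pos ho, if_pos ho', hb]
    omega
  all_goals
    intro t
    by_cases ht : q ∣ ℓ t
    swap
    · rw [if_neg ht]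
      omega
    rw [if_pos ht, hg ht]
  · omega
  · omega
  · intro h
    rcases hall t ht with rfl | rfl
    · exact absurd (by rw [← h, Nat.gcd_eq_left ho']) hgcd
    · exact absurd (by rw [← h, Nat.gcd_eq_right ho]) hgcd
  · rintro rfl -
    refine ⟨rfl, ?_⟩
    rcases hall t ht with rfl | rfl
    · exact ⟨o', hne.symm, ho', hall, hgcd⟩
    · exact ⟨o, hne, ho, fun o'' h ↦ (hall o'' h).symm, by rwa [Nat.gcd_comm]⟩
  · omega

theorem exists_isWeight_four {ℓ : Ω → ℕ} {o o' c d : Ω} (hne : o ≠ o') (ho : 4 ∣ ℓ o)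
    (ho' : 4 ∣ ℓ o') (hcd : c ≠ d) (hc : 2 ∣ ℓ c ∧ ¬ 4 ∣ ℓ c) (hd : 2 ∣ ℓ d ∧ ¬ 4 ∣ ℓ d) :
    ∃ W, IsWeight ℓ 4 W := by
  classical
  have hgcd (o : Ω) : (ℓ o).gcd 4 = if 4 ∣ ℓ o then 4 else if 2 ∣ ℓ o then 2 else 1 := by
    split_ifs with h h'
    · exact Nat.gcd_eq_right h
    · have h1 : (ℓ o).gcd 4 ∣ 4 := Nat.gcd_dvd_right _ _
      have h2 : 2 ∣ (ℓ o).gcd 4 := Nat.dvd_gcd h' (by norm_num)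
      have h3 : (ℓ o).gcd 4 ≠ 4 := fun h4 ↦ h (Nat.gcd_eq_right_iff_dvd.1 h4)
      have h4 := Nat.le_of_dvd (by norm_num) h1
      have h5 := Nat.pos_of_dvd_of_pos h1 (by norm_num)
      omega
    · exact (((Nat.prime_two.coprime_iff_not_dvd).2 h').symm).pow_right 2
  refine ⟨fun o ↦ if 4 ∣ ℓ o then 8 else if 2 ∣ ℓ o then 4 else 0, ?_, ?_, ?_, ?_, ?_, ?_, ?_⟩
  · refine le_trans ?_ (sum_le_sum_of_subset (subset_univ ({o, o'} ∪ {c, d})))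
    rw [sum_union, sum_pair hne, sum_pair hcd, if_pos ho, if_pos ho', if_neg hc.2, if_neg hd.2,
      if_pos hc.1, if_pos hd.1]
    · decide
    · rw [disjoint_left]
      intro t ht ht'
      simp only [mem_insert, mem_singleton] at ht ht'
      rcases ht with rfl | rfl <;> rcases ht' with rfl | rfl <;> tauto
  all_goals
    intro t
    rw [hgcd]
    split_ifs <;> omega

theorem exists_isWeight {ℓ : Ω → ℕ} {q : ℕ} (hq1 : q ≠ 1) (hex : ∃ o, q ∣ ℓ o)
    (hex2 : q ≠ 2 → ∀ o, q ∣ ℓ o → ∃ o', o' ≠ o ∧ q ∣ ℓ o')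
    (hB : q = 3 ∨ q = 5 ∨ q = 7 → ∀ o o', o ≠ o' → q ∣ ℓ o → q ∣ ℓ o' →
      (∀ o'', q ∣ ℓ o'' → o'' = o ∨ o'' = o') → (ℓ o).gcd (ℓ o') ≠ q)
    (hC : q = 4 → ∀ o o', o ≠ o' → q ∣ ℓ o → q ∣ ℓ o' →
      (∀ o'', q ∣ ℓ o'' → o'' = o ∨ o'' = o') → (ℓ o).gcd (ℓ o') = q →
      ∃ c d, c ≠ d ∧ (2 ∣ ℓ c ∧ ¬ 4 ∣ ℓ c) ∧ (2 ∣ ℓ d ∧ ¬ 4 ∣ ℓ d)) :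
    ∃ W, IsWeight ℓ q W := by
  classical
  by_cases hq2 : q = 2
  · subst hq2
    exact exists_isWeight_two hex
  by_cases hcard : b q ≤ #{o | q ∣ ℓ o}
  · exact exists_isWeight_of_card hq1 hq2 hcard
  obtain ⟨o, ho⟩ := hex
  obtain ⟨o', hne, ho'⟩ := hex2 hq2 o ho
  have hsub : {o, o'} ⊆ ({o | q ∣ ℓ o} : Finset Ω) := by
    intro t ht
    simp only [mem_insert, mem_singleton] at ht
    rcases ht with rfl | rfl <;> simpa
  have hge := card_le_card hsub
  rw [card_pair hne.symm] at hge
  have hq : q = 3 ∨ q = 4 ∨ q = 5 ∨ q = 7 := by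
    by_contra hq
    simp only [b, if_neg hq1, if_neg hq2, if_neg hq] at hcard
    omega
  have hb : b q = 3 := by
    rcases hq with rfl | rfl | rfl | rfl <;> decide
  have heq := eq_of_subset_of_card_le hsub (by rw [card_pair hne.symm]; omega)
  have hall (o'' : Ω) (h : q ∣ ℓ o'') : o'' = o ∨ o'' = o' := by
    have : o'' ∈ ({o, o'} : Finset Ω) := by simpa [heq]
    simpa using this
  by_cases hgcd : (ℓ o).gcd (ℓ o') = q
  · have hq4 : q = 4 := by
      by_contra h4
      exact hB (by tauto) o o' hne.symm ho ho' hall hgcd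
    obtain ⟨c, d, hcd, hc, hd⟩ := hC hq4 o o' hne.symm ho ho' hall hgcd
    subst hq4
    exact exists_isWeight_four hne.symm ho ho' hcd hc hd
  · exact exists_isWeight_of_gcd_ne hq hne.symm ho ho' hall hgcd

theorem Nat.eq_prod_gcd_of_dvd_prod {ι : Type*} (s : Finset ι) (q : ι → ℕ)
    (hcop : ∀ i ∈ s, ∀ j ∈ s, i ≠ j → (q i).Coprime (q j)) {l : ℕ} (hl : l ∣ ∏ i ∈ s, q i) :
    l = ∏ i ∈ s, l.gcd (q i) := by
  classical
  have key (t : Finset ι) (ht : t ⊆ s) : l.gcd (∏ i ∈ t, q i) = ∏ i ∈ t, l.gcd (q i) := by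
    induction t using Finset.induction_on with
    | empty => simp
    | insert a t ha ih =>
      rw [prod_insert ha, prod_insert ha, Nat.Coprime.gcd_mul, ih ((subset_insert a t).trans ht)]
      refine Nat.Coprime.prod_right fun i hi ↦ hcop a (ht (mem_insert_self a t)) i
        (ht (mem_insert_of_mem hi)) ?_
      rintro rfl
      exact ha hi
  rw [← key s subset_rfl, Nat.gcd_eq_left hl]

theorem sum_weight_le {ι : Type*} [Fintype ι] {q : ι → ℕ}
    (hcop : ∀ i j, i ≠ j → (q i).Coprime (q j)) {ℓ : Ω → ℕ} {W : ι → Ω → ℕ}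
    (hW : ∀ i, IsWeight ℓ (q i) (W i)) {o : Ω} (hpos : 0 < ℓ o) (hdvd : ℓ o ∣ ∏ i, q i) :
    ∑ i, W i o ≤ 2 * ℓ o ∨ ((∃ i, q i = 4) ∧ (∃ i, q i = 3) ∧ ∑ i, W i o ≤ 2 * ℓ o + 1 ∧
      3 ∣ ℓ o ∧ ∃ o', ∀ o'', 3 ∣ ℓ o'' → o'' = o ∨ o'' = o') := by
  classical
  have hprod := Nat.eq_prod_gcd_of_dvd_prod univ q (fun i _ j _ ↦ hcop i j) hdvd
  have hgpos (i : ι) : 0 < (ℓ o).gcd (q i) := Nat.gcd_pos_of_pos_left _ hpos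
  let T : Finset ι := {i | (ℓ o).gcd (q i) ≠ 1}
  have hT1 {i : ι} (hi : i ∈ T) : 2 ≤ (ℓ o).gcd (q i) := by
    have h1 := hgpos i
    have h2 : (ℓ o).gcd (q i) ≠ 1 := (mem_filter.1 hi).2
    omega
  have hT2 {i : ι} (hi : i ∉ T) : (ℓ o).gcd (q i) = 1 := by
    by_contra h
    exact hi (mem_filter.2 ⟨mem_univ i, h⟩)
  have hprodT : ∏ i ∈ T, (ℓ o).gcd (q i) = ℓ o := by
    conv_rhs => rw [hprod]
    exact prod_subset (subset_univ T) fun i _ hi ↦ hT2 hi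
  have hsumT : ∑ i ∈ T, W i o = ∑ i, W i o :=
    sum_subset (subset_univ T) fun i _ hi ↦ (hW i).eq_zero o (hT2 hi)
  rw [← hsumT]
  rcases Nat.lt_or_ge (#T) 2 with hT | hT
  · left
    rcases Nat.eq_zero_or_pos (#T) with h0 | h0
    · simp [card_eq_zero.1 h0]
    · obtain ⟨i, hi⟩ := card_eq_one.1 (show #T = 1 by omega)
      rw [hi, sum_singleton]
      rw [hi, prod_singleton] at hprodT
      exact (hW i).le_two o hprodT
  · have hne (i : ι) (hi : i ∈ T) (j : ι) (_ : j ∈ T) (hij : i ≠ j) :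
        (ℓ o).gcd (q i) ≠ (ℓ o).gcd (q j) := by
      intro heq
      have h1 := hT1 hi
      have h2 := (hcop i j hij).coprime_dvd_left (Nat.gcd_dvd_right (ℓ o) (q i))
      have h3 := h2.coprime_dvd_right (Nat.gcd_dvd_right (ℓ o) (q j))
      rw [← heq, Nat.coprime_self] at h3
      omega
    obtain ⟨-, h | ⟨⟨i, -, j, -, hi, hj, hi4, hj6⟩, h6, hle⟩⟩ := sum_le_two_mul_prod T
      (fun i ↦ (ℓ o).gcd (q i)) (fun i ↦ W i o) hne
      (fun i hi ↦ hT1 hi) (fun i _ ↦ (hW i).le_three o) (fun i _ ↦ (hW i).le_four o) hT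
    · left
      rwa [hprodT] at h
    · rw [hprodT] at h6 hle
      obtain ⟨hq3, o', hne, ho', hall, hgcd⟩ := (hW j).of_three o hj hj6
      rcases (hW i).of_two o hi hi4 with hq4 | ⟨-, hall2⟩
      · exact Or.inr ⟨⟨i, hq4⟩, ⟨j, hq3⟩, hle, hj ▸ Nat.gcd_dvd_left _ _, o', hall⟩
      · refine absurd (hall2 o' ?_) hne
        by_contra h2
        have h1 : (ℓ o').Coprime 2 := ((Nat.prime_two.coprime_iff_not_dvd).2 h2).symm
        apply hgcd
        rw [h6, Nat.gcd_comm, show 6 = 2 * 3 by rfl,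
          Nat.Coprime.gcd_mul _ (by norm_num), h1, one_mul, Nat.gcd_eq_right ho']

theorem sum_mul_le_of_isWeight {ι : Type*} [Fintype ι] {q : ι → ℕ}
    (hcop : ∀ i j, i ≠ j → (q i).Coprime (q j)) {ℓ : Ω → ℕ}
    (hW : ∀ i, ∃ W, IsWeight ℓ (q i) W) (hpos : ∀ o, 0 < ℓ o) (hdvd : ∀ o, ℓ o ∣ ∏ i, q i) :
    ∑ i, b (q i) * q i ≤ ∑ o, ℓ o ∨ ((∃ i, q i = 4) ∧ (∃ i, q i = 3) ∧
      ∑ i, b (q i) * q i ≤ ∑ o, ℓ o + 1) := by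
  classical
  choose W hW using hW
  have htot : 2 * ∑ i, b (q i) * q i ≤ ∑ o, ∑ i, W i o := by
    rw [sum_comm, mul_sum]
    exact sum_le_sum fun i _ ↦ (hW i).sum_ge
  have hle (o : Ω) := sum_weight_le hcop hW (hpos o) (hdvd o)
  by_cases hbad : ∀ o, ∑ i, W i o ≤ 2 * ℓ o
  · left
    have : ∑ o, ∑ i, W i o ≤ 2 * ∑ o, ℓ o := by
      rw [mul_sum]
      exact sum_le_sum fun o _ ↦ hbad o
    omega
  · push Not at hbad
    obtain ⟨o, ho⟩ := hbad
    obtain ⟨h4, h3, -, -, o', hall⟩ := (hle o).resolve_left ho.not_ge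
    refine Or.inr ⟨h4, h3, ?_⟩
    have hle' (t : Ω) : ∑ i, W i t ≤ 2 * ℓ t + if t ∈ ({o, o'} : Finset Ω) then 1 else 0 := by
      rcases hle t with h | ⟨-, -, h, h3, -⟩
      · exact h.trans (Nat.le_add_right _ _)
      · rw [if_pos (by simpa using hall t h3)]
        exact h
    have h1 : ∑ o, ∑ i, W i o ≤ 2 * ∑ o, ℓ o + #{o, o'} := by
      refine (sum_le_sum fun t _ ↦ hle' t).trans_eq ?_
      rw [sum_add_distrib, mul_sum, sum_boole, filter_mem_eq_inter, univ_inter, Nat.cast_id]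
    have h2 : #{o, o'} ≤ 2 := card_le_two
    omega

end Weights

section Main

open MulAction

theorem generatesAut_of_mulEquiv {P : Type} [PartialOrder P] {n : ℕ} (hn : 0 < n)
    (e : (P ≃o P) ≃* Multiplicative (ZMod n)) :
    ∃ g : P ≃o P, GeneratesAut g n ∧ orderOf g = n := by
  have : NeZero n := ⟨hn.ne'⟩
  have hord : orderOf (e.symm (Multiplicative.ofAdd 1)) = n := by
    rw [MulEquiv.orderOf_eq, orderOf_ofAdd_eq_addOrderOf, ZMod.addOrderOf_one]
  refine ⟨_, ⟨hn, ?_, fun φ ↦ ⟨(Multiplicative.toAdd (e φ)).val, ?_⟩⟩, hord⟩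
  · exact orderOf_dvd_iff_pow_eq_one.1 (dvd_of_eq hord)
  · rw [← map_pow, ← ofAdd_nsmul, nsmul_one, ZMod.natCast_zmod_val, ofAdd_toAdd,
      MulEquiv.symm_apply_apply]

theorem inOrbit_iff_mem_orbit {P : Type} [PartialOrder P] {g : P ≃o P} {n : ℕ}
    (hg : GeneratesAut g n) {x y : P} :
    InOrbit g x y ↔ y ∈ orbit (Subgroup.zpowers g) x := by
  constructor
  · rintro ⟨k, rfl⟩
    exact ⟨⟨g ^ k, Subgroup.npow_mem_zpowers g k⟩, rfl⟩
  · rintro ⟨⟨φ, hφ⟩, rfl⟩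
    obtain ⟨k, rfl⟩ := hg.exists_pow φ
    exact ⟨k, rfl⟩

theorem card_eq_sum_period {P : Type} [PartialOrder P] [Fintype P] (g : P ≃o P)
    [Fintype (orbitRel.Quotient (Subgroup.zpowers g) P)] :
    Fintype.card P = ∑ o : orbitRel.Quotient (Subgroup.zpowers g) P, period g o.out := by
  classical
  rw [← Nat.card_eq_fintype_card, Nat.card_congr (selfEquivSigmaOrbits (Subgroup.zpowers g) P),
    Nat.card_sigma]
  refine Finset.sum_congr rfl fun o _ ↦ ?_
  rw [Nat.card_eq_fintype_card, ← minimalPeriod_eq_card]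
  rfl

theorem not_pow_succ_dvd_prod {ι : Type*} [Fintype ι] {p r : ι → ℕ} (hp : ∀ i, (p i).Prime)
    (hinj : Function.Injective p) (i : ι) : ¬ p i ^ (r i + 1) ∣ ∏ j, p j ^ r j := by
  classical
  intro h
  rw [← Finset.mul_prod_erase _ _ (Finset.mem_univ i), pow_succ] at h
  have h1 := Nat.dvd_of_mul_dvd_mul_left (pow_pos (hp i).pos _) h
  obtain ⟨j, hj, hd⟩ := (hp i).prime.exists_mem_finset_dvd h1
  have h2 := (Nat.prime_dvd_prime_iff_eq (hp i) (hp j)).1 ((hp i).dvd_of_dvd_pow hd)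
  exact Finset.ne_of_mem_erase hj (hinj h2).symm

theorem exactDvd_of_pow {p r n : ℕ} (hp : p.Prime) (hr : 1 ≤ r) (hq : p ^ r ∣ n)
    (hq' : ¬ p ^ (r + 1) ∣ n) : ExactDvd (p ^ r) n := by
  refine ⟨hq, ?_⟩
  rwa [hp.pow_minFac (by omega), ← pow_succ]

theorem exists_isWeight_period {P : Type} [PartialOrder P] [Fintype P] {g : P ≃o P} {n : ℕ}
    (hg : GeneratesAut g n) (hord : orderOf g = n) {p r : ℕ} (hp : p.Prime) (hr : 1 ≤ r)
    (hex : ExactDvd (p ^ r) n) [Fintype (orbitRel.Quotient (Subgroup.zpowers g) P)] :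
    ∃ W, IsWeight (fun o : orbitRel.Quotient (Subgroup.zpowers g) P ↦ period g o.out)
      (p ^ r) W := by
  have hmk (z : P) : InOrbit g (Quotient.mk (orbitRel (Subgroup.zpowers g) P) z).out z :=
    ((inOrbit_iff_mem_orbit hg).2 (Quotient.mk_out (s := orbitRel (Subgroup.zpowers g) P) z)).symm
      hg
  have hout {o o' : orbitRel.Quotient (Subgroup.zpowers g) P} (h : InOrbit g o.out o'.out) :
      o' = o := by
    rw [← Quotient.out_eq o, ← Quotient.out_eq o']
    exact Quotient.sound ((inOrbit_iff_mem_orbit hg).1 h)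
  obtain ⟨hq, hq'⟩ := hex
  rw [hp.pow_minFac (by omega), ← pow_succ] at hq'
  have hall {o o' : orbitRel.Quotient (Subgroup.zpowers g) P}
      (hall : ∀ o'' : orbitRel.Quotient (Subgroup.zpowers g) P, p ^ r ∣ period g o''.out →
        o'' = o ∨ o'' = o') (z : P) (hz : p ^ r ∣ period g z) :
      InOrbit g o.out z ∨ InOrbit g o'.out z := by
    rw [(hmk z).period_eq] at hz
    rcases hall _ hz with rfl | rfl
    · exact Or.inl (hmk z)
    · exact Or.inr (hmk z)
  refine exists_isWeight (Nat.one_lt_pow (by omega) hp.one_lt).ne' ?_ ?_ ?_ ?_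
  · obtain ⟨z, hz⟩ := exists_dvd_period hord hp hr hq hq'
    exact ⟨_, (hmk z).period_eq ▸ hz⟩
  · intro h2 o ho
    obtain ⟨y, hy, hne⟩ := hg.exists_not_inOrbit hp hr hq hq' h2 ho
    refine ⟨_, ?_, (hmk y).period_eq ▸ hy⟩
    rintro rfl
    exact hne (hmk y)
  · intro hpr o o' hne ho ho' h hgcd
    have hprime : (p ^ r).Prime := by
      rcases hpr with h | h | h <;> rw [h] <;> norm_num
    have hr1 : r = 1 := hprime.eq_one_of_pow
    subst hr1
    simp only [pow_one] at *
    refine hg.gcd_period_ne hp hq hq' ?_ ho (fun h ↦ hne (hout h).symm) (hall h) hgcd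
    rcases hpr with rfl | rfl | rfl
    · exact ZMod.exists_affine_symmetry_three
    · exact ZMod.exists_affine_symmetry_five
    · exact ZMod.exists_affine_symmetry_seven
  · intro h4 o o' hne ho ho' h hgcd
    have hp2 : p = 2 := by
      have h1 : p ∣ 2 ^ 2 := (dvd_pow_self p (by omega)).trans h4.dvd
      exact (Nat.prime_dvd_prime_iff_eq hp Nat.prime_two).1 (hp.dvd_of_dvd_pow h1)
    have h8 : ¬ 8 ∣ n := by
      rwa [pow_succ, h4, hp2] at hq'
    have h := hall h
    rw [h4] at hq ho ho' h hgcd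
    obtain ⟨c, d, hcd, hc, hd⟩ := hg.exists_two_orbits_of_gcd_eq_four hq h8
      (fun h ↦ hne (hout h).symm) h hgcd
    rw [(hmk c).period_eq] at hc
    rw [(hmk d).period_eq] at hd
    refine ⟨_, _, fun heq ↦ hcd ?_, hc, hd⟩
    exact ((hmk c).symm hg).trans (heq ▸ hmk d)

end Main

/-- Let `n = p₁^{r₁} ⋯ p_k^{r_k}` with distinct primes `p_i` and `r_i ≥ 1`. Every finite
poset whose automorphism group is cyclic of order `n` has at least
`(Σ b(p_i^{r_i})·p_i^{r_i}) - 1` points if `3 ∥ n` and `4 ∥ n`, and at least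
`Σ b(p_i^{r_i})·p_i^{r_i}` points otherwise. -/
theorem card_lower_bound_of_aut_cyclic (n k : ℕ) (p r : Fin k → ℕ)
    (hp : ∀ i, (p i).Prime) (hr : ∀ i, 1 ≤ r i) (hinj : Function.Injective p)
    (hn : n = ∏ i, p i ^ r i)
    (P : Type) [PartialOrder P] [Fintype P]
    (hcyc : Nonempty ((P ≃o P) ≃* Multiplicative (ZMod n))) :
    (if ExactDvd 3 n ∧ ExactDvd 4 n then (∑ i, b (p i ^ r i) * p i ^ r i) - 1
     else ∑ i, b (p i ^ r i) * p i ^ r i) ≤ Fintype.card P := by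
  subst hn
  have hpos : 0 < ∏ i, p i ^ r i := Finset.prod_pos fun i _ ↦ pow_pos (hp i).pos _
  obtain ⟨e⟩ := hcyc
  obtain ⟨g, hg, hord⟩ := generatesAut_of_mulEquiv hpos e
  have : Fintype (MulAction.orbitRel.Quotient (Subgroup.zpowers g) P) := Fintype.ofFinite _
  have hex (i : Fin k) : ExactDvd (p i ^ r i) (∏ i, p i ^ r i) :=
    exactDvd_of_pow (hp i) (hr i) (Finset.dvd_prod_of_mem _ (Finset.mem_univ i))
      (not_pow_succ_dvd_prod hp hinj i)
  have key := sum_mul_le_of_isWeight (q := fun i ↦ p i ^ r i)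
    (fun i j hij ↦ Nat.coprime_pow_primes _ _ (hp i) (hp j) (hinj.ne hij))
    (fun i ↦ exists_isWeight_period hg hord (hp i) (hr i) (hex i))
    (fun o ↦ Nat.pos_of_dvd_of_pos (hg.period_dvd _) hpos) (fun o ↦ hg.period_dvd _)
  rw [← card_eq_sum_period] at key
  split_ifs with h
  · omega
  · rcases key with h' | ⟨⟨i, hi⟩, ⟨j, hj⟩, -⟩
    · exact h'
    · exact absurd ⟨hj ▸ hex j, hi ▸ hex i⟩ h
end

section
/- Let n = p₁^{r₁} p₂^{r₂} ⋯ p_k^{r_k} where the p_i are distinct primes and r_i ≥ 1 for every i (with n = 1 corresponding to the empty product). Then the minimum number of points of a finite poset whose automorphism group is isomorphic to the cyclic group ℤ/nℤ equals (Σ_{i=1}^k b(p_i^{r_i})·p_i^{r_i}) − 1 if 3 ∥ n and 4 ∥ n, and equals Σ_{i=1}^k b(p_i^{r_i})·p_i^{r_i} otherwise. -/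
/-- Some poset with `m` points has automorphism group isomorphic to `ℤ/nℤ`. -/
def RealizesCyclic (n m : ℕ) : Prop :=
  ∃ (P : Type) (_ : PartialOrder P) (_ : Fintype P),
    Fintype.card P = m ∧ Nonempty ((P ≃o P) ≃* Multiplicative (ZMod n))

section OrdinalSum

variable {P Q : Type} [PartialOrder P] [PartialOrder Q] [Finite P]

theorem OrderIso.exists_apply_sumLex_inl (f : P ⊕ₗ Q ≃o P ⊕ₗ Q) (x : P) :
    ∃ y : P, f (toLex (Sum.inl x)) = toLex (Sum.inl y) := by
  rcases h : ofLex (f (toLex (Sum.inl x))) with y | y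
  · exact ⟨y, by rw [← h, toLex_ofLex]⟩
  exfalso
  have h' : f (toLex (Sum.inl x)) = toLex (Sum.inr y) := by rw [← h, toLex_ofLex]
  have key : ∀ z : P, ∃ z' : P, f.symm (toLex (Sum.inl z)) = toLex (Sum.inl z') := by
    intro z
    have h1 : f.symm (toLex (Sum.inl z)) ≤ toLex (Sum.inl x) := by
      rw [f.symm_apply_le, h']
      exact Sum.Lex.inl_le_inr _ _
    rcases h2 : ofLex (f.symm (toLex (Sum.inl z))) with w | w
    · exact ⟨w, by rw [← h2, toLex_ofLex]⟩
    · have h3 : f.symm (toLex (Sum.inl z)) = toLex (Sum.inr w) := by rw [← h2, toLex_ofLex]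
      rw [h3] at h1
      exact absurd h1 Sum.Lex.not_inr_le_inl
  choose k hk using key
  have hinj : Function.Injective k := by
    intro u v huv
    have : f.symm (toLex (Sum.inl u)) = f.symm (toLex (Sum.inl v)) := by rw [hk, hk, huv]
    simpa using this
  obtain ⟨z, hz⟩ := Finite.injective_iff_surjective.1 hinj x
  have := hk z
  rw [hz, OrderIso.symm_apply_eq, h'] at this
  simp at this

theorem OrderIso.exists_apply_sumLex_inr (f : P ⊕ₗ Q ≃o P ⊕ₗ Q) (x : Q) :
    ∃ y : Q, f (toLex (Sum.inr x)) = toLex (Sum.inr y) := by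
  rcases h : ofLex (f (toLex (Sum.inr x))) with y | y
  · exfalso
    have h' : f (toLex (Sum.inr x)) = toLex (Sum.inl y) := by rw [← h, toLex_ofLex]
    obtain ⟨z, hz⟩ := f.symm.exists_apply_sumLex_inl y
    rw [← h', f.symm_apply_apply] at hz
    simp at hz
  · exact ⟨y, by rw [← h, toLex_ofLex]⟩

/-- Automorphisms of a finite ordinal sum are pairs of automorphisms of the summands. -/
theorem nonempty_sumLex_aut_mulEquiv [Finite Q] :
    Nonempty ((P ⊕ₗ Q ≃o P ⊕ₗ Q) ≃* (P ≃o P) × (Q ≃o Q)) := by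
  let F : (P ≃o P) × (Q ≃o Q) →* (P ⊕ₗ Q ≃o P ⊕ₗ Q) :=
    MonoidHom.mk' (fun e => OrderIso.sumLexCongr e.1 e.2) (by
      intro a c
      ext x
      rcases x with x | x <;> rfl)
  refine ⟨(MulEquiv.ofBijective F ⟨?_, ?_⟩).symm⟩
  · intro a c hac
    have h : ∀ x, F a x = F c x := fun x => by rw [hac]
    refine Prod.ext (OrderIso.ext (funext fun x => ?_)) (OrderIso.ext (funext fun x => ?_))
    · have := h (toLex (Sum.inl x))
      exact Sum.inl_injective this
    · have := h (toLex (Sum.inr x))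
      exact Sum.inr_injective this
  · intro f
    choose u hu using f.exists_apply_sumLex_inl
    choose v hv using f.exists_apply_sumLex_inr
    choose u' hu' using f.symm.exists_apply_sumLex_inl
    choose v' hv' using f.symm.exists_apply_sumLex_inr
    have e1 : ∀ x, u' (u x) = x := fun x => by
      have := hu' (u x)
      rw [← hu, f.symm_apply_apply] at this
      exact (Sum.inl_injective this).symm
    have e2 : ∀ x, u (u' x) = x := fun x => by
      have := hu (u' x)
      rw [← hu', f.apply_symm_apply] at this
      exact (Sum.inl_injective this).symm
    have e3 : ∀ x, v' (v x) = x := fun x => by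
      have := hv' (v x)
      rw [← hv, f.symm_apply_apply] at this
      exact (Sum.inr_injective this).symm
    have e4 : ∀ x, v (v' x) = x := fun x => by
      have := hv (v' x)
      rw [← hv', f.apply_symm_apply] at this
      exact (Sum.inr_injective this).symm
    refine ⟨(⟨⟨u, u', e1, e2⟩, ?_⟩, ⟨⟨v, v', e3, e4⟩, ?_⟩), ?_⟩
    · intro x y
      have := f.le_iff_le (x := toLex (Sum.inl x)) (y := toLex (Sum.inl y))
      rw [hu, hu] at this
      simpa using this
    · intro x y
      have := f.le_iff_le (x := toLex (Sum.inr x)) (y := toLex (Sum.inr y))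
      rw [hv, hv] at this
      simpa using this
    · ext x
      rcases x with x | x
      · exact (hu x).symm
      · exact (hv x).symm

end OrdinalSum

theorem RealizesCyclic.mul {n₁ n₂ m₁ m₂ : ℕ} (h₁ : RealizesCyclic n₁ m₁)
    (h₂ : RealizesCyclic n₂ m₂) (hn : n₁.Coprime n₂) : RealizesCyclic (n₁ * n₂) (m₁ + m₂) := by
  obtain ⟨P, _, _, rfl, ⟨e₁⟩⟩ := h₁
  obtain ⟨Q, _, _, rfl, ⟨e₂⟩⟩ := h₂
  obtain ⟨e⟩ := nonempty_sumLex_aut_mulEquiv (P := P) (Q := Q)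
  refine ⟨P ⊕ₗ Q, inferInstance, Fintype.ofEquiv (P ⊕ Q) toLex, ?_, ⟨?_⟩⟩
  · exact (Fintype.ofEquiv_card _).trans Fintype.card_sum
  · exact e.trans ((e₁.prodCongr e₂).trans ((MulEquiv.prodMultiplicative _ _).symm.trans
      (AddEquiv.toMultiplicative (ZMod.chineseRemainder hn).toAddEquiv).symm))

theorem nonempty_aut_mulEquiv_of_action {P : Type} [PartialOrder P] {n : ℕ}
    (act : ZMod n → P → P) (h_zero : ∀ x, act 0 x = x)
    (h_add : ∀ s t x, act (s + t) x = act s (act t x))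
    (h_mono : ∀ t x y, x ≤ y → act t x ≤ act t y)
    (h_faithful : ∀ t, (∀ x, act t x = x) → t = 0)
    (h_all : ∀ f : P ≃o P, ∃ t, ∀ x, f x = act t x) :
    Nonempty ((P ≃o P) ≃* Multiplicative (ZMod n)) := by
  have h1 : ∀ t x, act (-t) (act t x) = x := fun t x => by
    rw [← h_add, neg_add_cancel, h_zero]
  have h2 : ∀ t x, act t (act (-t) x) = x := fun t x => by
    rw [← h_add, add_neg_cancel, h_zero]
  let T : Multiplicative (ZMod n) →* (P ≃o P) := MonoidHom.mk'
    (fun t => ⟨⟨act t.toAdd, act (-t.toAdd), h1 _, h2 _⟩, fun {x y} =>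
      ⟨fun h => by
        have := h_mono (-t.toAdd) _ _ h
        simpa [h1] using this, h_mono _ _ _⟩⟩)
    (by
      intro s t
      ext x
      exact h_add _ _ _)
  refine ⟨(MulEquiv.ofBijective T ⟨?_, ?_⟩).symm⟩
  · rw [injective_iff_map_eq_one]
    intro t ht
    apply h_faithful t.toAdd
    intro x
    exact congrArg (fun f : P ≃o P => f x) ht
  · intro f
    obtain ⟨t, ht⟩ := h_all f
    refine ⟨Multiplicative.ofAdd t, ?_⟩
    ext x
    exact (ht x).symm

theorem realizesCyclic_one : RealizesCyclic 1 0 := by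
  refine ⟨Empty, inferInstance, inferInstance, rfl, ?_⟩
  exact nonempty_aut_mulEquiv_of_action (fun _ x => x) (fun _ => rfl) (fun _ _ _ => rfl)
    (fun _ _ _ h => h) (fun _ _ => Subsingleton.elim _ _) (fun _ => ⟨0, fun x => x.elim⟩)

/-- `ZMod q` with the discrete order. -/
inductive CyclicAntichain (q : ℕ)
  | pt (i : ZMod q)

instance (q : ℕ) : PartialOrder (CyclicAntichain q) where
  le x y := x = y
  le_refl _ := rfl
  le_trans _ _ _ := Eq.trans
  le_antisymm _ _ h _ := h

theorem realizesCyclic_two : RealizesCyclic 2 2 := by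
  let E : ZMod 2 ≃ CyclicAntichain 2 := ⟨.pt, fun ⟨i⟩ => i, fun _ => rfl, fun _ => rfl⟩
  refine ⟨CyclicAntichain 2, inferInstance, Fintype.ofEquiv _ E, Fintype.ofEquiv_card E, ?_⟩
  refine nonempty_aut_mulEquiv_of_action (fun t ⟨i⟩ => .pt (t + i)) ?_ ?_ ?_ ?_ ?_
  · rintro ⟨i⟩
    simp
  · rintro s t ⟨i⟩
    simp [add_assoc]
  · rintro t x y rfl
    exact le_rfl
  · intro t ht
    simpa using ht (.pt 0)
  · intro f
    obtain ⟨t, ht⟩ : ∃ t, f (.pt 0) = .pt t := by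
      rcases f (.pt 0) with ⟨t⟩
      exact ⟨t, rfl⟩
    obtain ⟨s, hs⟩ : ∃ s, f (.pt 1) = .pt s := by
      rcases f (.pt 1) with ⟨t⟩
      exact ⟨t, rfl⟩
    have hne : s ≠ t := by
      rintro rfl
      have := f.injective (ht.trans hs.symm)
      simp at this
    refine ⟨t, ?_⟩
    rintro ⟨i⟩
    have hst : s = t + 1 := by
      clear hs ht
      revert s t
      decide
    have hi : i = 0 ∨ i = 1 := by
      revert i
      decide
    rcases hi with rfl | rfl
    · simp [ht]
    · simp [hs, hst]
theorem ZMod.apply_eq_of_apply_succ {q : ℕ} [NeZero q] {σ : ZMod q → ZMod q} {u : ZMod q}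
    (h : ∀ i, σ (i + 1) = σ i + u) (i : ZMod q) : σ i = σ 0 + u * i := by
  obtain ⟨k, rfl⟩ := ZMod.natCast_zmod_surjective i
  induction k with
  | zero => simp
  | succ k ih =>
    rw [Nat.cast_succ, h, ih]
    ring

/-- Three copies of `ZMod q`, with `bot i < mid i < top i` and `bot i < top (i + 1)`. -/
inductive CyclicThreeLevel (q : ℕ)
  | bot (i : ZMod q)
  | mid (i : ZMod q)
  | top (i : ZMod q)

namespace CyclicThreeLevel

variable {q : ℕ}

/-- The order relation of `CyclicThreeLevel`. -/
def Le : CyclicThreeLevel q → CyclicThreeLevel q → Prop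
  | bot i, bot j => i = j
  | mid i, mid j => i = j
  | top i, top j => i = j
  | bot i, mid j => i = j
  | mid i, top j => i = j
  | bot i, top j => j = i ∨ j = i + 1
  | _, _ => False

instance : PartialOrder (CyclicThreeLevel q) where
  le := Le
  le_refl x := by cases x <;> simp [Le]
  le_trans x y z := by
    rcases x with x | x | x <;> rcases y with y | y | y <;> rcases z with z | z | z <;>
      simp [Le] <;> grind
  le_antisymm x y := by
    rcases x with x | x | x <;> rcases y with y | y | y <;> simp [Le] <;> grind

theorem le_def (x y : CyclicThreeLevel q) : x ≤ y ↔ Le x y := Iff.rfl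

/-- The underlying set of `CyclicThreeLevel q`. -/
def equivSum : ZMod q ⊕ ZMod q ⊕ ZMod q ≃ CyclicThreeLevel q where
  toFun x := x.elim bot (fun y => y.elim mid top)
  invFun
    | bot i => .inl i
    | mid i => .inr (.inl i)
    | top i => .inr (.inr i)
  left_inv x := by rcases x with x | x | x <;> rfl
  right_inv x := by rcases x with x | x | x <;> rfl

/-- The action of `ZMod q` by translations. -/
def shift (t : ZMod q) : CyclicThreeLevel q → CyclicThreeLevel q
  | bot i => bot (t + i)
  | mid i => mid (t + i)
  | top i => top (t + i)

theorem exists_eq_mid {x y z : CyclicThreeLevel q} (hxy : x < y) (hyz : y < z) :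
    ∃ i, y = mid i := by
  rw [lt_iff_le_and_ne, le_def] at hxy hyz
  rcases x with x | x | x <;> rcases y with y | y | y <;> rcases z with z | z | z <;>
    simp_all [Le]

theorem bot_lt_mid (i : ZMod q) : bot i < mid i := by
  simp [lt_iff_le_and_ne, le_def, Le]

theorem mid_lt_top (i : ZMod q) : mid i < top i := by
  simp [lt_iff_le_and_ne, le_def, Le]

theorem exists_shift [NeZero q] (hq : (1 : ZMod q) ≠ 0) (f : CyclicThreeLevel q ≃o CyclicThreeLevel q) :
    ∃ t, ∀ x, f x = shift t x := by
  have h_mid : ∀ i, ∃ j, f (mid i) = mid j := fun i =>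
    exists_eq_mid (f.lt_iff_lt.2 (bot_lt_mid i)) (f.lt_iff_lt.2 (mid_lt_top i))
  choose σ hσ using h_mid
  have h_bot : ∀ i, f (bot i) = bot (σ i) := by
    intro i
    have := f.lt_iff_lt.2 (bot_lt_mid i)
    rw [hσ, lt_iff_le_and_ne, le_def] at this
    generalize f (bot i) = z at this ⊢
    rcases z with x | x | x <;> simp_all [Le]
  have h_top : ∀ i, f (top i) = top (σ i) := by
    intro i
    have := f.lt_iff_lt.2 (mid_lt_top i)
    rw [hσ, lt_iff_le_and_ne, le_def] at this
    generalize f (top i) = z at this ⊢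
    rcases z with x | x | x <;> simp_all [Le]
  have h_succ : ∀ i, σ (i + 1) = σ i + 1 := by
    intro i
    have h1 : f (bot i) ≤ f (top (i + 1)) := f.le_iff_le.2 (Or.inr rfl)
    rw [h_bot, h_top] at h1
    rcases h1 with h1 | h1
    · have : f (mid (i + 1)) = f (mid i) := by rw [hσ, hσ, h1]
      have := f.injective this
      simp [hq] at this
    · exact h1
  have h_all := ZMod.apply_eq_of_apply_succ h_succ
  simp only [one_mul] at h_all
  refine ⟨σ 0, ?_⟩
  rintro (i | i | i)
  · rw [h_bot, h_all, shift]
  · rw [hσ, h_all, shift]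
  · rw [h_top, h_all, shift]

end CyclicThreeLevel

theorem realizesCyclic_three_mul {q : ℕ} (hq : 2 ≤ q) : RealizesCyclic q (3 * q) := by
  have : NeZero q := ⟨by omega⟩
  have h_one : (1 : ZMod q) ≠ 0 := by
    have : Fact (1 < q) := ⟨hq⟩
    exact one_ne_zero
  refine ⟨CyclicThreeLevel q, inferInstance, Fintype.ofEquiv _ CyclicThreeLevel.equivSum,
    ?_, ?_⟩
  · rw [Fintype.ofEquiv_card]
    simp only [Fintype.card_sum, ZMod.card]
    ring
  refine nonempty_aut_mulEquiv_of_action CyclicThreeLevel.shift ?_ ?_ ?_ ?_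
    (CyclicThreeLevel.exists_shift h_one)
  · rintro (i | i | i) <;> simp [CyclicThreeLevel.shift]
  · rintro s t (i | i | i) <;> simp [CyclicThreeLevel.shift, add_assoc]
  · rintro t (i | i | i) (j | j | j) <;>
      simp [CyclicThreeLevel.shift, CyclicThreeLevel.le_def, CyclicThreeLevel.Le, add_assoc]
  · intro t ht
    simpa [CyclicThreeLevel.shift] using ht (.bot 0)
/-- Two copies of `ZMod q`, with `bot i < top j` when `j - i ∈ S`. -/
inductive CyclicTwoLevel (q : ℕ) (S : Finset (ZMod q))
  | bot (i : ZMod q)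
  | top (i : ZMod q)

namespace CyclicTwoLevel

variable {q : ℕ} {S : Finset (ZMod q)}

/-- The order relation of `CyclicTwoLevel`. -/
def Le : CyclicTwoLevel q S → CyclicTwoLevel q S → Prop
  | bot i, bot j => i = j
  | top i, top j => i = j
  | bot i, top j => j - i ∈ S
  | top _, bot _ => False

instance : PartialOrder (CyclicTwoLevel q S) where
  le := Le
  le_refl x := by cases x <;> simp [Le]
  le_trans x y z := by
    rcases x with x | x <;> rcases y with y | y <;> rcases z with z | z <;>
      simp [Le] <;> grind
  le_antisymm x y := by
    rcases x with x | x <;> rcases y with y | y <;> simp +contextual [Le]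

theorem le_def (x y : CyclicTwoLevel q S) : x ≤ y ↔ Le x y := Iff.rfl

/-- The underlying set of `CyclicTwoLevel q S`. -/
def equivSum : ZMod q ⊕ ZMod q ≃ CyclicTwoLevel q S where
  toFun x := x.elim bot top
  invFun
    | bot i => .inl i
    | top i => .inr i
  left_inv x := by rcases x with x | x <;> rfl
  right_inv x := by rcases x with x | x <;> rfl

/-- The action of `ZMod q` by translations. -/
def shift (t : ZMod q) : CyclicTwoLevel q S → CyclicTwoLevel q S
  | bot i => bot (t + i)
  | top i => top (t + i)

theorem exists_eq_bot {x y : CyclicTwoLevel q S} (hxy : x < y) : ∃ i, x = bot i := by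
  rw [lt_iff_le_and_ne, le_def] at hxy
  rcases x with x | x <;> rcases y with y | y <;> simp_all [Le]

theorem exists_eq_top {x y : CyclicTwoLevel q S} (hxy : x < y) : ∃ i, y = top i := by
  rw [lt_iff_le_and_ne, le_def] at hxy
  rcases x with x | x <;> rcases y with y | y <;> simp_all [Le]

theorem bot_lt_top {i j : ZMod q} : (bot i : CyclicTwoLevel q S) < top j ↔ j - i ∈ S := by
  simp [lt_iff_le_and_ne, le_def, Le]

end CyclicTwoLevel

/-- The only permutations of `ZMod q` induced on both sides by an automorphism of the bipartite
Cayley graph of `S` are the translations, if the number of common neighbours singles out the pairs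
at distance one and no reflection preserves `S`. -/
theorem ZMod.eq_translation_of_sub_mem_iff {q : ℕ} [NeZero q] (hq : (2 : ZMod q) ≠ 0)
    (S : Finset (ZMod q)) (κ : ℕ)
    (h_count : ∀ d : ZMod q, (S.filter (fun s => s + d ∈ S)).card = κ ↔ d = 1 ∨ d = -1)
    (h_stab : ∀ c : ZMod q, (∀ s ∈ S, s + c ∈ S) → c = 0)
    (h_refl : ∀ c : ZMod q, ¬ ∀ s ∈ S, c - s ∈ S)
    (σ τ : Equiv.Perm (ZMod q)) (h : ∀ i j, j - i ∈ S ↔ τ j - σ i ∈ S) :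
    ∃ t, (∀ i, σ i = t + i) ∧ ∀ i, τ i = t + i := by
  have key : ∀ i i', (S.filter (fun s => s + (i - i') ∈ S)).card =
      (S.filter (fun s => s + (σ i - σ i') ∈ S)).card := by
    intro i i'
    refine Finset.card_bij (fun s _ => τ (s + i) - σ i) ?_ ?_ ?_
    · intro s hs
      rw [Finset.mem_filter] at hs ⊢
      constructor
      · rw [← h]
        simpa using hs.1
      · rw [sub_add_sub_cancel, ← h]
        convert hs.2 using 1
        ring
    · intro s _ s' _ hss
      simpa using hss
    · intro s hs
      rw [Finset.mem_filter] at hs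
      have e : τ (τ.symm (s + σ i)) - σ i = s := by simp
      refine ⟨τ.symm (s + σ i) - i, ?_, by simp⟩
      rw [Finset.mem_filter]
      constructor
      · rw [h, e]
        exact hs.1
      · rw [sub_add_sub_cancel, h, Equiv.apply_symm_apply]
        convert hs.2 using 1
        ring
  have h_step : ∀ i, σ (i + 1) - σ i = 1 ∨ σ (i + 1) - σ i = -1 := by
    intro i
    rw [← h_count, ← key, h_count]
    simp
  have h_const : ∀ i, σ (i + 1 + 1) - σ (i + 1) = σ (i + 1) - σ i + 0 := by
    intro i
    have hne : σ (i + 1 + 1) ≠ σ i := by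
      intro h'
      have := σ.injective h'
      rw [add_assoc, one_add_one_eq_two] at this
      exact hq (by simpa using this)
    rcases h_step i with h1 | h1 <;> rcases h_step (i + 1) with h2 | h2
    · rw [h1, h2, add_zero]
    · exact absurd (by linear_combination h1 + h2) hne
    · exact absurd (by linear_combination h1 + h2) hne
    · rw [h1, h2, add_zero]
  have h_const' := ZMod.apply_eq_of_apply_succ (σ := fun i => σ (i + 1) - σ i) h_const
  simp only [zero_mul, add_zero, zero_add] at h_const'
  have h_lin := ZMod.apply_eq_of_apply_succ (σ := σ) (u := σ 1 - σ 0)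
    (fun i => by rw [← h_const' i]; ring)
  rcases h_step 0 with h1 | h1 <;> rw [zero_add] at h1 <;> rw [h1] at h_lin
  · refine ⟨σ 0, fun i => by rw [h_lin, one_mul], fun j => ?_⟩
    rw [eq_comm, ← sub_eq_zero, ← neg_eq_zero]
    apply h_stab
    intro s hs
    have := (h (j - s) j).1 (by simpa using hs)
    rw [h_lin] at this
    convert this using 1
    ring
  · exfalso
    refine h_refl (τ 0 - σ 0) fun s hs => ?_
    have := (h (-s) 0).1 (by simpa using hs)
    rw [h_lin] at this
    convert this using 1
    ring

theorem realizesCyclic_two_mul {q : ℕ} [NeZero q] (hq : (2 : ZMod q) ≠ 0)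
    (S : Finset (ZMod q)) (h_zero : 0 ∈ S) (κ : ℕ)
    (h_count : ∀ d : ZMod q, (S.filter (fun s => s + d ∈ S)).card = κ ↔ d = 1 ∨ d = -1)
    (h_stab : ∀ c : ZMod q, (∀ s ∈ S, s + c ∈ S) → c = 0)
    (h_refl : ∀ c : ZMod q, ¬ ∀ s ∈ S, c - s ∈ S) : RealizesCyclic q (2 * q) := by
  refine ⟨CyclicTwoLevel q S, inferInstance, Fintype.ofEquiv _ CyclicTwoLevel.equivSum,
    ?_, ?_⟩
  · rw [Fintype.ofEquiv_card]
    simp only [Fintype.card_sum, ZMod.card]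
    ring
  refine nonempty_aut_mulEquiv_of_action CyclicTwoLevel.shift ?_ ?_ ?_ ?_ ?_
  · rintro (i | i) <;> simp [CyclicTwoLevel.shift]
  · rintro s t (i | i) <;> simp [CyclicTwoLevel.shift, add_assoc]
  · rintro t (i | i) (j | j) <;>
      simp [CyclicTwoLevel.shift, CyclicTwoLevel.le_def, CyclicTwoLevel.Le]
  · intro t ht
    simpa [CyclicTwoLevel.shift] using ht (.bot 0)
  · intro f
    have h_lt : ∀ i : ZMod q, (.bot i : CyclicTwoLevel q S) < .top i := fun i =>
      CyclicTwoLevel.bot_lt_top.2 (by simpa using h_zero)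
    choose σ hσ using fun i => CyclicTwoLevel.exists_eq_bot (f.lt_iff_lt.2 (h_lt i))
    choose τ hτ using fun i => CyclicTwoLevel.exists_eq_top (f.lt_iff_lt.2 (h_lt i))
    have hσ_inj : Function.Injective σ := fun i j hij => by
      have : f (.bot i) = f (.bot j) := by rw [hσ, hσ, hij]
      simpa using this
    have hτ_inj : Function.Injective τ := fun i j hij => by
      have : f (.top i) = f (.top j) := by rw [hτ, hτ, hij]
      simpa using this
    obtain ⟨t, h1, h2⟩ := ZMod.eq_translation_of_sub_mem_iff hq S κ h_count h_stab h_refl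
      (Equiv.ofBijective σ (Finite.injective_iff_bijective.1 hσ_inj))
      (Equiv.ofBijective τ (Finite.injective_iff_bijective.1 hτ_inj)) (by
        intro i j
        rw [← CyclicTwoLevel.bot_lt_top, ← f.lt_iff_lt, hσ, hτ, CyclicTwoLevel.bot_lt_top]
        rfl)
    refine ⟨t, ?_⟩
    rintro (i | i)
    · rw [hσ, CyclicTwoLevel.shift, ← h1]
      rfl
    · rw [hτ, CyclicTwoLevel.shift, ← h2]
      rfl

theorem realizesCyclic_eight : RealizesCyclic 8 (2 * 8) :=
  realizesCyclic_two_mul (by decide) {0, 3, 4, 6} (by decide) 1 (by decide) (by decide)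
    (by decide)

theorem realizesCyclic_nine : RealizesCyclic 9 (2 * 9) :=
  realizesCyclic_two_mul (by decide) {0, 3, 7} (by decide) 0 (by decide) (by decide)
    (by decide)

theorem ZMod.intCast_inj_of_abs_lt {q : ℕ} {x y : ℤ} (h : |x - y| < q)
    (hxy : (x : ZMod q) = y) : x = y := by
  have h1 := (ZMod.intCast_eq_intCast_iff_dvd_sub y x q).1 hxy.symm
  have := Int.eq_zero_of_abs_lt_dvd h1 h
  omega

theorem realizesCyclic_of_eleven_le {q : ℕ} (hq : 11 ≤ q) : RealizesCyclic q (2 * q) := by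
  have : NeZero q := ⟨by omega⟩
  have h_inj : ∀ x y : ℤ, |x - y| ≤ 10 → (x : ZMod q) = y → x = y := fun x y h =>
    ZMod.intCast_inj_of_abs_lt (by omega)
  let R : Finset ℤ := {0, 1, 2, 5}
  have hR : ∀ x ∈ R, 0 ≤ x ∧ x ≤ 5 := by decide
  let S : Finset (ZMod q) := R.image Int.cast
  have h_mem : ∀ z : ℤ, -5 ≤ z → z ≤ 10 → ((z : ZMod q) ∈ S ↔ z ∈ R) := by
    intro z h1 h2
    constructor
    · intro h
      obtain ⟨r, hr, hrz⟩ := Finset.mem_image.1 h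
      have := hR r hr
      rwa [← h_inj r z (by rw [abs_le]; omega) hrz]
    · exact fun h => Finset.mem_image_of_mem _ h
  have h_injOn : Set.InjOn (Int.cast : ℤ → ZMod q) R := by
    intro x hx y hy hxy
    have := hR x hx
    have := hR y hy
    exact h_inj x y (by rw [abs_le]; omega) hxy
  have h_card : ∀ d : ℤ, -1 ≤ d → d ≤ 1 →
      (S.filter (fun s => s + (d : ZMod q) ∈ S)).card = (R.filter (fun s => s + d ∈ R)).card := by
    intro d h1 h2
    rw [← Finset.card_image_of_injOn (h_injOn.mono (Finset.filter_subset (fun s => s + d ∈ R) R)),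
      Finset.filter_image]
    congr 2
    refine Finset.filter_congr fun x hx => ?_
    have := hR x hx
    rw [← Int.cast_add, h_mem _ (by omega) (by omega)]
  refine realizesCyclic_two_mul ?_ S ?_ 2 ?_ ?_ ?_
  · intro h
    have := h_inj 2 0 (by decide) (by exact_mod_cast h)
    omega
  · exact_mod_cast (h_mem 0 (by decide) (by decide)).2 (by decide)
  · intro d
    constructor
    · intro h
      obtain ⟨s, hs, s', hs', hss⟩ := Finset.one_lt_card.1 (show 1 < _ by rw [h]; decide)
      rw [Finset.mem_filter] at hs hs'
      obtain ⟨r, hr, rfl⟩ := Finset.mem_image.1 hs.1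
      obtain ⟨r', hr', rfl⟩ := Finset.mem_image.1 hs'.1
      obtain ⟨t, ht, htr⟩ := Finset.mem_image.1 hs.2
      obtain ⟨t', ht', htr'⟩ := Finset.mem_image.1 hs'.2
      have := hR r hr
      have := hR r' hr'
      have := hR t ht
      have := hR t' ht'
      have h_diff := h_inj (t - r) (t' - r') (by rw [abs_le]; omega)
        (by push_cast; linear_combination htr - htr')
      have h_dec : ∀ r ∈ R, ∀ r' ∈ R, ∀ t ∈ R, ∀ t' ∈ R, r ≠ r' → t - r = t' - r' →
          t - r = 0 ∨ t - r = 1 ∨ t - r = -1 := by decide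
      have hd : d = ((t - r : ℤ) : ZMod q) := by
        push_cast
        linear_combination -htr
      rcases h_dec r hr r' hr' t ht t' ht' (fun e => hss (by rw [e])) h_diff with e | e | e <;>
        rw [e] at hd <;> subst hd
      · rw [h_card 0 (by decide) (by decide)] at h
        exact absurd h (by decide)
      · simp
      · simp
    · rintro (rfl | rfl)
      · exact_mod_cast (h_card 1 (by decide) (by decide)).trans (by decide)
      · exact_mod_cast (h_card (-1) (by decide) (by decide)).trans (by decide)
  · intro c hc
    obtain ⟨r, hr, hrc⟩ := Finset.mem_image.1 (hc (0 : ℤ) ((h_mem 0 (by decide) (by decide)).2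
      (by decide)))
    have h_all : ∀ x ∈ R, x + r ∈ R := by
      intro x hx
      have := hR x hx
      have := hR r hr
      rw [← h_mem _ (by omega) (by omega)]
      have := hc x (Finset.mem_image_of_mem _ hx)
      push_cast at hrc ⊢
      rwa [hrc, zero_add]
    have h_dec : ∀ r ∈ R, (∀ x ∈ R, x + r ∈ R) → r = 0 := by decide
    rw [h_dec r hr h_all] at hrc
    simpa using hrc.symm
  · intro c hc
    obtain ⟨r, hr, hrc⟩ := Finset.mem_image.1 (hc (0 : ℤ) ((h_mem 0 (by decide) (by decide)).2
      (by decide)))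
    have h_all : ∀ x ∈ R, r - x ∈ R := by
      intro x hx
      have := hR x hx
      have := hR r hr
      rw [← h_mem _ (by omega) (by omega)]
      have := hc x (Finset.mem_image_of_mem _ hx)
      push_cast at hrc ⊢
      rwa [hrc, sub_zero]
    have h_dec : ∀ r ∈ R, ¬ ∀ x ∈ R, r - x ∈ R := by decide
    exact h_dec r hr h_all
/-- The points of a poset of size twenty whose automorphism group is cyclic of order twelve: two
copies of `ZMod 4` and two copies of `ZMod 6`. -/
inductive CyclicTwelve
  | bot (i : ZMod 4)
  | left (i : ZMod 4)
  | right (i : ZMod 6)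
  | top (i : ZMod 6)

namespace CyclicTwelve

/-- The parity of a residue modulo `4` agrees with that of a residue modulo `6`. -/
abbrev SameParity (i : ZMod 4) (j : ZMod 6) : Prop := i.val % 2 = j.val % 2

/-- The differences between adjacent residues modulo `4`. -/
abbrev Adj₄ (i j : ZMod 4) : Prop := j - i = 0 ∨ j - i = 1

/-- The differences between adjacent residues modulo `6`. -/
abbrev Adj₆ (i j : ZMod 6) : Prop := j - i = 0 ∨ j - i = 1 ∨ j - i = 3

/-- The order relation of `CyclicTwelve`. -/
def Le : CyclicTwelve → CyclicTwelve → Prop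
  | bot i, bot j => i = j
  | left i, left j => i = j
  | right i, right j => i = j
  | top i, top j => i = j
  | bot i, left j => Adj₄ i j
  | bot i, right j => SameParity i j
  | left i, top j => SameParity i j
  | right i, top j => Adj₆ i j
  | bot _, top _ => True
  | _, _ => False

instance : PartialOrder CyclicTwelve where
  le := Le
  le_refl x := by cases x <;> simp [Le]
  le_trans x y z := by
    rcases x with x | x | x | x <;> rcases y with y | y | y | y <;>
      rcases z with z | z | z | z <;> simp +contextual [Le] <;> grind
  le_antisymm x y := by
    rcases x with x | x | x | x <;> rcases y with y | y | y | y <;> simp +contextual [Le]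

theorem le_def (x y : CyclicTwelve) : x ≤ y ↔ Le x y := Iff.rfl

/-- The underlying set of `CyclicTwelve`. -/
def equivSum : (ZMod 4 ⊕ ZMod 4) ⊕ (ZMod 6 ⊕ ZMod 6) ≃ CyclicTwelve where
  toFun x := x.elim (fun y => y.elim bot left) (fun y => y.elim right top)
  invFun
    | bot i => .inl (.inl i)
    | left i => .inl (.inr i)
    | right i => .inr (.inl i)
    | top i => .inr (.inr i)
  left_inv x := by rcases x with (x | x) | (x | x) <;> rfl
  right_inv x := by rcases x with x | x | x | x <;> rfl

/-- The action of `ZMod 12` by translations. -/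
def shift (t : ZMod 12) : CyclicTwelve → CyclicTwelve
  | bot i => bot (t.cast + i)
  | left i => left (t.cast + i)
  | right i => right (t.cast + i)
  | top i => top (t.cast + i)

theorem bot_lt_left {i j : ZMod 4} : bot i < left j ↔ Adj₄ i j := by
  simp [lt_iff_le_and_ne, le_def, Le]

theorem bot_lt_right {i : ZMod 4} {j : ZMod 6} : bot i < right j ↔ SameParity i j := by
  simp [lt_iff_le_and_ne, le_def, Le]

theorem left_lt_top {i : ZMod 4} {j : ZMod 6} : left i < top j ↔ SameParity i j := by
  simp [lt_iff_le_and_ne, le_def, Le]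

theorem right_lt_top {i j : ZMod 6} : right i < top j ↔ Adj₆ i j := by
  simp [lt_iff_le_and_ne, le_def, Le]

theorem exists_eq_left_or_right {x y z : CyclicTwelve} (hxy : x < y) (hyz : y < z) :
    (∃ i, y = left i) ∨ ∃ i, y = right i := by
  rw [lt_iff_le_and_ne, le_def] at hxy hyz
  rcases x with x | x | x | x <;> rcases y with y | y | y | y <;>
    rcases z with z | z | z | z <;> simp_all [Le]

theorem sameParity_shift : ∀ (t : ZMod 12) (i : ZMod 4) (j : ZMod 6),
    SameParity (t.cast + i) (t.cast + j) ↔ SameParity i j := by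
  decide

set_option synthInstance.maxSize 2000 in
set_option synthInstance.maxHeartbeats 400000 in
set_option maxRecDepth 10000 in
/-- The maps induced on the levels by an automorphism of `CyclicTwelve` are translations. -/
theorem eq_translation {α β : ZMod 4 → ZMod 4} {γ δ : ZMod 6 → ZMod 6}
    (h_bl : ∀ i j, Adj₄ i j ↔ Adj₄ (α i) (β j)) (h_br : ∀ i j, SameParity i j ↔ SameParity (α i) (γ j))
    (h_lt : ∀ i j, SameParity i j ↔ SameParity (β i) (δ j)) (h_rt : ∀ i j, Adj₆ i j ↔ Adj₆ (γ i) (δ j)) :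
    ∃ t : ZMod 12, (∀ i, α i = t.cast + i) ∧ (∀ i, β i = t.cast + i) ∧
      (∀ i, γ i = t.cast + i) ∧ ∀ i, δ i = t.cast + i := by
  obtain ⟨t, hα, hγ⟩ : ∃ t : ZMod 12, α 0 = t.cast ∧ γ 0 = t.cast := by
    have h := (h_br 0 0).1 rfl
    generalize α 0 = x at h ⊢
    generalize γ 0 = y at h ⊢
    revert x y
    decide
  refine ⟨t, ?_⟩
  obtain ⟨α', rfl⟩ : ∃ α' : ZMod 4 → ZMod 4, α = fun i => t.cast + α' i :=
    ⟨fun i => α i - t.cast, by simp⟩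
  obtain ⟨β', rfl⟩ : ∃ β' : ZMod 4 → ZMod 4, β = fun i => t.cast + β' i :=
    ⟨fun i => β i - t.cast, by simp⟩
  obtain ⟨γ', rfl⟩ : ∃ γ' : ZMod 6 → ZMod 6, γ = fun i => t.cast + γ' i :=
    ⟨fun i => γ i - t.cast, by simp⟩
  obtain ⟨δ', rfl⟩ : ∃ δ' : ZMod 6 → ZMod 6, δ = fun i => t.cast + δ' i :=
    ⟨fun i => δ i - t.cast, by simp⟩
  simp only [sameParity_shift, Adj₄, Adj₆, add_sub_add_left_eq_sub, add_eq_left, add_right_inj]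
    at h_bl h_br h_lt h_rt hα hγ ⊢
  have h_δ : δ' = id := by
    have h_dec : ∀ d₀ : ZMod 6, Adj₆ 0 d₀ → ∀ d₂ : ZMod 6, ¬ Adj₆ 0 d₂ →
        d₀.val % 2 = d₂.val % 2 → ∀ d₄ : ZMod 6, ¬ Adj₆ 0 d₄ → d₀.val % 2 = d₄.val % 2 →
        ∀ d₁ : ZMod 6, Adj₆ 0 d₁ → ∀ d₃ : ZMod 6, Adj₆ 0 d₃ → d₁.val % 2 = d₃.val % 2 →
        ∀ d₅ : ZMod 6, ¬ Adj₆ 0 d₅ → d₁.val % 2 = d₅.val % 2 →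
        (∀ i : ZMod 6, ∃ g : ZMod 6, (Adj₆ i 0 ↔ Adj₆ g d₀) ∧ (Adj₆ i 1 ↔ Adj₆ g d₁) ∧
          (Adj₆ i 2 ↔ Adj₆ g d₂) ∧ (Adj₆ i 3 ↔ Adj₆ g d₃) ∧ (Adj₆ i 4 ↔ Adj₆ g d₄) ∧
          (Adj₆ i 5 ↔ Adj₆ g d₅)) →
        d₀ = 0 ∧ d₁ = 1 ∧ d₂ = 2 ∧ d₃ = 3 ∧ d₄ = 4 ∧ d₅ = 5 := by
      decide
    have h_par : ∀ i j : ZMod 6, i.val % 2 = j.val % 2 → (δ' i).val % 2 = (δ' j).val % 2 := by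
      intro i j hij
      obtain ⟨k, hk⟩ : ∃ k, SameParity k i := by
        revert i
        decide +revert
      rw [← (h_lt k i).1 hk, (h_lt k j).1 (hk.trans hij)]
    have h_zero : ∀ j, Adj₆ 0 j ↔ Adj₆ 0 (δ' j) := fun j => by
      have := h_rt 0 j
      rwa [hγ] at this
    obtain ⟨h0, h1, h2, h3, h4, h5⟩ := h_dec (δ' 0) ((h_zero _).1 (by decide))
      (δ' 2) (by rw [← h_zero]; decide) (h_par _ _ (by decide))
      (δ' 4) (by rw [← h_zero]; decide) (h_par _ _ (by decide))
      (δ' 1) ((h_zero _).1 (by decide)) (δ' 3) ((h_zero _).1 (by decide)) (h_par _ _ (by decide))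
      (δ' 5) (by rw [← h_zero]; decide) (h_par _ _ (by decide))
      (fun i => ⟨γ' i, h_rt i 0, h_rt i 1, h_rt i 2, h_rt i 3, h_rt i 4, h_rt i 5⟩)
    funext i
    fin_cases i <;> assumption
  subst h_δ
  have h_γ : ∀ i, γ' i = i := by
    have h_dec : ∀ i g : ZMod 6, (∀ j, Adj₆ i j ↔ Adj₆ g j) → g = i := by decide
    exact fun i => h_dec i _ (h_rt i)
  have h_β : ∀ i, β' i = i := by
    have h_dec : ∀ i g : ZMod 4, (∀ j, SameParity i j ↔ SameParity g j) →
        (Adj₄ 0 i ↔ Adj₄ 0 g) → g = i := by decide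
    intro i
    refine h_dec i _ (h_lt i) ?_
    have := h_bl 0 i
    rwa [hα] at this
  have h_α : ∀ i, α' i = i := by
    have h_dec : ∀ i g : ZMod 4, (∀ j, Adj₄ i j ↔ Adj₄ g j) → g = i := by decide
    intro i
    refine h_dec i _ fun j => ?_
    have := h_bl i j
    rwa [h_β] at this
  exact ⟨h_α, h_β, h_γ, fun _ => rfl⟩

theorem exists_apply_left (f : CyclicTwelve ≃o CyclicTwelve) (i : ZMod 4) :
    ∃ j, f (left i) = left j := by
  have h_mid : ∀ k : ZMod 4, (∃ j, f (left k) = left j) ∨ ∃ j, f (left k) = right j := by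
    intro k
    obtain ⟨z, hz⟩ : ∃ z, SameParity k z := by
      revert k
      decide
    exact exists_eq_left_or_right (f.lt_iff_lt.2 (bot_lt_left.2 (Or.inl (sub_self k))))
      (f.lt_iff_lt.2 (left_lt_top.2 hz))
  rcases h_mid i with h | ⟨j, hj⟩
  · exact h
  exfalso
  have h_same : ∀ z, left i < z ↔ left (i + 2) < z := by
    have h_dec : ∀ (i : ZMod 4) (j : ZMod 6), SameParity i j ↔ SameParity (i + 2) j := by decide
    rintro (z | z | z | z) <;> simp [lt_iff_le_and_ne, le_def, Le]
    rw [h_dec]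
  have h_same' : ∀ z, right j < z ↔ f (left (i + 2)) < z := by
    intro z
    rw [← hj, ← f.apply_symm_apply z, f.lt_iff_lt, f.lt_iff_lt, h_same]
  rcases h_mid (i + 2) with ⟨k, hk⟩ | ⟨k, hk⟩
  · have h_dec : ∀ (j : ZMod 6) (k : ZMod 4), ¬ ∀ z, Adj₆ j z ↔ SameParity k z := by decide
    refine h_dec j k fun z => ?_
    rw [← right_lt_top, h_same', hk, left_lt_top]
  · have h_dec : ∀ j k : ZMod 6, (∀ z, Adj₆ j z ↔ Adj₆ k z) → j = k := by decide
    have hjk : j = k := h_dec j k fun z => by rw [← right_lt_top, h_same', hk, right_lt_top]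
    have := f.injective (hj.trans (hjk ▸ hk.symm))
    simp only [left.injEq, left_eq_add] at this
    revert this
    decide

theorem exists_apply_right (f : CyclicTwelve ≃o CyclicTwelve) (i : ZMod 6) :
    ∃ j, f (right i) = right j := by
  obtain ⟨z, hz⟩ : ∃ z, SameParity z i := by
    revert i
    decide
  rcases exists_eq_left_or_right (f.lt_iff_lt.2 (bot_lt_right.2 hz))
    (f.lt_iff_lt.2 (right_lt_top.2 (Or.inl (sub_self i)))) with ⟨j, hj⟩ | h
  · obtain ⟨k, hk⟩ := exists_apply_left f.symm j
    rw [← hj, f.symm_apply_apply] at hk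
    simp at hk
  · exact h

theorem exists_apply_bot (f : CyclicTwelve ≃o CyclicTwelve) (i : ZMod 4) :
    ∃ j, f (bot i) = bot j := by
  obtain ⟨j, hj⟩ := exists_apply_left f i
  have := f.lt_iff_lt.2 (bot_lt_left.2 (Or.inl (sub_self i)))
  rw [hj, lt_iff_le_and_ne, le_def] at this
  generalize f (bot i) = z at this ⊢
  rcases z with x | x | x | x <;> simp_all [Le]

theorem exists_apply_top (f : CyclicTwelve ≃o CyclicTwelve) (i : ZMod 6) :
    ∃ j, f (top i) = top j := by
  obtain ⟨j, hj⟩ := exists_apply_right f i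
  have := f.lt_iff_lt.2 (right_lt_top.2 (Or.inl (sub_self i)))
  rw [hj, lt_iff_le_and_ne, le_def] at this
  generalize f (top i) = z at this ⊢
  rcases z with x | x | x | x <;> simp_all [Le]

theorem exists_shift (f : CyclicTwelve ≃o CyclicTwelve) : ∃ t, ∀ x, f x = shift t x := by
  choose α hα using exists_apply_bot f
  choose β hβ using exists_apply_left f
  choose γ hγ using exists_apply_right f
  choose δ hδ using exists_apply_top f
  obtain ⟨t, h1, h2, h3, h4⟩ := eq_translation (α := α) (β := β) (γ := γ) (δ := δ)
    (fun i j => by rw [← bot_lt_left, ← f.lt_iff_lt, hα, hβ, bot_lt_left])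
    (fun i j => by rw [← bot_lt_right, ← f.lt_iff_lt, hα, hγ, bot_lt_right])
    (fun i j => by rw [← left_lt_top, ← f.lt_iff_lt, hβ, hδ, left_lt_top])
    (fun i j => by rw [← right_lt_top, ← f.lt_iff_lt, hγ, hδ, right_lt_top])
  refine ⟨t, ?_⟩
  rintro (i | i | i | i)
  · rw [hα, h1, shift]
  · rw [hβ, h2, shift]
  · rw [hγ, h3, shift]
  · rw [hδ, h4, shift]

end CyclicTwelve

theorem realizesCyclic_twelve : RealizesCyclic 12 20 := by
  have h_add₄ : ∀ s t : ZMod 12, ((s + t).cast : ZMod 4) = s.cast + t.cast := by decide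
  have h_add₆ : ∀ s t : ZMod 12, ((s + t).cast : ZMod 6) = s.cast + t.cast := by decide
  refine ⟨CyclicTwelve, inferInstance, Fintype.ofEquiv _ CyclicTwelve.equivSum, ?_, ?_⟩
  · rw [Fintype.ofEquiv_card]
    rfl
  refine nonempty_aut_mulEquiv_of_action CyclicTwelve.shift ?_ ?_ ?_ ?_
    CyclicTwelve.exists_shift
  · rintro (i | i | i | i) <;> simp [CyclicTwelve.shift]
  · rintro s t (i | i | i | i) <;> simp [CyclicTwelve.shift, h_add₄, h_add₆, add_assoc]
  · rintro t (i | i | i | i) (j | j | j | j) <;>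
      simp only [CyclicTwelve.shift, CyclicTwelve.le_def, CyclicTwelve.Le, add_right_inj,
        CyclicTwelve.sameParity_shift, CyclicTwelve.Adj₄, CyclicTwelve.Adj₆,
        add_sub_add_left_eq_sub, imp_self]
  · intro t ht
    have h1 := ht (.bot 0)
    have h2 := ht (.right 0)
    simp only [CyclicTwelve.shift, add_zero, CyclicTwelve.bot.injEq,
      CyclicTwelve.right.injEq] at h1 h2
    clear ht
    revert t
    decide

theorem realizesCyclic_of_isPrimePow {q : ℕ} (hq : IsPrimePow q) :
    RealizesCyclic q (b q * q) := by
  have h2 := hq.two_le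
  by_cases h : 11 ≤ q
  · have : b q = 2 := by
      unfold b
      split_ifs <;> omega
    rw [this]
    exact realizesCyclic_of_eleven_le h
  · have h6 : ¬ IsPrimePow 6 := by
      rw [isPrimePow_iff_card_primeFactors_eq_one]
      decide +kernel
    have h10 : ¬ IsPrimePow 10 := by
      rw [isPrimePow_iff_card_primeFactors_eq_one]
      decide +kernel
    interval_cases q
    · exact realizesCyclic_two
    · exact realizesCyclic_three_mul h2
    · exact realizesCyclic_three_mul h2
    · exact realizesCyclic_three_mul h2
    · exact absurd hq h6
    · exact realizesCyclic_three_mul h2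
    · exact realizesCyclic_eight
    · exact realizesCyclic_nine
    · exact absurd hq h10
section CyclicGenerator

open Function

variable {P : Type} [PartialOrder P] {g : P ≃o P} {n : ℕ}

/-- The automorphism `g` has order `n` and commutes with all automorphisms. -/
structure IsCyclicGenerator (g : P ≃o P) (n : ℕ) : Prop where
  pos : 0 < n
  comm : ∀ (f : P ≃o P) (x : P), f (g x) = g (f x)
  iterate_eq : ∀ x, g^[n] x = x
  dvd : ∀ k, (∀ x, g^[k] x = x) → n ∣ k

theorem OrderIso.pow_apply_eq_iterate (g : P ≃o P) (k : ℕ) (x : P) : (g ^ k) x = g^[k] x := by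
  induction k generalizing x with
  | zero => rfl
  | succ k ih => rw [pow_succ, RelIso.mul_apply, ih, iterate_succ_apply]

theorem exists_isCyclicGenerator (hn : 0 < n) (e : (P ≃o P) ≃* Multiplicative (ZMod n)) :
    ∃ g : P ≃o P, IsCyclicGenerator g n := by
  have h_pow : ∀ k : ℕ, (e.symm (Multiplicative.ofAdd 1)) ^ k = 1 ↔ n ∣ k := by
    intro k
    rw [← map_pow, map_eq_one_iff e.symm e.symm.injective, ← ofAdd_nsmul, nsmul_one, ofAdd_eq_one,
      ZMod.natCast_eq_zero_iff]
  refine ⟨e.symm (Multiplicative.ofAdd 1), hn, ?_, ?_, ?_⟩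
  · intro f x
    rw [← RelIso.mul_apply, ← RelIso.mul_apply]
    congr 1
    apply e.injective
    rw [map_mul, map_mul, mul_comm]
  · intro x
    rw [← OrderIso.pow_apply_eq_iterate, (h_pow n).2 dvd_rfl]
    rfl
  · intro k hk
    rw [← h_pow]
    ext x
    rw [OrderIso.pow_apply_eq_iterate]
    exact hk x

theorem exists_orderIso_of_monotone_of_injective [Finite P] {φ : P → P} (h_mono : Monotone φ)
    (h_inj : Injective φ) : ∃ f : P ≃o P, ∀ x, f x = φ x := by
  let E : Equiv.Perm P := Equiv.ofBijective φ (Finite.injective_iff_bijective.1 h_inj)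
  obtain ⟨m, hm0, hm⟩ := isOfFinOrder_iff_pow_eq_one.1 (isOfFinOrder_of_finite E)
  have h_iter : ∀ x, φ^[m] x = x := by
    intro x
    have h1 : ∀ k, (E ^ k) x = φ^[k] x := by
      intro k
      induction k with
      | zero => rfl
      | succ k ih => rw [pow_succ', Equiv.Perm.mul_apply, ih, iterate_succ_apply']; rfl
    rw [← h1, hm]
    rfl
  refine ⟨⟨E, fun {x y} => ⟨fun h => ?_, fun h => h_mono h⟩⟩, fun _ => rfl⟩
  obtain ⟨k, rfl⟩ : ∃ k, m = k + 1 := ⟨m - 1, by omega⟩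
  have h1 := h_mono.iterate k h
  change φ^[k] (φ x) ≤ φ^[k] (φ y) at h1
  rwa [← iterate_succ_apply, ← iterate_succ_apply, h_iter, h_iter] at h1

namespace IsCyclicGenerator

/-- Two points are in the same orbit of `g`. -/
def SameOrbit (g : P ≃o P) (x y : P) : Prop := ∃ k : ℕ, g^[k] x = y

theorem iterate_mono (g : P ≃o P) (k : ℕ) : Monotone g^[k] := g.monotone.iterate k

theorem iterate_le_iterate (g : P ≃o P) (k : ℕ) {x y : P} : g^[k] x ≤ g^[k] y ↔ x ≤ y := by
  rw [← OrderIso.pow_apply_eq_iterate, ← OrderIso.pow_apply_eq_iterate, OrderIso.le_iff_le]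

theorem iterate_inj (g : P ≃o P) (k : ℕ) {x y : P} : g^[k] x = g^[k] y ↔ x = y :=
  (g.injective.iterate k).eq_iff

theorem iterate_comm (g : P ≃o P) (i j : ℕ) (x : P) : g^[i] (g^[j] x) = g^[j] (g^[i] x) := by
  rw [← iterate_add_apply, ← iterate_add_apply, add_comm]

theorem iterate_eq_self_iff {k : ℕ} {x : P} : g^[k] x = x ↔ minimalPeriod g x ∣ k :=
  isPeriodicPt_iff_minimalPeriod_dvd

theorem iterate_eq_iterate_iff {i j : ℕ} {x : P} :
    g^[i] x = g^[j] x ↔ i ≡ j [MOD minimalPeriod g x] := by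
  wlog hij : i ≤ j generalizing i j
  · rw [eq_comm, this (le_of_not_ge hij)]
    exact ⟨Nat.ModEq.symm, Nat.ModEq.symm⟩
  obtain ⟨k, rfl⟩ := Nat.exists_eq_add_of_le hij
  rw [iterate_add_apply, iterate_inj, eq_comm, iterate_eq_self_iff, Nat.modEq_iff_dvd' hij,
    Nat.add_sub_cancel_left]

theorem iterate_mul_eq (h : IsCyclicGenerator g n) (k : ℕ) (x : P) : g^[n * k] x = x := by
  rw [iterate_mul]
  exact iterate_fixed (h.iterate_eq x) k

theorem period_dvd (h : IsCyclicGenerator g n) (x : P) : minimalPeriod g x ∣ n :=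
  iterate_eq_self_iff.1 (h.iterate_eq x)

theorem period_pos (h : IsCyclicGenerator g n) (x : P) : 0 < minimalPeriod g x :=
  Nat.pos_of_dvd_of_pos (h.period_dvd x) h.pos

theorem period_iterate (h : IsCyclicGenerator g n) (k : ℕ) (x : P) :
    minimalPeriod g (g^[k] x) = minimalPeriod g x :=
  minimalPeriod_apply_iterate (mk_mem_periodicPts h.pos (h.iterate_eq x)) k

theorem exists_iterate_eq (h : IsCyclicGenerator g n) (k : ℕ) :
    ∃ k', ∀ x, g^[k'] (g^[k] x) = x := by
  refine ⟨(n - 1) * k, fun x => ?_⟩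
  rw [← iterate_add_apply, ← Nat.succ_mul, Nat.succ_eq_add_one, Nat.sub_add_cancel h.pos,
    h.iterate_mul_eq]

theorem equivalence_sameOrbit (h : IsCyclicGenerator g n) : Equivalence (SameOrbit g) where
  refl x := ⟨0, rfl⟩
  symm := by
    rintro x _ ⟨k, rfl⟩
    obtain ⟨k', hk'⟩ := h.exists_iterate_eq k
    exact ⟨k', hk' x⟩
  trans := by
    rintro x _ _ ⟨k, rfl⟩ ⟨l, rfl⟩
    exact ⟨l + k, iterate_add_apply _ _ _ _⟩

theorem period_eq_of_sameOrbit (h : IsCyclicGenerator g n) {x y : P} (hxy : SameOrbit g x y) :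
    minimalPeriod g y = minimalPeriod g x := by
  obtain ⟨k, rfl⟩ := hxy
  exact h.period_iterate k x

theorem eq_of_le_of_sameOrbit (h : IsCyclicGenerator g n) {x y : P}
    (hxy : SameOrbit g x y) (hle : x ≤ y) : x = y := by
  obtain ⟨k, rfl⟩ := hxy
  have h1 := (iterate_mono g k).monotone_iterate_of_le_map hle h.pos
  simp only [← iterate_mul] at h1
  rw [mul_comm k n, h.iterate_mul_eq, Nat.succ_eq_add_one, zero_add, mul_one] at h1
  exact le_antisymm hle h1

theorem iterate_apply_eq (h : IsCyclicGenerator g n) [Finite P] (k : P → ℕ)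
    (h_mono : ∀ x y, x ≤ y → g^[k x] x ≤ g^[k y] y) (h_inj : ∀ x y, g^[k x] x = g^[k y] y → x = y)
    (x : P) : g^[k (g x)] x = g^[k x] x := by
  obtain ⟨f, hf⟩ := exists_orderIso_of_monotone_of_injective
    (φ := fun x => g^[k x] x) (fun x y => h_mono x y) (fun x y => h_inj x y)
  have := h.comm f x
  rw [hf, hf] at this
  apply g.injective
  rw [← this]
  exact (Function.iterate_succ_apply' g _ x).symm.trans (Function.iterate_succ_apply g _ x)

theorem period_eq_two_of_fixed_outside [Finite P] (h : IsCyclicGenerator g n) {t : ℕ} (ht : t ≤ n)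
    {x₀ : P} (hx₀ : g^[t] x₀ ≠ x₀) (h_fix : ∀ y, ¬ SameOrbit g x₀ y → g^[t] y = y) :
    minimalPeriod g x₀ = 2 := by
  classical
  have h_inv : ∀ y, g^[n - t] (g^[t] y) = y := by
    intro y
    rw [← iterate_add_apply, Nat.sub_add_cancel ht, h.iterate_eq]
  have h_fix' : ∀ y, ¬ SameOrbit g x₀ y → g^[n - t] y = y := by
    intro y hy
    have := h_inv y
    rwa [h_fix y hy] at this
  have h_equiv := h.equivalence_sameOrbit
  have h_mem : SameOrbit g x₀ (g^[t] x₀) := ⟨t, rfl⟩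
  let k : P → ℕ := fun y => if y = x₀ then t else if y = g^[t] x₀ then n - t else 0
  have hk₁ : k x₀ = t := if_pos rfl
  have hk₂ : k (g^[t] x₀) = n - t := by
    simp only [k, if_neg hx₀, if_true]
  have hk₃ : ∀ y, y ≠ x₀ → y ≠ g^[t] x₀ → k y = 0 := by
    intro y h₁ h₂
    simp only [k, if_neg h₁, if_neg h₂]
  have hk_fix : ∀ x y, ¬ SameOrbit g x₀ y → g^[k x] y = y := by
    intro x y hy
    by_cases h₁ : x = x₀
    · rw [h₁, hk₁, h_fix y hy]
    by_cases h₂ : x = g^[t] x₀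
    · rw [h₂, hk₂, h_fix' y hy]
    rw [hk₃ x h₁ h₂, iterate_zero_apply]
  have h_swap : ∀ x, (x = x₀ ∧ g^[k x] x = g^[t] x₀) ∨ (x = g^[t] x₀ ∧ g^[k x] x = x₀) ∨
      ((x ≠ x₀ ∧ x ≠ g^[t] x₀) ∧ g^[k x] x = x) := by
    intro x
    by_cases h₁ : x = x₀
    · exact Or.inl ⟨h₁, by rw [h₁, hk₁]⟩
    by_cases h₂ : x = g^[t] x₀
    · exact Or.inr (Or.inl ⟨h₂, by rw [h₂, hk₂, h_inv]⟩)
    exact Or.inr (Or.inr ⟨⟨h₁, h₂⟩, by rw [hk₃ x h₁ h₂, iterate_zero_apply]⟩)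
  have key := h.iterate_apply_eq k (x := x₀) ?_ ?_
  · rw [hk₁] at key
    have h₁ : g x₀ ≠ x₀ := fun h₁ => hx₀ (iterate_fixed h₁ t)
    have h₂ : g x₀ = g^[t] x₀ := by
      by_contra h₂
      rw [hk₃ _ h₁ h₂, iterate_zero_apply] at key
      exact hx₀ key.symm
    rw [h₂, hk₂] at key
    have h₃ : g^[2] x₀ = x₀ := by
      have := h_inv x₀
      rw [iterate_comm, key, ← h₂] at this
      change g^[t] (g^[1] x₀) = x₀ at this
      rwa [iterate_comm, ← h₂] at this
    have h₄ := iterate_eq_self_iff.1 h₃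
    rcases (Nat.dvd_prime Nat.prime_two).1 h₄ with h₅ | h₅
    · exact absurd (minimalPeriod_eq_one_iff_isFixedPt.1 h₅) h₁
    · exact h₅
  · intro x y hxy
    by_cases hx : SameOrbit g x₀ x
    · by_cases hy : SameOrbit g x₀ y
      · rw [h.eq_of_le_of_sameOrbit (h_equiv.trans (h_equiv.symm hx) hy) hxy]
      · have hky : k y = 0 := hk₃ y (fun h₁ => hy (h₁ ▸ h_equiv.refl _)) (fun h₁ => hy (h₁ ▸ h_mem))
        rw [hky, iterate_zero_apply, ← hk_fix x y hy]
        exact iterate_mono g _ hxy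
    · have hkx : k x = 0 := hk₃ x (fun h₁ => hx (h₁ ▸ h_equiv.refl _)) (fun h₁ => hx (h₁ ▸ h_mem))
      rw [hkx, iterate_zero_apply, ← hk_fix y x hx]
      exact iterate_mono g _ hxy
  · intro x y hxy
    rcases h_swap x with ⟨h₁, h₂⟩ | ⟨h₁, h₂⟩ | ⟨h₁, h₂⟩ <;>
    rcases h_swap y with ⟨h₃, h₄⟩ | ⟨h₃, h₄⟩ | ⟨h₃, h₄⟩ <;> rw [h₂, h₄] at hxy <;> grind

theorem sameOrbit_iterate_right_iff (h : IsCyclicGenerator g n) {a x : P} (k : ℕ) :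
    SameOrbit g a (g^[k] x) ↔ SameOrbit g a x :=
  have he := h.equivalence_sameOrbit
  ⟨fun hx => he.trans hx (he.symm ⟨k, rfl⟩), fun hx => he.trans hx ⟨k, rfl⟩⟩

theorem iterate_le_iterate_of_modEq (h : IsCyclicGenerator g n) {a b : P} {i j i' j' : ℕ}
    (h_mod : i' + j ≡ i + j' [MOD (minimalPeriod g a).gcd (minimalPeriod g b)])
    (hle : g^[i] a ≤ g^[j] b) : g^[i'] a ≤ g^[j'] b := by
  obtain ⟨z, hza, hzb⟩ := Nat.chineseRemainder' h_mod
  obtain ⟨c, hc⟩ : ∃ c, c + (i + j) = n * (i + j) :=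
    ⟨n * (i + j) - (i + j), Nat.sub_add_cancel (Nat.le_mul_of_pos_left _ h.pos)⟩
  have h_zero : ∀ x, c + (i + j) ≡ 0 [MOD minimalPeriod g x] := fun x =>
    (Nat.modEq_zero_iff_dvd).2 (hc ▸ (h.period_dvd x).mul_right _)
  have h₁ := iterate_mono g (z + c) hle
  rw [← iterate_add_apply, ← iterate_add_apply] at h₁
  have h₂ : z + c + i ≡ i' [MOD minimalPeriod g a] := calc
    z + c + i ≡ i' + j + c + i [MOD minimalPeriod g a] := (hza.add_right c).add_right i
    _ = i' + (c + (i + j)) := by ring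
    _ ≡ i' + 0 [MOD minimalPeriod g a] := (h_zero a).add_left i'
  have h₃ : z + c + j ≡ j' [MOD minimalPeriod g b] := calc
    z + c + j ≡ i + j' + c + j [MOD minimalPeriod g b] := (hzb.add_right c).add_right j
    _ = j' + (c + (i + j)) := by ring
    _ ≡ j' + 0 [MOD minimalPeriod g b] := (h_zero b).add_left j'
  rwa [iterate_eq_iterate_iff.2 h₂, iterate_eq_iterate_iff.2 h₃] at h₁

/-- The affine map `i ↦ u * i + c` on the residues modulo `q` of the indices of two orbits can be
an automorphism only if `u = 1`. -/
theorem eq_one_of_affine [Finite P] (h : IsCyclicGenerator g n) {q w : ℕ} [NeZero q]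
    (hw : (w : ZMod q) = 1) {a b : P} (hab : ¬ SameOrbit g a b)
    (h_gcd : (minimalPeriod g a).gcd (minimalPeriod g b) = q)
    (h_dir : ∀ i j, ¬ g^[i] b ≤ g^[j] a) {u c₁ c₂ : ZMod q} (hu : IsUnit u)
    (h_rel : ∀ s : ZMod q, a ≤ g^[s.val] b → a ≤ g^[(u * s + c₂ - c₁).val] b)
    (h_out₁ : ∀ y, ¬ SameOrbit g a y → ¬ SameOrbit g b y → ∀ i : ℕ,
      (g^[i] a ≤ y → g^[w * ((u - 1) * i + c₁).val] (g^[i] a) ≤ y) ∧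
      (y ≤ g^[i] a → y ≤ g^[w * ((u - 1) * i + c₁).val] (g^[i] a)))
    (h_out₂ : ∀ y, ¬ SameOrbit g a y → ¬ SameOrbit g b y → ∀ i : ℕ,
      (g^[i] b ≤ y → g^[w * ((u - 1) * i + c₂).val] (g^[i] b) ≤ y) ∧
      (y ≤ g^[i] b → y ≤ g^[w * ((u - 1) * i + c₂).val] (g^[i] b))) : u = 1 := by
  classical
  have he := h.equivalence_sameOrbit
  have hqa : q ∣ minimalPeriod g a := h_gcd ▸ Nat.gcd_dvd_left _ _
  have hqb : q ∣ minimalPeriod g b := h_gcd ▸ Nat.gcd_dvd_right _ _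
  have h_idx : ∀ (c : ZMod q) (i : ℕ),
      ((w * ((u - 1) * i + c).val + i : ℕ) : ZMod q) = u * i + c := by
    intro c i
    rw [Nat.cast_add, Nat.cast_mul, hw, ZMod.natCast_zmod_val]
    ring
  have h_cast : ∀ (x : P), q ∣ minimalPeriod g x → ∀ i j, g^[i] x = g^[j] x →
      (i : ZMod q) = j := by
    intro x hx i j hij
    exact (ZMod.natCast_eq_natCast_iff _ _ _).2 ((iterate_eq_iterate_iff.1 hij).of_dvd hx)
  let k : P → ℕ := fun x =>
    if hx : SameOrbit g a x then w * ((u - 1) * (hx.choose : ℕ) + c₁).val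
    else if hx : SameOrbit g b x then w * ((u - 1) * (hx.choose : ℕ) + c₂).val
    else 0
  have hka : ∀ i, k (g^[i] a) = w * ((u - 1) * i + c₁).val := by
    intro i
    have hx : SameOrbit g a (g^[i] a) := ⟨i, rfl⟩
    simp only [k, dif_pos hx]
    rw [h_cast a hqa _ _ hx.choose_spec]
  have hkb : ∀ i, k (g^[i] b) = w * ((u - 1) * i + c₂).val := by
    intro i
    have hx : SameOrbit g b (g^[i] b) := ⟨i, rfl⟩
    have hx' : ¬ SameOrbit g a (g^[i] b) := by rwa [h.sameOrbit_iterate_right_iff]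
    simp only [k, dif_pos hx, dif_neg hx']
    rw [h_cast b hqb _ _ hx.choose_spec]
  have hk₀ : ∀ x, ¬ SameOrbit g a x → ¬ SameOrbit g b x → k x = 0 := by
    intro x h₁ h₂
    simp only [k, dif_neg h₁, dif_neg h₂]
  have h_inj₁ : ∀ (x : P) (c : ZMod q), q ∣ minimalPeriod g x →
      (∀ i, k (g^[i] x) = w * ((u - 1) * i + c).val) → ∀ i j,
      g^[k (g^[i] x)] (g^[i] x) = g^[k (g^[j] x)] (g^[j] x) → g^[i] x = g^[j] x := by
    intro x c hx hk i j hij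
    rw [hk, hk, ← iterate_add_apply, ← iterate_add_apply] at hij
    have h₁ := h_cast x hx _ _ hij
    rw [h_idx, h_idx, add_left_inj, hu.mul_right_inj] at h₁
    rw [h₁, iterate_add_apply, iterate_add_apply, iterate_inj] at hij
    exact hij
  have key := h.iterate_apply_eq k (x := a) ?_ ?_
  · have h₀ := hka 0
    have h₁ := hka 1
    rw [iterate_zero_apply] at h₀
    rw [iterate_one] at h₁
    rw [h₀, h₁] at key
    have h₂ := h_cast a hqa _ _ key
    rw [Nat.cast_mul, Nat.cast_mul, hw, ZMod.natCast_zmod_val, ZMod.natCast_zmod_val] at h₂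
    simpa [sub_eq_zero] using h₂
  · intro x y hxy
    by_cases hxa : SameOrbit g a x
    · obtain ⟨i, rfl⟩ := hxa
      by_cases hya : SameOrbit g a y
      · rw [h.eq_of_le_of_sameOrbit (he.trans (he.symm ⟨i, rfl⟩) hya) hxy]
      by_cases hyb : SameOrbit g b y
      · obtain ⟨j, rfl⟩ := hyb
        rw [hka, hkb, ← iterate_add_apply, ← iterate_add_apply]
        have h₁ : a ≤ g^[((j : ZMod q) - i).val] b := by
          refine h.iterate_le_iterate_of_modEq (i' := 0) ?_ hxy
          rw [h_gcd, ← ZMod.natCast_eq_natCast_iff]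
          push_cast
          rw [ZMod.natCast_zmod_val]
          ring
        refine h.iterate_le_iterate_of_modEq (i := 0) ?_ (h_rel _ h₁)
        rw [h_gcd, ← ZMod.natCast_eq_natCast_iff, Nat.cast_add, h_idx, zero_add, h_idx,
          ZMod.natCast_zmod_val]
        ring
      · rw [hk₀ y hya hyb, iterate_zero_apply, hka]
        exact (h_out₁ y hya hyb i).1 hxy
    by_cases hya : SameOrbit g a y
    · obtain ⟨j, rfl⟩ := hya
      by_cases hxb : SameOrbit g b x
      · obtain ⟨i, rfl⟩ := hxb
        exact absurd hxy (h_dir i j)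
      · rw [hk₀ x hxa hxb, iterate_zero_apply, hka]
        exact (h_out₁ x hxa hxb j).2 hxy
    by_cases hxb : SameOrbit g b x
    · obtain ⟨i, rfl⟩ := hxb
      by_cases hyb : SameOrbit g b y
      · rw [h.eq_of_le_of_sameOrbit (he.trans (he.symm ⟨i, rfl⟩) hyb) hxy]
      · rw [hk₀ y hya hyb, iterate_zero_apply, hkb]
        exact (h_out₂ y hya hyb i).1 hxy
    by_cases hyb : SameOrbit g b y
    · obtain ⟨j, rfl⟩ := hyb
      rw [hk₀ x hxa hxb, iterate_zero_apply, hkb]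
      exact (h_out₂ x hxa hxb j).2 hxy
    · rw [hk₀ x hxa hxb, hk₀ y hya hyb]
      exact hxy
  · intro x y hxy
    have hxy' := hxy
    have h_a : SameOrbit g a x ↔ SameOrbit g a y := by
      rw [← h.sameOrbit_iterate_right_iff (k x), hxy, h.sameOrbit_iterate_right_iff]
    have h_b : SameOrbit g b x ↔ SameOrbit g b y := by
      rw [← h.sameOrbit_iterate_right_iff (k x), hxy, h.sameOrbit_iterate_right_iff]
    by_cases hxa : SameOrbit g a x
    · obtain ⟨j, rfl⟩ := h_a.1 hxa
      obtain ⟨i, rfl⟩ := hxa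
      exact h_inj₁ a c₁ hqa hka i j hxy
    by_cases hxb : SameOrbit g b x
    · obtain ⟨j, rfl⟩ := h_b.1 hxb
      obtain ⟨i, rfl⟩ := hxb
      exact h_inj₁ b c₂ hqb hkb i j hxy
    rwa [hk₀ x hxa hxb, hk₀ y (h_a.not.1 hxa) (h_b.not.1 hxb)] at hxy

theorem forall_not_le_or_forall_not_le (h : IsCyclicGenerator g n) {a b : P}
    (hab : ¬ SameOrbit g a b) :
    (∀ i j, ¬ g^[i] b ≤ g^[j] a) ∨ ∀ i j, ¬ g^[i] a ≤ g^[j] b := by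
  by_contra! H
  obtain ⟨⟨i, j, h₁⟩, ⟨i', j', h₂⟩⟩ := H
  obtain ⟨k, hk⟩ := h.exists_iterate_eq i'
  have h₃ := iterate_mono g (j + k) h₂
  rw [iterate_add_apply, hk] at h₃
  have he := h.equivalence_sameOrbit
  have h₄ : SameOrbit g (g^[i] b) (g^[j + k] (g^[j'] b)) :=
    he.trans (he.symm ⟨i, rfl⟩) (he.trans ⟨j', rfl⟩ ⟨j + k, rfl⟩)
  have h₅ := h.eq_of_le_of_sameOrbit h₄ (h₁.trans h₃)
  have h₆ : g^[i] b = g^[j] a := le_antisymm h₁ (by rw [h₅]; exact h₃)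
  exact hab (he.trans ⟨j, h₆.symm⟩ (he.symm ⟨i, rfl⟩))

theorem gcd_period_ne_of_forall_exists_affine [Finite P] (h : IsCyclicGenerator g n) {q m : ℕ}
    (hq : q.Prime) (hn : n = q * m) (hqm : q.Coprime m)
    (h_aff : ∀ S : Finset (ZMod q), ∃ u c, IsUnit u ∧ u ≠ 1 ∧ ∀ s ∈ S, u * s + c ∈ S) {a b : P}
    (hab : ¬ SameOrbit g a b)
    (h_two : ∀ y, q ∣ minimalPeriod g y → SameOrbit g a y ∨ SameOrbit g b y) :
    (minimalPeriod g a).gcd (minimalPeriod g b) ≠ q := by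
  classical
  intro h_gcd
  wlog h_dir : ∀ i j, ¬ g^[i] b ≤ g^[j] a generalizing a b
  · exact this (fun H => hab (h.equivalence_sameOrbit.symm H)) (fun y hy => (h_two y hy).symm)
      (Nat.gcd_comm _ _ ▸ h_gcd) ((h.forall_not_le_or_forall_not_le hab).resolve_left h_dir)
  have : Fact q.Prime := ⟨hq⟩
  obtain ⟨w, hw₁, hw₂⟩ := Nat.chineseRemainder hqm 1 0
  have h_fix : ∀ y, ¬ SameOrbit g a y → ¬ SameOrbit g b y → ∀ s, g^[w * s] y = y := by
    intro y hya hyb s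
    have hqy : ¬ q ∣ minimalPeriod g y := fun H => (h_two y H).elim hya hyb
    have h₁ : minimalPeriod g y ∣ m :=
      ((hq.coprime_iff_not_dvd.2 hqy).symm).dvd_of_dvd_mul_left (hn ▸ h.period_dvd y)
    exact iterate_eq_self_iff.2 ((h₁.trans ((Nat.modEq_zero_iff_dvd).1 hw₂)).mul_right s)
  have h_out : ∀ x y, ¬ SameOrbit g a y → ¬ SameOrbit g b y → ∀ s,
      (x ≤ y → g^[w * s] x ≤ y) ∧ (y ≤ x → y ≤ g^[w * s] x) := by
    intro x y hya hyb s
    have h₁ := h_fix y hya hyb s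
    constructor <;> intro h₂ <;> have h₃ := iterate_mono g (w * s) h₂ <;> rwa [h₁] at h₃
  obtain ⟨u, c, hu, hu₁, hc⟩ := h_aff {s | a ≤ g^[s.val] b}
  have hw₀ : (w : ZMod q) = 1 := by
    have := (ZMod.natCast_eq_natCast_iff _ _ _).2 hw₁
    rwa [Nat.cast_one] at this
  refine hu₁ (h.eq_one_of_affine hw₀ hab h_gcd h_dir (c₁ := 0) (c₂ := c) hu ?_
    (fun y hya hyb i => h_out _ y hya hyb _) (fun y hya hyb i => h_out _ y hya hyb _))
  intro s hs
  have := hc s (by simpa using hs)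
  rw [sub_zero]
  simpa using this

theorem exists_affine_zmod_three (S : Finset (ZMod 3)) :
    ∃ u c : ZMod 3, IsUnit u ∧ u ≠ 1 ∧ ∀ s ∈ S, u * s + c ∈ S := by
  have key : ∀ S : Finset (ZMod 3), ∃ c, ∀ s ∈ S, -1 * s + c ∈ S := by decide
  obtain ⟨c, hc⟩ := key S
  exact ⟨-1, c, isUnit_one.neg, by decide, hc⟩

theorem exists_affine_zmod_five (S : Finset (ZMod 5)) :
    ∃ u c : ZMod 5, IsUnit u ∧ u ≠ 1 ∧ ∀ s ∈ S, u * s + c ∈ S := by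
  have key : ∀ S : Finset (ZMod 5), ∃ c, ∀ s ∈ S, -1 * s + c ∈ S := by decide
  obtain ⟨c, hc⟩ := key S
  exact ⟨-1, c, isUnit_one.neg, by decide, hc⟩

set_option maxRecDepth 10000 in
theorem exists_affine_zmod_seven (S : Finset (ZMod 7)) :
    ∃ u c : ZMod 7, IsUnit u ∧ u ≠ 1 ∧ ∀ s ∈ S, u * s + c ∈ S := by
  have key : ∀ S : Finset (ZMod 7), ∃ c u, (u = -1 ∨ u = 2) ∧ ∀ s ∈ S, u * s + c ∈ S := by decide
  obtain ⟨c, u, rfl | rfl, hc⟩ := key S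
  · exact ⟨-1, c, isUnit_one.neg, by decide, hc⟩
  · exact ⟨2, c, IsUnit.of_mul_eq_one 4 (by decide), by decide, hc⟩

theorem zmod_four_reflection_or_eq_pair (S : Finset (ZMod 4)) :
    (∃ c : ZMod 4, (c = 0 ∨ c = 2) ∧ ∀ s ∈ S, -1 * s + c ∈ S) ∨ ∃ s : ZMod 4, S = {s, s + 1} := by
  decide +revert

/-- The point `y` distinguishes some point of the orbit of `x` from its image under `g`. -/
def Linked (g : P ≃o P) (x y : P) : Prop :=
  ∃ i : ℕ, (g^[i] x ≤ y ∧ ¬ g^[i + 1] x ≤ y) ∨ (y ≤ g^[i] x ∧ ¬ y ≤ g^[i + 1] x)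

theorem Linked.iterate {x y : P} (hxy : Linked g x y) (k : ℕ) : Linked g x (g^[k] y) := by
  obtain ⟨i, hi⟩ := hxy
  refine ⟨k + i, ?_⟩
  rwa [add_assoc, iterate_add_apply, iterate_add_apply _ k (i + 1), iterate_le_iterate,
    iterate_le_iterate, iterate_le_iterate, iterate_le_iterate]

theorem le_iterate_of_not_linked {x y : P} (hxy : ¬ Linked g x y) (i s : ℕ) :
    (g^[i] x ≤ y → g^[i + s] x ≤ y) ∧ (y ≤ g^[i] x → y ≤ g^[i + s] x) := by
  simp only [Linked, not_exists, not_or, not_and, not_not] at hxy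
  induction s with
  | zero => exact ⟨id, id⟩
  | succ s ih => exact ⟨fun h₁ => (hxy _).1 (ih.1 h₁), fun h₁ => (hxy _).2 (ih.2 h₁)⟩

theorem le_iterate_of_iterate_eq {x y : P} {k : ℕ} (hy : g^[k] y = y) (i : ℕ) :
    (g^[i] x ≤ y ↔ g^[k + i] x ≤ y) ∧ (y ≤ g^[i] x ↔ y ≤ g^[k + i] x) := by
  rw [iterate_add_apply]
  constructor
  · conv_rhs => rw [← hy]
    exact (iterate_le_iterate g k).symm
  · conv_rhs => rw [← hy]
    exact (iterate_le_iterate g k).symm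

theorem not_linked_of_pair {a b y : P} (h_dir : ∀ i j, ¬ g^[i] b ≤ g^[j] a) {s₀ : ZMod 4}
    (h_rel : ∀ i j : ℕ, g^[i] a ≤ g^[j] b ↔ (j - i : ZMod 4) = s₀ ∨ (j - i : ZMod 4) = s₀ + 1)
    (hya : ∀ i, (g^[i] a ≤ y ↔ g^[i + 2] a ≤ y) ∧ (y ≤ g^[i] a ↔ y ≤ g^[i + 2] a))
    (hyb : ∀ i, (g^[i] b ≤ y ↔ g^[i + 2] b ≤ y) ∧ (y ≤ g^[i] b ↔ y ≤ g^[i + 2] b))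
    (h_a : Linked g a y) : ¬ Linked g b y := by
  rintro ⟨j, hj⟩
  obtain ⟨i, hi⟩ := h_a
  have key : ∀ s t s₀ : ZMod 4, (s - (t + 1) = s₀ ∨ s - (t + 1) = s₀ + 1) ∨
      (s + 2 - (t + 1) = s₀ ∨ s + 2 - (t + 1) = s₀ + 1) := by decide
  have key' : ∀ s t s₀ : ZMod 4, (s + 1 - t = s₀ ∨ s + 1 - t = s₀ + 1) ∨
      (s + 1 - (t + 2) = s₀ ∨ s + 1 - (t + 2) = s₀ + 1) := by decide
  rcases hi with ⟨h₁, h₂⟩ | ⟨h₁, h₂⟩ <;> rcases hj with ⟨h₃, h₄⟩ | ⟨h₃, h₄⟩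
  · rcases key j i s₀ with h₅ | h₅
    · exact h₂ (((h_rel (i + 1) j).2 (by push_cast; exact h₅)).trans h₃)
    · exact h₂ (((h_rel (i + 1) (j + 2)).2 (by push_cast; exact h₅)).trans ((hyb j).1.1 h₃))
  · have h₅ := (h_rel i j).1 (h₁.trans h₃)
    have h₆ := (h_rel i (j + 2)).1 (h₁.trans ((hyb j).2.1 h₃))
    push_cast at h₆
    have : ∀ s t s₀ : ZMod 4, (s - t = s₀ ∨ s - t = s₀ + 1) →
      ¬ (s + 2 - t = s₀ ∨ s + 2 - t = s₀ + 1) := by decide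
    exact this _ _ _ h₅ h₆
  · exact h_dir j i (h₃.trans h₁)
  · rcases key' j i s₀ with h₅ | h₅
    · exact h₄ (h₁.trans ((h_rel i (j + 1)).2 (by push_cast; exact h₅)))
    · exact h₄ (((hya i).2.1 h₁).trans ((h_rel (i + 2) (j + 1)).2 (by push_cast; exact h₅)))

theorem dvd_or_dvd_of_dvd_primePow_mul {p r m d : ℕ} (hp : p.Prime) (hd : d ∣ p ^ (r + 1) * m) :
    p ^ (r + 1) ∣ d ∨ d ∣ p ^ r * m := by
  obtain ⟨d₁, d₂, h₁, h₂, rfl⟩ := (Nat.dvd_mul).1 hd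
  obtain ⟨j, hj, rfl⟩ := (Nat.dvd_prime_pow hp).1 h₁
  rcases Nat.lt_or_ge j (r + 1) with h₃ | h₃
  · exact Or.inr (Nat.mul_dvd_mul (pow_dvd_pow p (by omega)) h₂)
  · exact Or.inl ((pow_dvd_pow p h₃).mul_right d₂)

theorem exists_even_periods [Finite P] (h : IsCyclicGenerator g n) {m : ℕ} (hn : n = 4 * m)
    (hm : Odd m) {a b : P} (hab : ¬ SameOrbit g a b) (ha : minimalPeriod g a = 4)
    (hb : minimalPeriod g b = 4)
    (h_two : ∀ y, 4 ∣ minimalPeriod g y → SameOrbit g a y ∨ SameOrbit g b y) :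
    ∃ x y, ¬ SameOrbit g x y ∧ (2 ∣ minimalPeriod g x ∧ ¬ 4 ∣ minimalPeriod g x) ∧
      2 ∣ minimalPeriod g y ∧ ¬ 4 ∣ minimalPeriod g y := by
  classical
  wlog h_dir : ∀ i j, ¬ g^[i] b ≤ g^[j] a generalizing a b
  · exact this (fun H => hab (h.equivalence_sameOrbit.symm H)) hb ha (fun y hy => (h_two y hy).symm)
      ((h.forall_not_le_or_forall_not_le hab).resolve_left h_dir)
  have h_gcd : (minimalPeriod g a).gcd (minimalPeriod g b) = 4 := by rw [ha, hb]; rfl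
  have h4m : Nat.Coprime 4 m := by
    have : Nat.Coprime (2 ^ 2) m := Nat.Coprime.pow_left 2 (Nat.coprime_two_left.2 hm)
    exact this
  obtain ⟨w, hw₁, hw₂⟩ := Nat.chineseRemainder h4m 1 0
  have hmw : m ∣ w := (Nat.modEq_zero_iff_dvd).1 hw₂
  have hw₀ : (w : ZMod 4) = 1 := by
    have := (ZMod.natCast_eq_natCast_iff _ _ _).2 hw₁
    rwa [Nat.cast_one] at this
  have h_four : ∀ {z : P}, minimalPeriod g z = 4 → ∀ {i j : ℕ}, (i : ZMod 4) = j →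
      g^[i] z = g^[j] z := by
    intro z hz i j hij
    rw [iterate_eq_iterate_iff, hz]
    exact (ZMod.natCast_eq_natCast_iff _ _ _).1 hij
  have h_out_dvd : ∀ y, ¬ SameOrbit g a y → ¬ SameOrbit g b y →
      ¬ 4 ∣ minimalPeriod g y ∧ g^[w * 2] y = y := by
    intro y hya hyb
    have h4y : ¬ 4 ∣ minimalPeriod g y := fun H => (h_two y H).elim hya hyb
    refine ⟨h4y, ?_⟩
    have h₁ : minimalPeriod g y ∣ 2 ^ (1 + 1) * m := hn ▸ h.period_dvd y
    have h₂ := (dvd_or_dvd_of_dvd_primePow_mul Nat.prime_two h₁).resolve_left h4y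
    rw [iterate_eq_self_iff]
    exact h₂.trans (by rw [pow_one, mul_comm]; exact Nat.mul_dvd_mul_right hmw 2)
  have h_two_shift : ∀ z y, minimalPeriod g z = 4 → ¬ SameOrbit g a y → ¬ SameOrbit g b y → ∀ i,
      (g^[i] z ≤ y ↔ g^[i + 2] z ≤ y) ∧ (y ≤ g^[i] z ↔ y ≤ g^[i + 2] z) := by
    intro z y hz hya hyb i
    have h₁ := le_iterate_of_iterate_eq (x := z) (h_out_dvd y hya hyb).2 i
    rwa [h_four hz (show ((w * 2 + i : ℕ) : ZMod 4) = (i + 2 : ℕ) by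
      push_cast; rw [hw₀]; ring)] at h₁
  have h_even : ∀ z y, minimalPeriod g z = 4 → ¬ SameOrbit g a y → ¬ SameOrbit g b y →
      Linked g z y → 2 ∣ minimalPeriod g y := by
    rintro z y hz hya hyb ⟨i, hi⟩
    by_contra h_odd
    have h₁ : minimalPeriod g y ∣ 2 ^ 1 * m := (dvd_or_dvd_of_dvd_primePow_mul Nat.prime_two
      (hn ▸ h.period_dvd y)).resolve_left (h_out_dvd y hya hyb).1
    have h₂ : minimalPeriod g y ∣ 2 ^ 0 * m :=
      (dvd_or_dvd_of_dvd_primePow_mul Nat.prime_two h₁).resolve_left h_odd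
    rw [pow_zero, one_mul] at h₂
    have h₃ := le_iterate_of_iterate_eq (x := z) (iterate_eq_self_iff.2 (h₂.trans hmw)) i
    rw [h_four hz (show ((w + i : ℕ) : ZMod 4) = (i + 1 : ℕ) by push_cast; rw [hw₀]; ring)] at h₃
    tauto
  have h_shift : ∀ z y (e : ZMod 4), minimalPeriod g z = 4 → ¬ SameOrbit g a y →
      ¬ SameOrbit g b y → (¬ Linked g z y ∨ e = 0 ∨ e = 2) → ∀ i : ℕ,
      (g^[i] z ≤ y → g^[w * e.val] (g^[i] z) ≤ y) ∧
      (y ≤ g^[i] z → y ≤ g^[w * e.val] (g^[i] z)) := by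
    intro z y e hz hya hyb h_or i
    have h₁ : g^[w * e.val] (g^[i] z) = g^[i + e.val] z := by
      rw [← iterate_add_apply]
      exact h_four hz (by push_cast; rw [hw₀]; ring)
    rw [h₁]
    rcases h_or with h₂ | rfl | rfl
    · exact le_iterate_of_not_linked h₂ i _
    · exact ⟨id, id⟩
    · exact ⟨(h_two_shift z y hz hya hyb i).1.1, (h_two_shift z y hz hya hyb i).2.1⟩
  have h_ne : (-1 : ZMod 4) ≠ 1 := by decide
  have h_double : ∀ t : ZMod 4, (-1 - 1) * t + 0 = 0 ∨ (-1 - 1) * t + 0 = 2 := by decide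
  have h_double' : ∀ t : ZMod 4, (-1 - 1) * t + 2 = 0 ∨ (-1 - 1) * t + 2 = 2 := by decide
  have h_apply := fun c₁ c₂ h_rel h₁ h₂ => h_ne (h.eq_one_of_affine hw₀ hab h_gcd h_dir
    (u := -1) (c₁ := c₁) (c₂ := c₂) isUnit_one.neg h_rel h₁ h₂)
  rcases zmod_four_reflection_or_eq_pair {s | a ≤ g^[s.val] b} with ⟨c, hc, hS⟩ | ⟨s₀, hS⟩
  · refine (h_apply 0 c ?_ ?_ ?_).elim
    · intro s hs
      simpa using hS s (by simpa using hs)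
    · intro y hya hyb i
      exact h_shift a y _ ha hya hyb (Or.inr (h_double i)) i
    · intro y hya hyb i
      refine h_shift b y _ hb hya hyb (Or.inr ?_) i
      rcases hc with rfl | rfl
      · exact h_double i
      · exact h_double' i
  have h_rel₀ : ∀ s : ZMod 4, a ≤ g^[s.val] b ↔ s = s₀ ∨ s = s₀ + 1 := by
    intro s
    have := congrArg (s ∈ ·) hS
    simpa using this
  have h_refl : ∀ c₁ c₂ : ZMod 4, c₂ - c₁ = 2 * s₀ + 1 → ∀ s : ZMod 4, a ≤ g^[s.val] b →
      a ≤ g^[(-1 * s + c₂ - c₁).val] b := by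
    intro c₁ c₂ hc s hs
    rw [h_rel₀] at hs ⊢
    rw [add_sub_assoc, hc]
    rcases hs with rfl | rfl
    · right; ring
    · left; ring
  obtain ⟨x, hxa, hxb, hx⟩ : ∃ x, ¬ SameOrbit g a x ∧ ¬ SameOrbit g b x ∧ Linked g a x := by
    by_contra! H
    refine h_apply (-(2 * s₀ + 1)) 0 (h_refl _ _ (by ring)) ?_ ?_
    · intro y hya hyb i
      exact h_shift a y _ ha hya hyb (Or.inl (H y hya hyb)) i
    · intro y hya hyb i
      exact h_shift b y _ hb hya hyb (Or.inr (h_double i)) i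
  obtain ⟨y, hya, hyb, hy⟩ : ∃ y, ¬ SameOrbit g a y ∧ ¬ SameOrbit g b y ∧ Linked g b y := by
    by_contra! H
    refine h_apply 0 (2 * s₀ + 1) (h_refl _ _ (by ring)) ?_ ?_
    · intro y hya hyb i
      exact h_shift a y _ ha hya hyb (Or.inr (h_double i)) i
    · intro y hya hyb i
      exact h_shift b y _ hb hya hyb (Or.inl (H y hya hyb)) i
  refine ⟨x, y, ?_, ⟨h_even a x ha hxa hxb hx, (h_out_dvd x hxa hxb).1⟩,
    h_even b y hb hya hyb hy, (h_out_dvd y hya hyb).1⟩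
  rintro ⟨k, rfl⟩
  refine not_linked_of_pair h_dir (s₀ := s₀) ?_ (h_two_shift a _ ha hya hyb)
    (h_two_shift b _ hb hya hyb) (hx.iterate k) hy
  intro i j
  rw [← h_rel₀]
  constructor <;> intro h₁
  · refine h.iterate_le_iterate_of_modEq (i' := 0) ?_ h₁
    rw [h_gcd, ← ZMod.natCast_eq_natCast_iff]
    push_cast
    rw [ZMod.natCast_zmod_val]
    ring
  · refine h.iterate_le_iterate_of_modEq (i := 0) ?_ h₁
    rw [h_gcd, ← ZMod.natCast_eq_natCast_iff]
    push_cast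
    rw [ZMod.natCast_zmod_val]
    ring

theorem exists_primePow_dvd_period (h : IsCyclicGenerator g n) {p r m : ℕ} (hp : p.Prime)
    (hn : n = p ^ (r + 1) * m) : ∃ x, p ^ (r + 1) ∣ minimalPeriod g x := by
  by_contra! H
  have h₁ : n ∣ p ^ r * m := h.dvd _ fun x => iterate_eq_self_iff.2
    ((dvd_or_dvd_of_dvd_primePow_mul hp (hn ▸ h.period_dvd x)).resolve_left (H x))
  have h₂ : n = p * (p ^ r * m) := by rw [hn]; ring
  have h₃ : 0 < p ^ r * m := Nat.pos_of_ne_zero fun H => h.pos.ne' (by rw [h₂, H, mul_zero])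
  have h₄ := Nat.le_of_dvd h₃ h₁
  have h₅ := hp.two_le
  nlinarith

theorem period_eq_two_of_unique_orbit [Finite P] (h : IsCyclicGenerator g n) {p r m : ℕ}
    (hp : p.Prime) (hn : n = p ^ (r + 1) * m) (hm : ¬ p ∣ m) {x : P}
    (hx : p ^ (r + 1) ∣ minimalPeriod g x)
    (h_unique : ∀ y, p ^ (r + 1) ∣ minimalPeriod g y → SameOrbit g x y) :
    minimalPeriod g x = 2 := by
  have h₂ : n = p * (p ^ r * m) := by rw [hn]; ring
  refine h.period_eq_two_of_fixed_outside (t := p ^ r * m) ?_ ?_ ?_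
  · rw [h₂]
    exact Nat.le_mul_of_pos_left _ hp.pos
  · rw [Ne, iterate_eq_self_iff]
    intro H
    have h₃ := hx.trans H
    rw [pow_succ] at h₃
    exact hm (Nat.dvd_of_mul_dvd_mul_left (pow_pos hp.pos r) h₃)
  · intro y hy
    exact iterate_eq_self_iff.2 ((dvd_or_dvd_of_dvd_primePow_mul hp
      (hn ▸ h.period_dvd y)).resolve_left fun H => hy (h_unique y H))

end IsCyclicGenerator

end CyclicGenerator

section Counting

variable {Ω ι : Type*} {s : Ω → ℕ} {q : ι → ℕ}

theorem weight_sum_bound {q W : ι → ℕ} (F : Finset ι) (hq : ∀ i ∈ F, 2 ≤ q i)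
    (hW : ∀ i ∈ F, W i ≤ 3 * q i ∧ (q i = 2 → W i ≤ 2)) (hF : F.Nonempty) :
    2 ≤ ∏ i ∈ F, q i ∧ ∑ i ∈ F, W i ≤ 3 * ∏ i ∈ F, q i ∧
      (∏ i ∈ F, q i = 2 → ∑ i ∈ F, W i ≤ 2) ∧
      (1 < F.card → ∑ i ∈ F, W i ≤ 2 * ∏ i ∈ F, q i) := by
  classical
  induction hF using Finset.Nonempty.cons_induction with
  | singleton i => simpa using ⟨hq i (by simp), hW i (by simp)⟩
  | cons i F hi hF ih =>
    obtain ⟨h₁, h₂, h₃, -⟩ := ih (fun j hj => hq j (by simp [hj])) (fun j hj => hW j (by simp [hj]))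
    obtain ⟨h₄, h₅⟩ := hW i (by simp)
    have h₆ := hq i (by simp)
    rw [Finset.prod_cons, Finset.sum_cons]
    generalize ∏ i ∈ F, q i = Q at *
    generalize ∑ i ∈ F, W i = V at *
    generalize W i = v at *
    generalize q i = a at *
    have key : v + V ≤ 2 * (a * Q) := by
      rcases h₆.eq_or_lt with rfl | h₇
      · have := h₅ rfl
        omega
      rcases h₁.eq_or_lt with rfl | h₈
      · have := h₃ rfl
        omega
      nlinarith
    refine ⟨by nlinarith, by omega, fun h => ?_, fun _ => key⟩
    nlinarith

variable [Fintype ι]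

/-- The numerical constraints satisfied by the sizes `s` of the orbits of a generator of a cyclic
automorphism group whose order is the product of the pairwise coprime prime powers `q`. -/
structure OrbitProfile (s : Ω → ℕ) (q : ι → ℕ) : Prop where
  size_pos : ∀ ω, 0 < s ω
  size_dvd : ∀ ω, s ω ∣ ∏ i, q i
  two_le : ∀ i, 2 ≤ q i
  coprime : ∀ i j, i ≠ j → (q i).Coprime (q j)
  exists_dvd : ∀ i, ∃ ω, q i ∣ s ω
  unique : ∀ i ω, q i ∣ s ω → (∀ ω', q i ∣ s ω' → ω' = ω) → s ω = 2
  pair : ∀ i, (q i = 3 ∨ q i = 5 ∨ q i = 7) → ∀ ω ω', ω ≠ ω' → q i ∣ s ω' →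
    (∀ ω'', q i ∣ s ω'' → ω'' = ω ∨ ω'' = ω') → s ω ≠ q i
  pair_four : ∀ i, q i = 4 → ∀ ω ω', ω ≠ ω' → s ω = 4 → s ω' = 4 →
    (∀ ω'', 4 ∣ s ω'' → ω'' = ω ∨ ω'' = ω') →
    ∃ x y, x ≠ y ∧ (2 ∣ s x ∧ ¬ 4 ∣ s x) ∧ 2 ∣ s y ∧ ¬ 4 ∣ s y

namespace OrbitProfile

theorem prod_dvd (h : OrbitProfile s q) {F : Finset ι} {c : ℕ} (hF : ∀ i ∈ F, q i ∣ c) :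
    ∏ i ∈ F, q i ∣ c :=
  Finset.prod_dvd_of_isRelPrime
    (fun i _ j _ hij => Nat.coprime_iff_isRelPrime.1 (h.coprime i j hij)) hF

theorem eq_of_two_dvd (h : OrbitProfile s q) {i j : ι} (hi : 2 ∣ q i) (hj : 2 ∣ q j) : i = j := by
  by_contra hij
  have := Nat.dvd_gcd hi hj
  rw [h.coprime i j hij] at this
  omega

theorem odd_of_ne (h : OrbitProfile s q) {i j : ι} (hi : q i = 4) (hij : j ≠ i) : Odd (q j) := by
  rw [← Nat.not_even_iff_odd, even_iff_two_dvd]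
  exact fun hj => hij (h.eq_of_two_dvd hj (by rw [hi]; norm_num))

end OrbitProfile

variable [Fintype Ω]

/-- The orbits whose size is divisible by `d`. -/
def divisibleOrbits (s : Ω → ℕ) (d : ℕ) : Finset Ω := {ω | d ∣ s ω}

/-- Twice the contribution to the point count charged to each orbit of size divisible by `d`. -/
def orbitWeight (s : Ω → ℕ) (d : ℕ) : ℕ :=
  if d = 2 then (if (divisibleOrbits s d).card = 1 then 4 else 2)
  else if (d = 3 ∨ d = 4 ∨ d = 5 ∨ d = 7) ∧ (divisibleOrbits s d).card = 2 then 3 * d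
  else 2 * d

/-- The total weight charged to an orbit of size `d`. -/
def orbitCharge (s : Ω → ℕ) (q : ι → ℕ) (d : ℕ) : ℕ := ∑ i with q i ∣ d, orbitWeight s (q i)

theorem orbitWeight_le (d : ℕ) (hd : 2 ≤ d) : orbitWeight s d ≤ 3 * d := by
  unfold orbitWeight
  split_ifs <;> omega

namespace OrbitProfile

theorem card_divisibleOrbits (h : OrbitProfile s q) (i : ι) :
    2 ≤ (divisibleOrbits s (q i)).card ∨ q i = 2 ∧ (divisibleOrbits s (q i)).card = 1 := by
  obtain ⟨ω, hω⟩ := h.exists_dvd i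
  have h_mem : ω ∈ divisibleOrbits s (q i) := by simp [divisibleOrbits, hω]
  have h_pos := Finset.card_pos.2 ⟨ω, h_mem⟩
  by_cases h₁ : (divisibleOrbits s (q i)).card = 1
  · refine Or.inr ⟨?_, h₁⟩
    obtain ⟨ω', hω'⟩ := Finset.card_eq_one.1 h₁
    have h₂ := h.unique i ω hω fun ω'' hω'' => by
      have h₃ : ω'' ∈ divisibleOrbits s (q i) := by simp [divisibleOrbits, hω'']
      rw [hω', Finset.mem_singleton] at h₃ h_mem
      rw [h₃, h_mem]
    have h₃ := Nat.le_of_dvd two_pos (h₂ ▸ hω)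
    have := h.two_le i
    omega
  · omega

theorem two_mul_b_le (h : OrbitProfile s q) (i : ι) :
    2 * (b (q i) * q i) ≤ (divisibleOrbits s (q i)).card * orbitWeight s (q i) := by
  have h₁ := h.card_divisibleOrbits i
  have h₂ := h.two_le i
  unfold b orbitWeight
  generalize (divisibleOrbits s (q i)).card = N at *
  generalize q i = a at *
  split_ifs
  all_goals first
    | omega
    | exact absurd h₂ (by omega)
    | have hN : 3 ≤ N := by omega
      nlinarith
    | have hN : 2 ≤ N := by omega
      nlinarith

theorem two_mul_sum_le (h : OrbitProfile s q) :
    2 * ∑ i, b (q i) * q i ≤ ∑ ω, orbitCharge s q (s ω) := by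
  unfold orbitCharge
  simp_rw [Finset.sum_filter]
  rw [Finset.sum_comm, Finset.mul_sum]
  refine Finset.sum_le_sum fun i _ => (h.two_mul_b_le i).trans ?_
  rw [← Finset.sum_filter, Finset.sum_const, smul_eq_mul, divisibleOrbits]

theorem sum_orbitWeight_le (h : OrbitProfile s q) {F : Finset ι} {c : ℕ} (hc : 0 < c)
    (hF : ∀ i ∈ F, q i ∣ c) (hW : ∀ i ∈ F, q i = 2 → orbitWeight s (q i) ≤ 2) :
    ∑ i ∈ F, orbitWeight s (q i) ≤ 3 * c ∧
      (1 < F.card → ∑ i ∈ F, orbitWeight s (q i) ≤ 2 * c) := by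
  rcases F.eq_empty_or_nonempty with rfl | h_ne
  · simp
  have h₁ := Nat.le_of_dvd hc (h.prod_dvd hF)
  obtain ⟨-, h₂, -, h₃⟩ := weight_sum_bound F (fun i _ => h.two_le i)
    (fun i hi => ⟨orbitWeight_le (s := s) _ (h.two_le i), hW i hi⟩) h_ne
  exact ⟨by omega, fun h₄ => by have := h₃ h₄; omega⟩

theorem eq_two_of_card_eq_one (h : OrbitProfile s q) {i : ι} {ω : Ω} (hω : q i ∣ s ω)
    (h_card : (divisibleOrbits s (q i)).card = 1) : s ω = 2 := by
  refine h.unique i ω hω fun ω' hω' => ?_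
  exact Finset.card_le_one.1 h_card.le ω' (by simpa [divisibleOrbits] using hω') ω
    (by simpa [divisibleOrbits] using hω)

theorem ne_of_card_eq_two (h : OrbitProfile s q) {i : ι} {ω : Ω}
    (h_or : q i = 3 ∨ q i = 5 ∨ q i = 7) (hω : q i ∣ s ω)
    (h_card : (divisibleOrbits s (q i)).card = 2) : s ω ≠ q i := by
  classical
  have h_mem : ω ∈ divisibleOrbits s (q i) := by simpa [divisibleOrbits] using hω
  obtain ⟨ω', hω'⟩ := Finset.card_eq_one.1
    (show ((divisibleOrbits s (q i)).erase ω).card = 1 by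
      rw [Finset.card_erase_of_mem h_mem, h_card])
  have h_mem' : ω' ∈ (divisibleOrbits s (q i)).erase ω := by rw [hω']; simp
  rw [Finset.mem_erase] at h_mem'
  refine h.pair i h_or ω ω' (Ne.symm h_mem'.1) (by simpa [divisibleOrbits] using h_mem'.2)
    fun ω'' hω'' => ?_
  by_cases h₁ : ω'' = ω
  · exact Or.inl h₁
  · have : ω'' ∈ (divisibleOrbits s (q i)).erase ω := by simpa [divisibleOrbits, h₁] using hω''
    rw [hω', Finset.mem_singleton] at this
    exact Or.inr this

theorem orbitCharge_le (h : OrbitProfile s q) (ω : Ω) :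
    orbitCharge s q (s ω) ≤ 2 * s ω ∨
      s ω = 4 ∧ (∃ i, q i = 4) ∧ (divisibleOrbits s 4).card = 2 := by
  unfold orbitCharge
  generalize hF : Finset.univ.filter (fun i => q i ∣ s ω) = F
  have h_mem : ∀ i, i ∈ F ↔ q i ∣ s ω := by simp [← hF]
  have h_pos := h.size_pos ω
  rcases lt_trichotomy F.card 1 with h₁ | h₁ | h₁
  · rw [Nat.lt_one_iff, Finset.card_eq_zero] at h₁
    simp [h₁]
  · obtain ⟨i, rfl⟩ := Finset.card_eq_one.1 h₁
    rw [Finset.sum_singleton]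
    have hi : q i ∣ s ω := (h_mem i).1 (by simp)
    obtain ⟨t, ht⟩ := id hi
    have ht₀ : t ≠ 0 := by
      rintro rfl
      omega
    have h_le := Nat.le_of_dvd h_pos hi
    have ht_le : 2 ≤ t → 2 * q i ≤ s ω := fun h₂ => by rw [ht]; nlinarith
    have h₂ := h.two_le i
    unfold orbitWeight
    split_ifs with h₃ h₄ h₅
    · omega
    · omega
    · by_cases h₆ : t = 1
      · rw [h₆, mul_one] at ht
        by_cases h₇ : q i = 4
        · exact Or.inr ⟨by omega, ⟨i, h₇⟩, by rw [← h₇]; exact h₅.2⟩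
        · exact absurd ht (h.ne_of_card_eq_two (by omega) hi h₅.2)
      · have := ht_le (by omega)
        omega
    · omega
  · left
    refine (h.sum_orbitWeight_le h_pos (fun i hi => (h_mem i).1 hi) ?_).2 h₁
    intro i hi h₂
    unfold orbitWeight
    rw [if_pos h₂]
    split_ifs with h₃
    · exfalso
      have h₄ := h.eq_two_of_card_eq_one ((h_mem i).1 hi) h₃
      obtain ⟨j, hj, hji⟩ := Finset.exists_mem_ne h₁ i
      have h₅ := (h_mem j).1 hj
      rw [h₄] at h₅
      have h₆ := Nat.le_of_dvd two_pos h₅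
      have h₇ := h.two_le j
      exact hji (h.eq_of_two_dvd (by omega) (by omega))
    · exact le_rfl

theorem orbitCharge_four_le (h : OrbitProfile s q) {i : ι} (hi : q i = 4) :
    orbitCharge s q 4 ≤ 12 := by
  refine (h.sum_orbitWeight_le (c := 4) (by norm_num) (by simp) fun j _ h₂ => ?_).1
  have := h.eq_of_two_dvd (i := i) (j := j) (by omega) (by omega)
  subst this
  omega

theorem orbitCharge_add_three_le_of_four_dvd (h : OrbitProfile s q) {i : ι} (hi : q i = 4) {ω : Ω}
    (hω : 4 ∣ s ω) (hω' : s ω ≠ 4) : orbitCharge s q (s ω) + 3 ≤ 2 * s ω := by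
  classical
  obtain ⟨t, ht⟩ := hω
  have h_pos := h.size_pos ω
  have h_odd : Odd (∏ j ∈ Finset.univ.erase i, q j) :=
    Finset.prod_induction _ Odd (fun _ _ => Odd.mul) odd_one
      fun j hj => h.odd_of_ne hi (Finset.ne_of_mem_erase hj)
  have ht_odd : Odd t := by
    refine h_odd.of_dvd_nat (Nat.dvd_of_mul_dvd_mul_left (k := 4) (by norm_num) ?_)
    rw [← ht, ← hi, Finset.mul_prod_erase _ _ (Finset.mem_univ i)]
    exact h.size_dvd ω
  have ht₃ : 3 ≤ t := by
    obtain ⟨u, rfl⟩ := ht_odd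
    omega
  have h_mem : i ∈ Finset.univ.filter (fun j => q j ∣ s ω) := by simp [hi, ht]
  have h_le : ∑ j ∈ (Finset.univ.filter (fun j => q j ∣ s ω)).erase i, orbitWeight s (q j)
      ≤ 3 * t := by
    refine (h.sum_orbitWeight_le (by omega) (fun j hj => ?_) fun j hj h₂ => ?_).1
    · have h₁ := h.odd_of_ne hi (Finset.ne_of_mem_erase hj)
      have h₂ := (Finset.mem_filter.1 (Finset.mem_of_mem_erase hj)).2
      rw [ht] at h₂
      have h₃ : Nat.Coprime (q j) (2 ^ 2) := Nat.Coprime.pow_right 2 (Nat.coprime_two_right.2 h₁)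
      exact h₃.dvd_of_dvd_mul_left h₂
    · have h₁ := h.odd_of_ne hi (Finset.ne_of_mem_erase hj)
      rw [h₂] at h₁
      exact absurd h₁ (by decide)
  have h₁ := orbitWeight_le (s := s) (q i) (h.two_le i)
  unfold orbitCharge
  rw [← Finset.add_sum_erase _ _ h_mem]
  omega

theorem orbitCharge_le_of_even (h : OrbitProfile s q) {i : ι} (hi : q i = 4) {ω : Ω}
    (hω : 2 ∣ s ω) (hω' : ¬ 4 ∣ s ω) :
    orbitCharge s q (s ω) + 3 ≤ 2 * s ω ∧
      ((∀ j, q j ≠ 3) → orbitCharge s q (s ω) + 4 ≤ 2 * s ω) := by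
  obtain ⟨c, hc⟩ := hω
  have h_pos := h.size_pos ω
  have h_odd : ∀ j, q j ∣ s ω → Odd (q j) := by
    intro j hj
    refine h.odd_of_ne hi ?_
    rintro rfl
    exact hω' (hi ▸ hj)
  have h_dvd : ∀ j, q j ∣ s ω → q j ∣ c := fun j hj =>
    (Nat.coprime_two_right.2 (h_odd j hj)).dvd_of_dvd_mul_left (hc ▸ hj)
  have h_le : orbitCharge s q (s ω) ≤ 3 * c := by
    refine (h.sum_orbitWeight_le (by omega) (fun j hj => ?_) fun j hj h₂ => ?_).1
    · exact h_dvd j (Finset.mem_filter.1 hj).2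
    · have h₁ := h_odd j (Finset.mem_filter.1 hj).2
      rw [h₂] at h₁
      exact absurd h₁ (by decide)
  have h_zero : (∀ j, ¬ q j ∣ c) → orbitCharge s q (s ω) = 0 := by
    intro H
    unfold orbitCharge
    rw [Finset.filter_false_of_mem fun j _ hj => H j (h_dvd j hj), Finset.sum_empty]
  have h_c : c = 1 ∨ c = 3 ∨ 4 ≤ c := by omega
  rcases h_c with rfl | rfl | h₄
  · have := h_zero fun j hj => by
      have := Nat.le_of_dvd one_pos hj
      have := h.two_le j
      omega
    omega
  · refine ⟨by omega, fun H => ?_⟩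
    have := h_zero fun j hj => by
      rcases (Nat.dvd_prime Nat.prime_three).1 hj with h₅ | h₅
      · have := h.two_le j
        omega
      · exact H j h₅
    omega
  · exact ⟨by omega, fun _ => by omega⟩

theorem sum_le_card (h : OrbitProfile s q) :
    ∑ i, b (q i) * q i ≤ ∑ ω, s ω + 1 ∧
      ((∀ i, q i ≠ 3) ∨ (∀ i, q i ≠ 4) → ∑ i, b (q i) * q i ≤ ∑ ω, s ω) := by
  classical
  have h_two := h.two_mul_sum_le
  let f : Ω → ℤ := fun ω => 2 * s ω - orbitCharge s q (s ω)
  have hf : ∑ ω, f ω = 2 * (∑ ω, s ω : ℕ) - (∑ ω, orbitCharge s q (s ω) : ℕ) := by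
    simp only [f, Finset.sum_sub_distrib, ← Finset.mul_sum, Nat.cast_sum]
  by_cases h_exc : ∀ ω, 0 ≤ f ω
  · have := Finset.sum_nonneg fun ω (_ : ω ∈ Finset.univ) => h_exc ω
    omega
  push Not at h_exc
  obtain ⟨ω₁, hω₁⟩ := h_exc
  have h_neg : ∀ ω, f ω < 0 → s ω = 4 ∧ (∃ i, q i = 4) ∧ (divisibleOrbits s 4).card = 2 := by
    intro ω hω
    refine (h.orbitCharge_le ω).resolve_left fun H => ?_
    simp only [f] at hω
    omega
  obtain ⟨h_four, ⟨i, hi⟩, h_card⟩ := h_neg ω₁ hω₁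
  have h_charge := h.orbitCharge_four_le hi
  obtain ⟨ω₂, hω₂⟩ := Finset.card_eq_one.1 (show ((divisibleOrbits s 4).erase ω₁).card = 1 by
    rw [Finset.card_erase_of_mem (by simp [divisibleOrbits, h_four]), h_card])
  have h_mem : ∀ ω, ω ≠ ω₁ ∧ 4 ∣ s ω ↔ ω = ω₂ := by
    intro ω
    have := congrArg (ω ∈ ·) hω₂
    simpa [divisibleOrbits] using this
  obtain ⟨h_ne, h_dvd⟩ := (h_mem ω₂).2 rfl
  have h_only : ∀ ω, 4 ∣ s ω → ω = ω₁ ∨ ω = ω₂ := by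
    intro ω hω
    by_cases h₁ : ω = ω₁
    · exact Or.inl h₁
    · exact Or.inr ((h_mem ω).1 ⟨h₁, hω⟩)
  have h_nonneg : ∀ ω, ω ≠ ω₁ → ω ≠ ω₂ → 0 ≤ f ω := by
    intro ω h₁ h₂
    by_contra! H
    exact (h_only ω (by rw [(h_neg ω H).1])).elim h₁ h₂
  by_cases h₂ : s ω₂ = 4
  · obtain ⟨x, y, hxy, ⟨hx₂, hx₄⟩, hy₂, hy₄⟩ :=
      h.pair_four i hi ω₁ ω₂ h_ne.symm h_four h₂ h_only
    have h_sum : ∑ ω ∈ {ω₁, ω₂, x, y}, f ω ≤ ∑ ω, f ω := by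
      refine Finset.sum_le_sum_of_subset_of_nonneg (Finset.subset_univ _) fun ω _ hω => ?_
      simp only [Finset.mem_insert, not_or] at hω
      exact h_nonneg ω hω.1 hω.2.1
    have h₄ : ∀ ω, s ω = 4 → ∀ z, ¬ 4 ∣ s z → ω ≠ z := by
      rintro ω hω z hz rfl
      exact hz (by rw [hω])
    rw [Finset.sum_insert, Finset.sum_insert, Finset.sum_pair hxy] at h_sum
    · have hx := h.orbitCharge_le_of_even hi hx₂ hx₄
      have hy := h.orbitCharge_le_of_even hi hy₂ hy₄
      simp only [f, h_four, h₂] at h_sum hf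
      refine ⟨by omega, fun h_or => ?_⟩
      have h_three := h_or.resolve_right fun H => H i hi
      have := hx.2 h_three
      have := hy.2 h_three
      omega
    · simp [h₄ ω₂ h₂ x hx₄, h₄ ω₂ h₂ y hy₄]
    · simp [h₄ ω₁ h_four x hx₄, h₄ ω₁ h_four y hy₄, h_ne.symm]
  · have h_sum : ∑ ω ∈ {ω₁, ω₂}, f ω ≤ ∑ ω, f ω := by
      refine Finset.sum_le_sum_of_subset_of_nonneg (Finset.subset_univ _) fun ω _ hω => ?_
      simp only [Finset.mem_insert, Finset.mem_singleton, not_or] at hω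
      exact h_nonneg ω hω.1 hω.2
    rw [Finset.sum_pair h_ne.symm] at h_sum
    have := h.orbitCharge_add_three_le_of_four_dvd hi h_dvd h₂
    simp only [f, h_four] at h_sum hf
    omega

end OrbitProfile

end Counting

section OrbitCount

open Function

variable {P : Type} [PartialOrder P] {g : P ≃o P} {n : ℕ}

namespace IsCyclicGenerator

/-- The setoid whose classes are the orbits of `g`. -/
def orbitSetoid (h : IsCyclicGenerator g n) : Setoid P := ⟨SameOrbit g, h.equivalence_sameOrbit⟩

/-- The size of an orbit of `g`. -/
noncomputable def orbitSize (h : IsCyclicGenerator g n) : Quotient h.orbitSetoid → ℕ :=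
  Quotient.lift (minimalPeriod g) fun _ _ hxy => (h.period_eq_of_sameOrbit hxy).symm

theorem card_eq_sum_orbitSize [Fintype P] (h : IsCyclicGenerator g n)
    [Fintype (Quotient h.orbitSetoid)] : Fintype.card P = ∑ ω, h.orbitSize ω := by
  classical
  rw [← Finset.card_univ, Finset.card_eq_sum_card_fiberwise (t := Finset.univ)
    (f := fun x => (Quotient.mk h.orbitSetoid x)) (fun _ _ => Finset.mem_coe.2 (Finset.mem_univ _))]
  refine Finset.sum_congr rfl fun ω _ => ?_
  induction ω using Quotient.inductionOn with | h x => ?_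
  have h_image : ({y | Quotient.mk h.orbitSetoid y = Quotient.mk h.orbitSetoid x} : Finset P) =
      (Finset.range (minimalPeriod g x)).image fun i => g^[i] x := by
    ext y
    rw [Finset.mem_filter_univ, eq_comm, Quotient.eq, Finset.mem_image]
    constructor
    · rintro ⟨k, rfl⟩
      exact ⟨k % minimalPeriod g x, Finset.mem_range.2 (Nat.mod_lt _ (h.period_pos x)),
        iterate_mod_minimalPeriod_eq⟩
    · rintro ⟨k, -, rfl⟩
      exact ⟨k, rfl⟩
  rw [h_image, Finset.card_image_of_injOn, Finset.card_range]
  · rfl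
  · intro i hi j hj hij
    rw [Finset.coe_range, Set.mem_Iio] at hi hj
    exact (iterate_eq_iterate_iff.1 hij).eq_of_lt_of_lt hi hj

theorem orbitProfile [Finite P] (h : IsCyclicGenerator g n) {ι : Type*} [Fintype ι] {p r : ι → ℕ}
    (hp : ∀ i, (p i).Prime) (hr : ∀ i, 1 ≤ r i) (hinj : Injective p) (hn : n = ∏ i, p i ^ r i) :
    OrbitProfile h.orbitSize fun i => p i ^ r i := by
  classical
  have h_coprime : ∀ i j, i ≠ j → (p i ^ r i).Coprime (p j ^ r j) := fun i j hij =>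
    Nat.Coprime.pow _ _ ((Nat.coprime_primes (hp i) (hp j)).2 (hinj.ne hij))
  have h_split : ∀ i, ∃ m, n = p i ^ r i * m ∧ (p i ^ r i).Coprime m := fun i =>
    ⟨∏ j ∈ Finset.univ.erase i, p j ^ r j, by
      rw [hn, ← Finset.mul_prod_erase _ _ (Finset.mem_univ i)],
      Nat.Coprime.prod_right fun j hj => h_coprime i j (Finset.ne_of_mem_erase hj).symm⟩
  have h_succ : ∀ i, ∃ r', r i = r' + 1 := fun i => ⟨r i - 1, (Nat.sub_add_cancel (hr i)).symm⟩
  have h_eq : ∀ x y : P, Quotient.mk h.orbitSetoid x = Quotient.mk h.orbitSetoid y ↔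
      SameOrbit g x y := fun x y => Quotient.eq
  have h_ne : ∀ x y : P, Quotient.mk h.orbitSetoid x ≠ Quotient.mk h.orbitSetoid y →
      ¬ SameOrbit g x y := fun x y hxy H => hxy ((h_eq x y).2 H)
  refine ⟨?_, ?_, ?_, h_coprime, ?_, ?_, ?_, ?_⟩
  · rintro ⟨x⟩
    exact h.period_pos x
  · rintro ⟨x⟩
    rw [← hn]
    exact h.period_dvd x
  · intro i
    obtain ⟨r', hr'⟩ := h_succ i
    rw [hr', pow_succ]
    exact (hp i).two_le.trans (Nat.le_mul_of_pos_left _ (pow_pos (hp i).pos _))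
  · intro i
    obtain ⟨r', hr'⟩ := h_succ i
    obtain ⟨m, hm, -⟩ := h_split i
    rw [hr'] at hm ⊢
    obtain ⟨x, hx⟩ := h.exists_primePow_dvd_period (hp i) hm
    exact ⟨Quotient.mk _ x, hx⟩
  · rintro i ⟨x⟩ hx h_unique
    obtain ⟨r', hr'⟩ := h_succ i
    obtain ⟨m, hm, h_cop⟩ := h_split i
    simp only [hr'] at hm h_cop hx h_unique
    refine h.period_eq_two_of_unique_orbit (hp i) hm ?_ hx fun y hy =>
      (h_eq x y).1 (h_unique (Quotient.mk _ y) hy).symm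
    rwa [← (hp i).coprime_iff_not_dvd, ← Nat.coprime_pow_left_iff (Nat.succ_pos r')]
  · rintro i h_or ⟨x⟩ ⟨y⟩ hxy hy h_two hx
    obtain ⟨m, hm, h_cop⟩ := h_split i
    generalize p i ^ r i = q at *
    have h_two' : ∀ z, q ∣ minimalPeriod g z → SameOrbit g x z ∨ SameOrbit g y z := fun z hz =>
      (h_two (Quotient.mk _ z) hz).imp (fun H => (h_eq x z).1 H.symm) fun H => (h_eq y z).1 H.symm
    have h_gcd : (minimalPeriod g x).gcd (minimalPeriod g y) = q := by
      change minimalPeriod g x = q at hx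
      rw [hx]
      exact Nat.gcd_eq_left hy
    rcases h_or with rfl | rfl | rfl
    · exact h.gcd_period_ne_of_forall_exists_affine (by norm_num) hm h_cop
        exists_affine_zmod_three (h_ne x y hxy) h_two' h_gcd
    · exact h.gcd_period_ne_of_forall_exists_affine (by norm_num) hm h_cop
        exists_affine_zmod_five (h_ne x y hxy) h_two' h_gcd
    · exact h.gcd_period_ne_of_forall_exists_affine (by norm_num) hm h_cop
        exists_affine_zmod_seven (h_ne x y hxy) h_two' h_gcd
  · rintro i hi ⟨x⟩ ⟨y⟩ hxy hx hy h_two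
    obtain ⟨m, hm, h_cop⟩ := h_split i
    change p i ^ r i = 4 at hi
    rw [hi] at hm h_cop
    have h_odd : Odd m := Nat.coprime_two_left.1 (Nat.Coprime.coprime_dvd_left (by norm_num) h_cop)
    obtain ⟨z, w, hzw, hz, hw⟩ := h.exists_even_periods hm h_odd (h_ne x y hxy) hx hy fun z hz =>
      (h_two (Quotient.mk _ z) hz).imp (fun H => (h_eq x z).1 H.symm) fun H => (h_eq y z).1 H.symm
    exact ⟨Quotient.mk _ z, Quotient.mk _ w, fun H => hzw ((h_eq z w).1 H), hz, hw⟩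

end IsCyclicGenerator

end OrbitCount

section Main

variable {ι : Type*} {p r : ι → ℕ}

theorem realizesCyclic_prod_primePow (hp : ∀ i, (p i).Prime) (hr : ∀ i, 1 ≤ r i)
    (hinj : Function.Injective p) (F : Finset ι) :
    RealizesCyclic (∏ i ∈ F, p i ^ r i) (∑ i ∈ F, b (p i ^ r i) * p i ^ r i) := by
  classical
  induction F using Finset.induction_on with
  | empty => simpa using realizesCyclic_one
  | insert i F hi ih =>
    rw [Finset.prod_insert hi, Finset.sum_insert hi]
    refine (realizesCyclic_of_isPrimePow
      ((hp i).isPrimePow.pow (Nat.one_le_iff_ne_zero.1 (hr i)))).mul ih ?_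
    refine Nat.Coprime.prod_right fun j hj => Nat.Coprime.pow _ _ ?_
    exact (Nat.coprime_primes (hp i) (hp j)).2 (hinj.ne fun H => hi (H ▸ hj))

theorem exists_primePow_eq_of_exactDvd [Fintype ι] (hp : ∀ i, (p i).Prime)
    (hinj : Function.Injective p) {n q a : ℕ} (hn : n = ∏ i, p i ^ r i) (hq : q.Prime)
    (ha : 1 ≤ a) (h_dvd : q ^ a ∣ n) (h_not : ¬ q ^ (a + 1) ∣ n) : ∃ i, p i ^ r i = q ^ a := by
  classical
  obtain ⟨i, -, hi⟩ := (hq.prime.dvd_finsetProd_iff _).1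
    (hn ▸ (dvd_pow_self q (Nat.one_le_iff_ne_zero.1 ha)).trans h_dvd)
  have hqi : q = p i := (Nat.prime_dvd_prime_iff_eq hq (hp i)).1 (hq.dvd_of_dvd_pow hi)
  subst hqi
  rw [hn, ← Finset.mul_prod_erase _ _ (Finset.mem_univ i)] at h_dvd h_not
  have h_cop : ∀ e, (p i ^ e).Coprime (∏ j ∈ Finset.univ.erase i, p j ^ r j) := fun e =>
    Nat.Coprime.prod_right fun j hj => Nat.Coprime.pow _ _
      ((Nat.coprime_primes (hp i) (hp j)).2 (hinj.ne (Finset.ne_of_mem_erase hj).symm))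
  have h₁ := (Nat.pow_dvd_pow_iff_le_right (hp i).one_lt).1 ((h_cop a).dvd_of_dvd_mul_right h_dvd)
  have h₂ : ¬ a + 1 ≤ r i := fun H => h_not ((pow_dvd_pow (p i) H).mul_right _)
  exact ⟨i, by congr 1; omega⟩

theorem exists_eq_three_and_eq_four [Fintype ι] (hp : ∀ i, (p i).Prime)
    (hinj : Function.Injective p) {n : ℕ} (hn : n = ∏ i, p i ^ r i)
    (h_exact : ExactDvd 3 n ∧ ExactDvd 4 n) :
    (∃ i, p i ^ r i = 3) ∧ ∃ i, p i ^ r i = 4 := by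
  obtain ⟨⟨h₁, h₂⟩, h₃, h₄⟩ := h_exact
  rw [show Nat.minFac 3 = 3 by norm_num] at h₂
  rw [show Nat.minFac 4 = 2 by norm_num] at h₄
  exact ⟨exists_primePow_eq_of_exactDvd (a := 1) hp hinj hn Nat.prime_three le_rfl h₁ h₂,
    exists_primePow_eq_of_exactDvd (a := 2) hp hinj hn Nat.prime_two one_le_two h₃ h₄⟩

theorem exactDvd_of_primePow_eq [Fintype ι] (hp : ∀ i, (p i).Prime) (hr : ∀ i, 1 ≤ r i)
    (hinj : Function.Injective p) {n : ℕ} (hn : n = ∏ i, p i ^ r i) (i : ι) :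
    ExactDvd (p i ^ r i) n := by
  classical
  rw [hn, ← Finset.mul_prod_erase _ _ (Finset.mem_univ i)]
  refine ⟨dvd_mul_right _ _, fun H => ?_⟩
  rw [(hp i).pow_minFac (Nat.one_le_iff_ne_zero.1 (hr i))] at H
  have h₁ := Nat.dvd_of_mul_dvd_mul_left (pow_pos (hp i).pos _) H
  obtain ⟨j, hj, h₂⟩ := ((hp i).prime.dvd_finsetProd_iff _).1 h₁
  exact Finset.ne_of_mem_erase hj (hinj ((Nat.prime_dvd_prime_iff_eq (hp i) (hp j)).1
    ((hp i).dvd_of_dvd_pow h₂))).symm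

theorem realizesCyclic_min [Fintype ι] (hp : ∀ i, (p i).Prime) (hr : ∀ i, 1 ≤ r i)
    (hinj : Function.Injective p) {n : ℕ} (hn : n = ∏ i, p i ^ r i) :
    RealizesCyclic n (if ExactDvd 3 n ∧ ExactDvd 4 n then (∑ i, b (p i ^ r i) * p i ^ r i) - 1
      else ∑ i, b (p i ^ r i) * p i ^ r i) := by
  classical
  split_ifs with h_exact
  · obtain ⟨⟨i, hi⟩, j, hj⟩ := exists_eq_three_and_eq_four hp hinj hn h_exact
    have hij : j ≠ i := by
      rintro rfl
      omega
    have hj_mem : j ∈ Finset.univ.erase i := Finset.mem_erase.2 ⟨hij, Finset.mem_univ j⟩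
    have h₁ : n = 12 * ∏ l ∈ (Finset.univ.erase i).erase j, p l ^ r l := by
      rw [hn, ← Finset.mul_prod_erase _ _ (Finset.mem_univ i), ← Finset.mul_prod_erase _ _ hj_mem,
        hi, hj, ← mul_assoc]
      rfl
    have h₂ : ∑ l, b (p l ^ r l) * p l ^ r l - 1 =
        20 + ∑ l ∈ (Finset.univ.erase i).erase j, b (p l ^ r l) * p l ^ r l := by
      rw [← Finset.add_sum_erase _ _ (Finset.mem_univ i), ← Finset.add_sum_erase _ _ hj_mem, hi, hj]
      have h₃ : b 3 = 3 := rfl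
      have h₄ : b 4 = 3 := rfl
      rw [h₃, h₄]
      omega
    rw [h₁, h₂]
    refine realizesCyclic_twelve.mul (realizesCyclic_prod_primePow hp hr hinj _) ?_
    refine Nat.Coprime.prod_right fun l hl => ?_
    have h_cop : ∀ l', l ≠ l' → (p l' ^ r l').Coprime (p l ^ r l) := fun l' hl' =>
      Nat.Coprime.pow _ _ ((Nat.coprime_primes (hp l') (hp l)).2 (hinj.ne hl'.symm))
    have h₃ := h_cop j (Finset.ne_of_mem_erase hl)
    have h₄ := h_cop i (Finset.ne_of_mem_erase (Finset.mem_of_mem_erase hl))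
    rw [hj] at h₃
    rw [hi] at h₄
    exact Nat.Coprime.mul_left h₄ h₃
  · rw [hn]
    exact realizesCyclic_prod_primePow hp hr hinj Finset.univ

theorem le_card_of_realizesCyclic [Fintype ι] (hp : ∀ i, (p i).Prime) (hr : ∀ i, 1 ≤ r i)
    (hinj : Function.Injective p) {n m : ℕ} (hn : n = ∏ i, p i ^ r i) (h : RealizesCyclic n m) :
    (if ExactDvd 3 n ∧ ExactDvd 4 n then (∑ i, b (p i ^ r i) * p i ^ r i) - 1
      else ∑ i, b (p i ^ r i) * p i ^ r i) ≤ m := by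
  classical
  obtain ⟨P, _, _, rfl, ⟨e⟩⟩ := h
  have h_pos : 0 < n := hn ▸ Finset.prod_pos fun i _ => pow_pos (hp i).pos _
  obtain ⟨g, hg⟩ := exists_isCyclicGenerator h_pos e
  have : Fintype (Quotient hg.orbitSetoid) := Fintype.ofFinite _
  obtain ⟨h₁, h₂⟩ := (hg.orbitProfile hp hr hinj hn).sum_le_card
  rw [← hg.card_eq_sum_orbitSize] at h₁ h₂
  split_ifs with h_exact
  · omega
  · refine h₂ ?_
    by_contra! H
    obtain ⟨⟨i, hi⟩, j, hj⟩ := H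
    exact h_exact ⟨hi ▸ exactDvd_of_primePow_eq hp hr hinj hn i,
      hj ▸ exactDvd_of_primePow_eq hp hr hinj hn j⟩

end Main

/-- Let `n = p₁^{r₁} ⋯ p_k^{r_k}` with distinct primes `p_i` and `r_i ≥ 1` (the empty
product giving `n = 1`). The minimum number of points of a finite poset whose
automorphism group is isomorphic to `ℤ/nℤ` equals `(Σ b(p_i^{r_i})·p_i^{r_i}) - 1` if
`3 ∥ n` and `4 ∥ n`, and `Σ b(p_i^{r_i})·p_i^{r_i}` otherwise. -/
theorem smallest_poset_with_cyclic_aut (n k : ℕ) (p r : Fin k → ℕ)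
    (hp : ∀ i, (p i).Prime) (hr : ∀ i, 1 ≤ r i) (hinj : Function.Injective p)
    (hn : n = ∏ i, p i ^ r i) :
    IsLeast {m : ℕ | ∃ (P : Type) (instP : PartialOrder P) (instF : Fintype P),
        @Fintype.card P instF = m ∧
        Nonempty ((@OrderIso P P instP.toLE instP.toLE) ≃* Multiplicative (ZMod n))}
      (if ExactDvd 3 n ∧ ExactDvd 4 n then (∑ i, b (p i ^ r i) * p i ^ r i) - 1
       else ∑ i, b (p i ^ r i) * p i ^ r i) := by
  exact ⟨realizesCyclic_min hp hr hinj hn, fun _ h => le_card_of_realizesCyclic hp hr hinj hn h⟩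
end
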